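/- Let K be an algebraically closed field of characteristic zero and let F ∈ K[x_0,…,x_5] be homogeneous of degree d ≥ 5 such that the only common zero in K^6 of the partial derivatives ∂F/∂x_0,…,∂F/∂x_5 is the origin (i.e., the hypersurface X = {F = 0} ⊂ P^5 is smooth). Then the set of 3-dimensional K-linear subspaces W ⊆ K^6 on which F vanishes identically (equivalently, the set of projective 2-planes contained in X) is finite, of cardinality at most 120d^2 − 150d^3 + 35d^4. -/

import Mathlib

open MvPolynomial

theorem mv_taylor {R ι : Type*} [CommRing R] [Fintype ι] (f : MvPolynomial ι R) (P y : ι → R) (e : R) :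
    e ^ 2 ∣ eval (fun j => P j + e * y j) f - eval P f - e * ∑ j, eval P (pderiv j f) * y j := by
  classical
  induction f using MvPolynomial.induction_on with
  | C a => simp
  | add p q hp hq =>
    have := dvd_add hp hq
    refine this.trans (dvd_of_eq ?_)
    simp only [map_add, add_mul, Finset.sum_add_distrib]; ring
  | mul_X p i hp =>
    obtain ⟨u, hu⟩ := hp
    have hs : ∑ j, eval P (pderiv j (p * X i)) * y j = (∑ j, eval P (pderiv j p) * y j) * P i + eval P p * y i := by
      simp only [Derivation.leibniz, smul_eq_mul, map_add, map_mul, eval_X, add_mul, Finset.sum_add_distrib, pderiv_X]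
      rw [add_comm, Finset.sum_mul]
      congr 1
      · exact Finset.sum_congr rfl fun j _ => by ring
      · rw [Finset.sum_eq_single i]
        · simp
        · intro b _ hb; simp [hb.symm]
        · simp
    rw [hs]
    simp only [map_mul, eval_X]
    have : eval (fun j => P j + e * y j) p = eval P p + e * ∑ j, eval P (pderiv j p) * y j + e^2*u := by
      rw [← hu]; ring
    rw [this]
    exact ⟨(∑ j, eval P (pderiv j p) * y j) * y i + u * P i + u * e * y i, by ring⟩

theorem hensel_mv {k ι κ : Type*} [Field k] [Fintype ι] [Fintype κ]
    (hc : Fintype.card κ = Fintype.card ι) (f : κ → MvPolynomial ι (PowerSeries k)) (p : ι → k)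
    (hz : ∀ i, eval p (map PowerSeries.constantCoeff (f i)) = 0)
    (hnd : ∀ y : ι → k, (∀ i, ∑ j, eval p (pderiv j (map PowerSeries.constantCoeff (f i))) * y j = 0) → y = 0) :
    ∃ P : ι → PowerSeries k, (∀ j, PowerSeries.constantCoeff (P j) = p j) ∧ ∀ i, eval P (f i) = 0 := by
  classical
  let J : (ι → k) →ₗ[k] (κ → k) := LinearMap.pi fun i => ∑ j, (eval p (pderiv j (map PowerSeries.constantCoeff (f i)))) • LinearMap.proj j
  have hJ : ∀ y i, J y i = ∑ j, eval p (pderiv j (map PowerSeries.constantCoeff (f i))) * y j := by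
    intro y i; simp [J]
  have hinj : Function.Injective J := by
    rw [injective_iff_map_eq_zero]
    intro y hy
    exact hnd y fun i => by rw [← hJ, hy]; rfl
  have hsurj : Function.Surjective J := by
    refine (LinearMap.injective_iff_surjective_of_finrank_eq_finrank ?_).1 hinj
    simp [hc]
  -- evaluation commutes with constant coeff
  have hcc : ∀ (Q : ι → PowerSeries k) (g : MvPolynomial ι (PowerSeries k)), (∀ j, PowerSeries.constantCoeff (Q j) = p j) →
      PowerSeries.constantCoeff (eval Q g) = eval p (map PowerSeries.constantCoeff g) := by
    intro Q g hQ
    rw [eval_map, ← MvPolynomial.coe_eval₂Hom, ← RingHom.comp_apply]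
    congr 1
    ext <;> simp [hQ]
  have step : ∀ (n : ℕ) (Q : ι → PowerSeries k), (∀ j, PowerSeries.constantCoeff (Q j) = p j) →
      (∀ i, (PowerSeries.X ^ (n+1) : PowerSeries k) ∣ eval Q (f i)) →
      ∃ Q' : ι → PowerSeries k, (∀ j, PowerSeries.constantCoeff (Q' j) = p j) ∧
      (∀ i, (PowerSeries.X ^ (n+2) : PowerSeries k) ∣ eval Q' (f i)) ∧ ∀ j, (PowerSeries.X ^ (n+1) : PowerSeries k) ∣ Q' j - Q j := by
    intro n Q hQ hQf
    choose u hu using hQf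
    obtain ⟨y, hy⟩ := hsurj (fun i => - PowerSeries.constantCoeff (u i))
    refine ⟨fun j => Q j + PowerSeries.X ^ (n+1) * PowerSeries.C (y j), ?_, ?_, ?_⟩
    · intro j; simp [hQ]
    · intro i
      have h1 := mv_taylor (f i) Q (fun j => PowerSeries.C (y j)) (PowerSeries.X ^ (n+1))
      have h2 : (PowerSeries.X ^ (n+2) : PowerSeries k) ∣ eval Q (f i) + PowerSeries.X ^ (n+1) * ∑ j, eval Q (pderiv j (f i)) * PowerSeries.C (y j) := by
        rw [hu i, ← mul_add, pow_succ _ (n+1)]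
        refine mul_dvd_mul_left _ ?_
        rw [PowerSeries.X_dvd_iff]
        have h3 := congrFun hy i
        rw [hJ] at h3
        simp only [map_add, map_sum, map_mul, hcc Q _ hQ, PowerSeries.constantCoeff_C, ← pderiv_map]
        rw [h3]; ring
      have h4 : (PowerSeries.X ^ (n+2) : PowerSeries k) ∣ (PowerSeries.X ^ (n+1))^2 := by
        rw [← pow_mul]; exact pow_dvd_pow _ (by omega)
      have := dvd_add (h4.trans h1) h2
      refine this.trans (dvd_of_eq (by ring))
    · intro j; exact ⟨PowerSeries.C (y j), by ring⟩
  let T : ℕ → Type _ := fun n => {Q : ι → PowerSeries k // (∀ j, PowerSeries.constantCoeff (Q j) = p j) ∧ ∀ i, (PowerSeries.X ^ (n+1) : PowerSeries k) ∣ eval Q (f i)}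
  let S : ∀ n, T n := fun n => Nat.rec (motive := T) ⟨fun j => PowerSeries.C (p j), by simp, fun i => by
      change PowerSeries.X ^ (0+1) ∣ _
      rw [zero_add, pow_one, PowerSeries.X_dvd_iff, hcc _ _ (by simp)]; exact hz i⟩
    (fun n Q => ⟨(step n Q.1 Q.2.1 Q.2.2).choose, (step n Q.1 Q.2.1 Q.2.2).choose_spec.1, (step n Q.1 Q.2.1 Q.2.2).choose_spec.2.1⟩) n
  have hS : ∀ n j, (PowerSeries.X ^ (n+1) : PowerSeries k) ∣ (S (n+1)).1 j - (S n).1 j := fun n => 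
    (step n (S n).1 (S n).2.1 (S n).2.2).choose_spec.2.2
  have hS' : ∀ n m j, n ≤ m → (PowerSeries.X ^ (n+1) : PowerSeries k) ∣ (S m).1 j - (S n).1 j := by
    intro n m j h
    induction m, h using Nat.le_induction with
    | base => simp
    | succ m hm ih =>
      have := dvd_add ((pow_dvd_pow _ (by omega)).trans (hS m j)) ih
      refine this.trans (dvd_of_eq (by ring))
  let P : ι → PowerSeries k := fun j => PowerSeries.mk fun n => PowerSeries.coeff n ((S n).1 j)
  have hP : ∀ n j, (PowerSeries.X ^ (n+1) : PowerSeries k) ∣ P j - (S n).1 j := by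
    intro n j
    rw [PowerSeries.X_pow_dvd_iff]
    intro m hm
    have := hS' m n j (by omega)
    rw [PowerSeries.X_pow_dvd_iff] at this
    have := this m (by omega)
    simp only [map_sub, P, PowerSeries.coeff_mk] at this ⊢
    rw [← neg_eq_zero, ← this]; ring
  have hPc : ∀ n g, (PowerSeries.X ^ (n+1) : PowerSeries k) ∣ eval P g - eval (S n).1 g := by
    intro n g
    rw [← Ideal.mem_span_singleton, ← Ideal.Quotient.mk_eq_mk_iff_sub_mem]
    rw [← RingHom.comp_apply, ← RingHom.comp_apply]
    congr 1
    ext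
    · simp
    · simp only [RingHom.comp_apply, eval_X]
      rw [Ideal.Quotient.mk_eq_mk_iff_sub_mem, Ideal.mem_span_singleton]; exact hP n _
  refine ⟨P, ?_, ?_⟩
  · intro j
    rw [← (S 0).2.1 j]
    rw [← PowerSeries.coeff_zero_eq_constantCoeff_apply, ← PowerSeries.coeff_zero_eq_constantCoeff_apply]
    simp only [P, PowerSeries.coeff_mk]
  · intro i
    ext n
    have := dvd_add (hPc n (f i)) ((S n).2.2 i)
    rw [sub_add_cancel, PowerSeries.X_pow_dvd_iff] at this
    simpa using this n (by omega)

open MvPolynomial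

abbrev Sg := Bool × Fin 3

def mset (m : Bool → ℕ) : Set (Sg →₀ ℕ) := {α | ∀ s, ∑ j, α (s, j) ≤ m s}

theorem mset_finite (m : Bool → ℕ) : (mset m).Finite := by
  refine Set.Finite.subset (Set.finite_Iic (Finsupp.equivFunOnFinite.symm fun p : Sg => m p.1)) ?_
  intro α hα
  rw [Set.mem_Iic, Finsupp.le_def]
  rintro ⟨s, j⟩
  exact (Finset.single_le_sum (f := fun j => α (s, j)) (fun _ _ => Nat.zero_le _) (Finset.mem_univ j)).trans (hα s)

noncomputable def Fil (R : Type*) [CommSemiring R] (m : Bool → ℕ) : Submodule R (MvPolynomial Sg R) :=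
  restrictSupport R (mset m)

section Fil
variable {R : Type*} [CommSemiring R]

theorem Fil_mono {m n : Bool → ℕ} (h : m ≤ n) : Fil R m ≤ Fil R n :=
  restrictSupport_mono _ fun _ hα s => (hα s).trans (h s)

theorem Fil_mul {m n : Bool → ℕ} {f g : MvPolynomial Sg R} (hf : f ∈ Fil R m) (hg : g ∈ Fil R n) :
    f * g ∈ Fil R (m + n) := by
  have := Submodule.mul_mem_mul hf hg
  unfold Fil at this
  rw [← restrictSupport_add] at this
  refine restrictSupport_mono _ ?_ this
  rw [Set.add_subset_iff]
  intro x hx y hy s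
  simp only [Finsupp.add_apply, Finset.sum_add_distrib, Pi.add_apply]
  exact add_le_add (hx s) (hy s)

theorem Fil_C (m : Bool → ℕ) (r : R) : C r ∈ Fil R m := by
  unfold Fil
  rw [← monomial_zero', monomial_mem_restrictSupport]
  left; intro s; simp

theorem Fil_one (m : Bool → ℕ) : (1 : MvPolynomial Sg R) ∈ Fil R m := by
  have := Fil_C m (1 : R); rwa [C_1] at this

theorem Fil_X (s : Bool) (j : Fin 3) : (X (s, j) : MvPolynomial Sg R) ∈ Fil R (Pi.single s 1) := by
  unfold Fil
  rw [X, monomial_mem_restrictSupport]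
  left; intro s'
  by_cases h : s' = s
  · subst h
    simp [Finsupp.single_apply]
  · simp [Ne.symm h]

theorem Fil_map {S : Type*} [CommSemiring S] (φ : R →+* S) {m : Bool → ℕ} {f : MvPolynomial Sg R} (hf : f ∈ Fil R m) :
    map φ f ∈ Fil S m := by
  unfold Fil at *
  rw [mem_restrictSupport_iff] at *
  exact (Finset.coe_subset.2 (support_map_subset φ f)).trans hf

theorem Fil_zero : Fil R 0 ≤ Submodule.span R {1} := by
  unfold Fil
  rw [restrictSupport_eq_span, Submodule.span_le]
  rintro _ ⟨α, hα, rfl⟩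
  have : α = 0 := by
    ext ⟨s, j⟩
    have := (Finset.single_le_sum (f := fun j => α (s, j)) (fun _ _ => Nat.zero_le _) (Finset.mem_univ j)).trans (hα s)
    simpa using this
  subst this
  exact Submodule.subset_span rfl

/-- the coordinates `1, X (s,0), X(s,1), X(s,2)` -/
noncomputable def yv (R : Type*) [CommSemiring R] (s : Bool) : Fin 4 → MvPolynomial Sg R := Fin.cons 1 fun j => X (s, j)

theorem Fil_yv (s : Bool) (r : Fin 4) : yv R s r ∈ Fil R (Pi.single s 1) := by
  refine Fin.cases ?_ (fun j => ?_) r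
  · exact Fil_one _
  · exact Fil_X s j

theorem Fil_succ {m : Bool → ℕ} {s : Bool} (N : Submodule R (MvPolynomial Sg R))
    (h : ∀ r, ∀ q ∈ Fil R m, yv R s r * q ∈ N) : Fil R (m + Pi.single s 1) ≤ N := by
  conv_lhs => unfold Fil
  rw [restrictSupport_eq_span, Submodule.span_le]
  rintro _ ⟨α, hα, rfl⟩
  by_cases hm : ∑ j, α (s, j) ≤ m s
  · have := h 0 (monomial α 1) (by
      unfold Fil
      rw [monomial_mem_restrictSupport]
      left
      intro s'
      by_cases hs : s' = s
      · subst hs; exact hm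
      · have := hα s'; simpa [hs] using this)
    simpa [yv] using this
  · have : ∃ j, α (s, j) ≠ 0 := by
      by_contra hj
      push Not at hj
      simp [hj] at hm
    obtain ⟨j, hj⟩ := this
    have h2 : α = Finsupp.single (s, j) 1 + (α - Finsupp.single (s,j) 1) := by
      rw [add_tsub_cancel_of_le]
      rw [Finsupp.single_le_iff]; omega
    set β := α - Finsupp.single (s,j) 1
    have := h j.succ (monomial β 1) (by
      unfold Fil
      rw [monomial_mem_restrictSupport]
      left
      intro s'
      have := hα s'
      rw [h2] at this
      simp only [Finsupp.add_apply, Finset.sum_add_distrib, Pi.add_apply] at this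
      by_cases hs : s' = s
      · subst hs; simp [Finsupp.single_apply] at this; omega
      · simp [hs] at this; omega)
    simp only [yv, Fin.cons_succ, X, monomial_mul, one_mul] at this
    rw [← h2] at this
    exact this
end Fil

/-- linear form -/
noncomputable def lf (k : Type*) [CommSemiring k] (s : Bool) (c : ℕ) : MvPolynomial Sg k := ∑ r : Fin 4, C ((c : k) ^ (r : ℕ)) * yv k s r

theorem lf_zero (k : Type*) [CommSemiring k] (s : Bool) : lf k s 0 = 1 := by
  simp [lf, Fin.sum_univ_succ, yv]

theorem Fil_lf (k : Type*) [CommSemiring k] (s : Bool) (c : ℕ) : lf k s c ∈ Fil k (Pi.single s 1) := by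
  refine Submodule.sum_mem _ fun r _ => ?_
  have := Fil_mul (Fil_C 0 ((c : k) ^ (r : ℕ))) (Fil_yv s r)
  rwa [zero_add] at this

theorem yv_eq (k : Type*) [Field k] [CharZero k] (s : Bool) (c : Fin 4 → ℕ) (hc : Function.Injective c) (r : Fin 4) :
    ∃ a : Fin 4 → k, yv k s r = ∑ i, C (a i) * lf k s (c i) := by
  have hd : (Matrix.vandermonde (fun i => (c i : k))).det ≠ 0 := by
    rw [Matrix.det_vandermonde_ne_zero_iff]
    exact Nat.cast_injective.comp hc
  set V := Matrix.vandermonde (fun i => (c i : k)) with hV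
  have h1 : V⁻¹ * V = 1 := Matrix.nonsing_inv_mul _ (isUnit_iff_ne_zero.2 hd)
  refine ⟨fun i => V⁻¹ r i, ?_⟩
  simp only [lf, Finset.mul_sum, ← mul_assoc, ← C_mul]
  rw [Finset.sum_comm]
  simp only [← Finset.sum_mul, ← map_sum]
  have : ∀ x : Fin 4, ∑ i, V⁻¹ r i * (c i : k) ^ (x : ℕ) = (1 : Matrix _ _ k) r x := by
    intro x
    rw [← h1, Matrix.mul_apply]
    rfl
  simp only [this, Matrix.one_apply]
  simp

abbrev Pat := Fin 6 → Bool → Finset ℕ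

def cd (T : Bool → Finset ℕ) : Bool → ℕ := fun s => (T s).card

noncomputable def gg (k : Type*) [CommSemiring k] (T : Bool → Finset ℕ) : MvPolynomial Sg k := ∏ s, ∏ c ∈ T s, lf k s c

theorem Fil_gg (k : Type*) [CommSemiring k] (T : Bool → Finset ℕ) : gg k T ∈ Fil k (cd T) := by
  have h1 : ∀ s (A : Finset ℕ), ∏ c ∈ A, lf k s c ∈ Fil k (Pi.single s A.card) := by
    intro s A
    induction A using Finset.induction_on with
    | empty => simp [Fil_one]
    | insert a A ha ih =>
      rw [Finset.prod_insert ha, Finset.card_insert_of_notMem ha, add_comm, Pi.single_add]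
      exact Fil_mul (Fil_lf k s a) ih
  have := Fil_mul (h1 true (T true)) (h1 false (T false))
  unfold gg
  rw [Fintype.prod_bool]
  convert this
  funext s
  cases s <;> simp [cd]

section
variable (k : Type*) [Field k]

noncomputable def UU (m : Bool → ℕ) (T : Pat) : Submodule k (MvPolynomial Sg k) :=
  ⨆ i, (Fil k (m - cd (T i))).map (LinearMap.mulLeft k (gg k (T i)))

variable {k}
theorem mem_UU {m : Bool → ℕ} {T : Pat} (i : Fin 6) {n : Bool → ℕ} (h : n + cd (T i) ≤ m) {q : MvPolynomial Sg k}
    (hq : q ∈ Fil k n) : gg k (T i) * q ∈ UU k m T := by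
  refine Submodule.mem_iSup_of_mem i ⟨q, Fil_mono ?_ hq, rfl⟩
  exact le_tsub_of_add_le_right h

theorem UU_le {m : Bool → ℕ} {T : Pat} {N : Submodule k (MvPolynomial Sg k)}
    (h : ∀ i, ∀ q ∈ Fil k (m - cd (T i)), gg k (T i) * q ∈ N) : UU k m T ≤ N := by
  refine iSup_le fun i => ?_
  rintro _ ⟨q, hq, rfl⟩
  exact h i q hq

variable (k)
def Cover (m : Bool → ℕ) (T : Pat) (c : ℕ) : Prop :=
  ∃ Q : Finset (MvPolynomial Sg k), Q.card ≤ c ∧ Fil k m ≤ UU k m T ⊔ Submodule.span k Q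

variable {k}

theorem gg_single (s : Bool) (c : ℕ) : gg k (Function.update (fun _ => ∅) s {c}) = lf k s c := by
  unfold gg
  rw [Fintype.prod_bool]
  cases s <;> simp [Function.update]

theorem cd_single (s : Bool) (c : ℕ) : cd (Function.update (fun _ => ∅) s {c}) = Pi.single s 1 := by
  funext s'
  cases s <;> cases s' <;> simp [cd, Function.update]

theorem gg_erase (T : Bool → Finset ℕ) (s : Bool) (c : ℕ) (hc : c ∈ T s) :
    lf k s c * gg k (Function.update T s ((T s).erase c)) = gg k T := by
  unfold gg
  rw [Fintype.prod_bool, Fintype.prod_bool]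
  cases s
  · simp [Function.update, ← Finset.mul_prod_erase _ _ hc]; ring
  · simp [Function.update, ← Finset.mul_prod_erase _ _ hc]; ring

theorem cd_erase (T : Bool → Finset ℕ) (s : Bool) (c : ℕ) (hc : c ∈ T s) :
    cd T = cd (Function.update T s ((T s).erase c)) + Pi.single s 1 := by
  have := Finset.card_pos.2 ⟨c, hc⟩
  funext s'
  cases s <;> cases s' <;> simp [cd, Function.update, Finset.card_erase_of_mem hc] <;> omega

theorem split_cover {m' : Bool → ℕ} {T : Pat} {i : Fin 6} {s : Bool} {c : ℕ} (hc : c ∈ T i s)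
    (hm : ∀ j, j ≠ i → cd (T j) ≤ m') {c1 c2 : ℕ}
    (h1 : Cover k (m' + Pi.single s 1) (Function.update T i (Function.update (fun _ => ∅) s {c})) c1)
    (h2 : Cover k m' (Function.update T i (Function.update (T i) s ((T i s).erase c))) c2) :
    Cover k (m' + Pi.single s 1) T (c1 + c2) := by
  classical
  obtain ⟨Q1, hQ1, h1⟩ := h1
  obtain ⟨Q2, hQ2, h2⟩ := h2
  set Q3 := Q2.image (fun q => lf k s c * q) with hQ3
  refine ⟨Q1 ∪ Q3, (Finset.card_union_le _ _).trans (add_le_add hQ1 (Finset.card_image_le.trans hQ2)), ?_⟩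
  have key : UU k (m' + Pi.single s 1) (Function.update T i (Function.update (fun _ => ∅) s {c})) ≤ UU k (m' + Pi.single s 1) T ⊔ Submodule.span k Q3 := by
    refine UU_le fun j q hq => ?_
    by_cases hj : j = i
    · subst hj
      rw [Function.update_self, cd_single, add_tsub_cancel_right] at hq
      rw [Function.update_self, gg_single]
      have hq' := h2 hq
      rw [Submodule.mem_sup] at hq'
      obtain ⟨u, hu, w, hw, rfl⟩ := hq'
      rw [mul_add]
      refine Submodule.add_mem_sup ?_ ?_
      · have : UU k m' (Function.update T j (Function.update (T j) s ((T j s).erase c))) ≤ (UU k (m' + Pi.single s 1) T).comap (LinearMap.mulLeft k (lf k s c)) := by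
          refine UU_le fun j' q hq => ?_
          rw [Submodule.mem_comap, LinearMap.mulLeft_apply]
          by_cases hj : j' = j
          · subst hj
            rw [Function.update_self] at hq ⊢
            rw [← mul_assoc, gg_erase _ _ _ hc]
            refine Submodule.mem_iSup_of_mem j' ⟨q, ?_, rfl⟩
            rwa [cd_erase _ _ _ hc, add_tsub_add_eq_tsub_right]
          · rw [Function.update_of_ne hj] at hq ⊢
            rw [mul_left_comm]
            refine mem_UU j' ?_ (Fil_mul (Fil_lf k s c) hq)
            rw [add_assoc, tsub_add_cancel_of_le (hm _ hj), add_comm]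
        exact this hu
      · have : Submodule.span k (Q2 : Set (MvPolynomial Sg k)) ≤ (Submodule.span k (Q3 : Set (MvPolynomial Sg k))).comap (LinearMap.mulLeft k (lf k s c)) := by
          rw [Submodule.span_le]
          intro q hq
          exact Submodule.subset_span (Finset.mem_coe.2 (Finset.mem_image_of_mem _ hq))
        exact this hw
    · rw [Function.update_of_ne hj] at hq ⊢
      exact Submodule.mem_sup_left (Submodule.mem_iSup_of_mem j ⟨q, hq, rfl⟩)
  refine h1.trans ?_
  rw [Finset.coe_union, Submodule.span_union]
  refine sup_le (key.trans (sup_le le_sup_left ?_)) ?_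
  · exact le_sup_of_le_right le_sup_right
  · exact le_sup_of_le_right le_sup_left
end

noncomputable def MM (p : Fin 6 → Bool → ℕ) : ℕ :=
  (∏ i, (Polynomial.C (p i true) * Polynomial.X + Polynomial.C (p i false))).coeff 3

structure GoodPat (T : Pat) : Prop where
  disj : ∀ i j s, i ≠ j → Disjoint (T i s) (T j s)
  zero : ∀ i s, 0 ∉ T i s

theorem GoodPat.mono {T T' : Pat} (h : GoodPat T) (hT : ∀ i s, T' i s ⊆ T i s) : GoodPat T' :=
  ⟨fun i j s hij => (h.disj i j s hij).mono (hT i s) (hT j s), fun i s h0 => h.zero i s (hT i s h0)⟩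

theorem MM_split (T : Pat) (i : Fin 6) (s : Bool) (c : ℕ) (hc : c ∈ T i s) :
    MM (fun j => cd (T j)) = MM (fun j => cd (Function.update T i (Function.update (fun _ => ∅) s {c}) j)) +
      MM (fun j => cd (Function.update T i (Function.update (T i) s ((T i s).erase c)) j)) := by
  unfold MM
  rw [← Polynomial.coeff_add]
  congr 1
  have h : ∀ T' : Bool → Finset ℕ, ∏ j, (Polynomial.C (cd (Function.update T i T' j) true) * Polynomial.X + Polynomial.C (cd (Function.update T i T' j) false))
      = (Polynomial.C (cd T' true) * Polynomial.X + Polynomial.C (cd T' false)) * ∏ j ∈ Finset.univ \ {i}, (Polynomial.C (cd (T j) true) * Polynomial.X + Polynomial.C (cd (T j) false)) := by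
    intro T'
    rw [← Finset.prod_update_of_mem (Finset.mem_univ i)]
    refine Finset.prod_congr rfl fun j _ => ?_
    by_cases hj : j = i
    · subst hj; simp
    · simp [Function.update_of_ne hj]
  rw [h, h, ← add_mul]
  have := h (T i)
  rw [Function.update_eq_self] at this
  rw [this, cd_erase _ _ _ hc, cd_single]
  congr 1
  simp only [Pi.add_apply, map_add]
  ring

theorem cover_base (k : Type*) [Field k] [CharZero k] (T : Pat) (hT : GoodPat T) (m : Bool → ℕ) (s : Fin 6 → Bool) (c : Fin 6 → ℕ)
   (hs : ∀ i, T i = Function.update (fun _ => ∅) (s i) {c i}) (hm : ∀ s, 1 ≤ m s) : Cover k m T (MM fun i => cd (T i)) := by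
  classical
  have hU : ∀ i n, n + Pi.single (s i) 1 ≤ m → ∀ q ∈ Fil k n, lf k (s i) (c i) * q ∈ UU k m T := by
    intro i n hn q hq
    have := mem_UU (T := T) i (n := n) (m := m) (by rw [hs, cd_single]; exact hn) hq
    rwa [hs, gg_single] at this
  have hcs : ∀ i, c i ∈ T i (s i) := by intro i; rw [hs]; simp
  have hinj : ∀ i j, s i = s j → c i = c j → i = j := by
    intro i j h1 h2
    by_contra hne
    have := hT.disj i j (s i) hne
    rw [Finset.disjoint_left] at this
    refine this (hcs i) ?_
    rw [h1, h2]; exact hcs j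
  have hne0 : ∀ i, c i ≠ 0 := fun i h => hT.zero i (s i) (h ▸ hcs i)
  by_cases h4 : ∃ b, 4 ≤ (Finset.univ.filter fun i => s i = b).card
  · obtain ⟨b, hb⟩ := h4
    have : Nonempty (Fin 4 ↪ {i // s i = b}) := by
      apply Function.Embedding.nonempty_of_card_le
      rw [Fintype.card_fin, Fintype.card_subtype]; exact hb
    obtain ⟨e⟩ := this
    refine ⟨∅, Nat.zero_le _, ?_⟩
    simp only [Finset.coe_empty, Submodule.span_empty, sup_bot_eq]
    have hmm : m = (m - Pi.single b 1) + Pi.single b 1 := by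
      rw [tsub_add_cancel_of_le]
      intro s'; by_cases h : s' = b
      · subst h; simpa using hm s'
      · simp [h]
    rw [hmm]
    refine Fil_succ _ fun r q hq => ?_
    rw [← hmm]
    obtain ⟨a, ha⟩ := yv_eq k b (fun i => c (e i)) (fun i j hij => e.injective (Subtype.ext (hinj _ _ (by rw [(e i).2, (e j).2]) hij))) r
    rw [ha, Finset.sum_mul]
    refine Submodule.sum_mem _ fun i _ => ?_
    rw [mul_assoc, C_mul']
    refine Submodule.smul_mem _ _ ?_
    have := hU (e i) (m - Pi.single b 1) (by rw [(e i).2, ← hmm]) q hq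
    rwa [(e i).2] at this
  · push Not at h4
    have htot : (Finset.univ.filter fun i => s i = true).card + (Finset.univ.filter fun i => s i = false).card = 6 := by
      have := Finset.card_filter_add_card_filter_not (s := (Finset.univ : Finset (Fin 6))) (fun i => s i = true)
      simpa using this
    have h3t := h4 true
    have h3f := h4 false
    have h3 : ∀ b, (Finset.univ.filter fun i => s i = b).card = 3 := by
      intro b; cases b <;> omega
    have hM : MM (fun i => cd (T i)) = 1 := by
      have h0 : ∀ i, (Polynomial.C (cd (T i) true) * Polynomial.X + Polynomial.C (cd (T i) false) : Polynomial ℕ) = if s i = true then Polynomial.X else 1 := by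
        intro i
        rw [hs, cd_single]
        cases h : s i <;> simp
      unfold MM
      simp only [h0]
      rw [Finset.prod_ite]
      simp [h3]
    rw [hM]
    refine ⟨{1}, by simp, ?_⟩
    have key : ∀ N, ∀ n : Bool → ℕ, n ≤ m → n true + n false = N → Fil k n ≤ UU k m T ⊔ Fil k 0 := by
      intro N
      induction N with
      | zero =>
        intro n _ hn
        have : n = 0 := by funext b; cases b <;> simp <;> omega
        rw [this]; exact le_sup_right
      | succ N ih =>
        intro n hn hN
        have : ∃ b, 1 ≤ n b := by
          by_contra h
          push Not at h
          have h1 := h true; have h2 := h false; omega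
        obtain ⟨b, hb⟩ := this
        have hmm : n = (n - Pi.single b 1) + Pi.single b 1 := by
          rw [tsub_add_cancel_of_le]
          intro s'; by_cases h : s' = b
          · subst h; simpa using hb
          · simp [h]
        have : Nonempty (Fin 3 ↪ {i // s i = b}) := by
          apply Function.Embedding.nonempty_of_card_le
          rw [Fintype.card_fin, Fintype.card_subtype, h3]
        obtain ⟨e⟩ := this
        have ih' := ih (n - Pi.single b 1) (tsub_le_self.trans hn) (by
          cases b <;> simp <;> omega)
        rw [hmm]
        refine Fil_succ _ fun r q hq => ?_
        obtain ⟨a, ha⟩ := yv_eq k b (Fin.cons 0 (fun i => c (e i))) (by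
          rw [Fin.cons_injective_iff]
          refine ⟨?_, fun i j hij => e.injective (Subtype.ext (hinj _ _ (by rw [(e i).2, (e j).2]) hij))⟩
          rintro ⟨i, hi⟩
          exact hne0 _ hi) r
        rw [ha, Fin.sum_univ_succ, add_mul, Finset.sum_mul]
        refine Submodule.add_mem _ ?_ (Submodule.sum_mem _ fun i _ => ?_)
        · rw [mul_assoc, C_mul', Fin.cons_zero, lf_zero, one_mul]
          exact Submodule.smul_mem _ _ (ih' hq)
        · rw [mul_assoc, C_mul', Fin.cons_succ]
          refine Submodule.smul_mem _ _ (Submodule.mem_sup_left ?_)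
          have := hU (e i) (n - Pi.single b 1) (by rw [(e i).2, ← hmm]; exact hn) q hq
          rwa [(e i).2] at this
    refine (key _ m le_rfl rfl).trans (sup_le_sup_left ?_ _)
    simpa using Fil_zero (R := k)

theorem cover_main (k : Type*) [Field k] [CharZero k] (n : ℕ) : ∀ (T : Pat) (_ : GoodPat T) (m : Bool → ℕ),
    (∑ i, (cd (T i) true + cd (T i) false) = n) → (∀ s, 1 + ∑ i, cd (T i) s ≤ m s) → Cover k m T (MM fun i => cd (T i)) := by
  classical
  induction n using Nat.strong_induction_on with
  | _ n ih =>
  intro T hT m hn hm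
  by_cases h0 : ∃ i, cd (T i) true + cd (T i) false = 0
  · obtain ⟨i, hi⟩ := h0
    have hTi : T i = fun _ => ∅ := by
      funext b
      have : (T i b).card = 0 := by
        cases b
        · exact (Nat.add_eq_zero_iff.1 hi).2
        · exact (Nat.add_eq_zero_iff.1 hi).1
      exact Finset.card_eq_zero.1 this
    refine ⟨∅, Nat.zero_le _, ?_⟩
    intro q hq
    refine Submodule.mem_sup_left ?_
    have := mem_UU (T := T) i (n := m) (m := m) (by rw [hTi]; intro s; simp [cd]) hq
    rw [hTi] at this
    simpa [gg] using this
  by_cases h1 : ∀ i, cd (T i) true + cd (T i) false = 1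
  · have : ∀ i, ∃ s c, T i = Function.update (fun _ => ∅) s {c} := by
      intro i
      have := h1 i
      rcases Nat.add_eq_one_iff.1 this with ⟨ha, hb⟩ | ⟨ha, hb⟩
      · obtain ⟨c, hc⟩ := Finset.card_eq_one.1 hb
        refine ⟨false, c, ?_⟩
        funext b; cases b
        · simpa using hc
        · simpa [Function.update] using Finset.card_eq_zero.1 ha
      · obtain ⟨c, hc⟩ := Finset.card_eq_one.1 ha
        refine ⟨true, c, ?_⟩
        funext b; cases b
        · simpa [Function.update] using Finset.card_eq_zero.1 hb
        · simpa using hc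
    choose s c hs using this
    exact cover_base k T hT m s c hs fun s => by have := hm s; omega
  push Not at h0 h1
  obtain ⟨i, hi1⟩ := h1
  have hi0 := h0 i
  have hi2 : 2 ≤ cd (T i) true + cd (T i) false := by omega
  have : ∃ s, (T i s).Nonempty := by
    by_contra h
    push Not at h
    rw [cd, cd, h, h] at hi0; simp at hi0
  obtain ⟨s, c, hc⟩ := this
  set T1 := Function.update T i (Function.update (fun _ => ∅) s {c}) with hT1
  set T2 := Function.update T i (Function.update (T i) s ((T i s).erase c)) with hT2
  have hcd1 : ∀ b, cd (T1 i) b ≤ cd (T i) b := by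
    intro b
    rw [hT1, Function.update_self, cd_single, cd_erase _ _ _ hc]; simp
  have hcd2 : ∀ b, cd (T2 i) b + Pi.single (M := fun _ => ℕ) s 1 b = cd (T i) b := by
    intro b
    rw [hT2, Function.update_self, cd_erase (T i) s c hc]; simp
  have hne1 : ∀ j, j ≠ i → T1 j = T j := fun j hj => Function.update_of_ne hj _ _
  have hne2 : ∀ j, j ≠ i → T2 j = T j := fun j hj => Function.update_of_ne hj _ _
  have hT1T : GoodPat T1 := hT.mono fun j b => by
    by_cases hj : j = i
    · subst hj; rw [hT1, Function.update_self]
      by_cases hb : b = s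
      · subst hb; simpa using hc
      · simp [Function.update_of_ne hb]
    · rw [hne1 j hj]
  have hT2T : GoodPat T2 := hT.mono fun j b => by
    by_cases hj : j = i
    · subst hj; rw [hT2, Function.update_self]
      by_cases hb : b = s
      · subst hb; simp [Finset.erase_subset]
      · simp [Function.update_of_ne hb]
    · rw [hne2 j hj]
  have hsum : ∀ (f : Fin 6 → ℕ), ∑ j, f j = f i + ∑ j ∈ Finset.univ.erase i, f j := fun f => (Finset.add_sum_erase _ _ (Finset.mem_univ i)).symm
  have hs1 : ∀ b, ∑ j ∈ Finset.univ.erase i, cd (T1 j) b = ∑ j ∈ Finset.univ.erase i, cd (T j) b := fun b =>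
    Finset.sum_congr rfl fun j hj => by rw [hne1 j (Finset.ne_of_mem_erase hj)]
  have hs2 : ∀ b, ∑ j ∈ Finset.univ.erase i, cd (T2 j) b = ∑ j ∈ Finset.univ.erase i, cd (T j) b := fun b =>
    Finset.sum_congr rfl fun j hj => by rw [hne2 j (Finset.ne_of_mem_erase hj)]
  have hsT : ∑ b : Bool, Pi.single (M := fun _ => ℕ) s 1 b = 1 := by simp
  rw [Fintype.sum_bool] at hsT
  have hms : 1 ≤ m s := by have := hm s; omega
  obtain ⟨m', rfl⟩ : ∃ m', m = m' + Pi.single s 1 := ⟨m - Pi.single s 1, by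
    rw [tsub_add_cancel_of_le]
    intro s'; by_cases h : s' = s
    · subst h; simpa using hms
    · simp [h]⟩
  have hTT1 : cd (T1 i) true + cd (T1 i) false = 1 := by
    rw [hT1, Function.update_self, cd_single]; exact hsT
  rw [Finset.sum_add_distrib] at hn
  have e1 := hsum (fun j => cd (T j) true); have e2 := hsum (fun j => cd (T j) false)
  have e3 := hsum (fun j => cd (T1 j) true); have e4 := hsum (fun j => cd (T1 j) false)
  have e5 := hsum (fun j => cd (T2 j) true); have e6 := hsum (fun j => cd (T2 j) false)
  rw [hs1] at e3 e4
  rw [hs2] at e5 e6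
  have q1 := hcd2 true; have q2 := hcd2 false
  rw [MM_split T i s c hc]
  refine split_cover hc ?_ ?_ ?_
  · intro j hj b
    have h1 := hm b
    rw [hsum, Pi.add_apply, ← hcd2] at h1
    have h2 : cd (T j) b ≤ ∑ j ∈ Finset.univ.erase i, cd (T j) b :=
      Finset.single_le_sum (f := fun j => cd (T j) b) (fun _ _ => Nat.zero_le _) (Finset.mem_erase.2 ⟨hj, Finset.mem_univ _⟩)
    show cd (T j) b ≤ m' b
    omega
  · refine ih (∑ i, (cd (T1 i) true + cd (T1 i) false)) ?_ T1 hT1T _ rfl ?_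
    · rw [Finset.sum_add_distrib]; omega
    · intro b
      refine le_trans ?_ (hm b)
      rw [hsum, hsum, hs1]
      have := hcd1 b; omega
  · refine ih (∑ i, (cd (T2 i) true + cd (T2 i) false)) ?_ T2 hT2T _ rfl ?_
    · rw [Finset.sum_add_distrib]; omega
    · intro b
      have := hm b
      rw [hsum, Pi.add_apply, ← hcd2] at this
      rw [hsum, hs2]
      omega

open MvPolynomial

theorem exists_rank_id {k m n : Type*} [Field k] [Fintype m] [Fintype n] (A : Matrix m n k) (r : ℕ) (hr : A.rank = r) :
    ∃ (P : Matrix (Fin r) m k) (Q : Matrix n (Fin r) k), P * A * Q = 1 := by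
  classical
  let b : Module.Basis (Fin r) k (LinearMap.range A.mulVecLin) := Module.finBasisOfFinrankEq k _ hr
  have hb : ∀ j, ∃ w, A.mulVecLin w = (b j : m → k) := fun j => (b j).2
  choose w hw using hb
  have hli : LinearIndependent k (fun j => ((b j : LinearMap.range A.mulVecLin) : m → k)) :=
    b.linearIndependent.map' (LinearMap.range A.mulVecLin).subtype (Submodule.ker_subtype _)
  let Φ : (Fin r → k) →ₗ[k] (m → k) := Fintype.linearCombination k (fun j => ((b j : LinearMap.range A.mulVecLin) : m → k))
  have hΦ : LinearMap.ker Φ = ⊥ := by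
    rw [LinearMap.ker_eq_bot]
    exact hli.fintypeLinearCombination_injective
  obtain ⟨g, hg⟩ := LinearMap.exists_leftInverse_of_injective Φ hΦ
  refine ⟨LinearMap.toMatrix' g, Matrix.of fun x j => w j x, ?_⟩
  have : A * (Matrix.of fun x j => w j x) = LinearMap.toMatrix' Φ := by
    ext x j
    have := congrFun (hw j) x
    rw [LinearMap.toMatrix'_apply]
    simp only [Φ]
    rw [Fintype.linearCombination_apply, Finset.sum_eq_single j]
    · simp only [Pi.single_eq_same, one_smul]
      rw [← this]; rfl
    · intro i _ hi; simp [hi]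
    · simp
  rw [Matrix.mul_assoc, this, ← LinearMap.toMatrix'_comp, hg, LinearMap.toMatrix'_id]

theorem rank_semicont {k L m n : Type*} [Field k] [Field L] [Algebra k L] [Fintype m] [Fintype n]
    (A : Matrix m n (Polynomial k)) (t : L) (ht : Transcendental k t) :
    (A.map (Polynomial.eval 0)).rank ≤ (A.map (Polynomial.aeval t)).rank := by
  classical
  obtain ⟨r, hr⟩ : ∃ r, (A.map (Polynomial.eval 0)).rank = r := ⟨_, rfl⟩
  obtain ⟨P, Q, hPQ⟩ := exists_rank_id (A.map (Polynomial.eval 0)) r hr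
  rw [hr]
  set D := P.map Polynomial.C * A * Q.map Polynomial.C with hD
  have h0 : (Polynomial.evalRingHom (0 : k)).mapMatrix D = 1 := by
    rw [← hPQ, hD]
    simp only [RingHom.mapMatrix_apply, Matrix.map_mul]
    congr 2
    · ext; simp
    · ext; simp
  have hdet : D.det ≠ 0 := by
    intro h
    have := congrArg Matrix.det h0
    rw [← RingHom.map_det, h] at this
    simp at this
  have hdet2 : ((Polynomial.aeval t).toRingHom.mapMatrix D).det ≠ 0 := by
    rw [← RingHom.map_det]
    intro h
    exact hdet ((transcendental_iff.1 ht) _ h)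
  have h1 := Matrix.rank_of_det_ne_zero hdet2
  rw [Fintype.card_fin] at h1
  rw [← h1, hD]
  simp only [RingHom.mapMatrix_apply, Matrix.map_mul]
  refine (Matrix.rank_mul_le_left _ _).trans ((Matrix.rank_mul_le_right _ _).trans ?_)
  exact le_rfl

theorem Fil_eval {R : Type*} [CommRing R] {m : Bool → ℕ} (S : Finset (Sg →₀ ℕ)) (hS : (S : Set _) = mset m)
    (P : Sg → R) (h : MvPolynomial Sg R) (hh : h ∈ Fil R m) :
    eval P h = ∑ α : S, eval P (monomial α.1 1) * coeff α.1 h := by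
  have h1 : h.support ⊆ S := by
    rw [← Finset.coe_subset, hS]; exact hh
  rw [Finset.sum_coe_sort S (fun α => eval P (monomial α 1) * coeff α h)]
  conv_lhs => rw [h.as_sum, map_sum]
  rw [Finset.sum_subset h1]
  · refine Finset.sum_congr rfl fun α _ => ?_
    rw [eval_monomial, eval_monomial]; ring
  · intro α _ hα
    rw [notMem_support_iff.1 hα]; simp

theorem bezout {k L : Type*} [Field k] [CharZero k] [Field L] [Algebra k L] (δ : L) (hδ : Transcendental k δ)
    (T : Pat) (hT : GoodPat T) (f : Fin 6 → MvPolynomial Sg k) (hf : ∀ i, f i ∈ Fil k (cd (T i)))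
    (a : Fin 6 → ℕ) (ha : ∀ i, 0 < a i) {n : Type*} [Fintype n] (P : n → Sg → L) (hP : Function.Injective P)
    (hz : ∀ j i, aeval (P j) (f i) + δ ^ (a i) * aeval (P j) (gg k (T i)) = 0) :
    Fintype.card n ≤ MM fun i => cd (T i) := by
  classical
  have hδ0 : δ ≠ 0 := by rintro rfl; exact hδ isAlgebraic_zero
  set t := δ⁻¹ with ht
  have htr : Transcendental k t := by
    intro h; apply hδ; rw [← inv_inv δ]; exact h.inv
  have hz' : ∀ j i, aeval (P j) (gg k (T i)) + t ^ (a i) * aeval (P j) (f i) = 0 := by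
    intro j i
    have := congrArg (fun x => t ^ (a i) * x) (hz j i)
    simp only [mul_zero] at this
    rw [mul_add, ← mul_assoc, ← mul_pow, ht, inv_mul_cancel₀ hδ0, one_pow, one_mul, ← ht] at this
    rw [← this]; ring
  set m : Bool → ℕ := fun s => 1 + ∑ i, cd (T i) s + Fintype.card n with hm
  obtain ⟨Q, hQc, hQ⟩ := cover_main k _ T hT m rfl fun s => by simp [hm]
  refine le_trans ?_ hQc
  have hle : ∀ i, cd (T i) ≤ m := by
    intro i s
    have : cd (T i) s ≤ ∑ i, cd (T i) s := Finset.single_le_sum (f := fun j => cd (T j) s) (fun _ _ => Nat.zero_le _) (Finset.mem_univ _)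
    simp only [hm]; omega
  set S := (mset_finite m).toFinset with hS
  have hS' : (S : Set _) = mset m := by simp [hS]
  let J := Σ i : Fin 6, ((mset_finite (m - cd (T i))).toFinset)
  have hmon : ∀ (R : Type _) [CommSemiring R] (x : J), monomial x.2.1 (1 : R) ∈ Fil R (m - cd (T x.1)) := by
    intro R _ x
    unfold Fil
    rw [monomial_mem_restrictSupport]
    left
    have := x.2.2
    rwa [Set.Finite.mem_toFinset] at this
  let A : Matrix S J (Polynomial k) := Matrix.of fun α x =>
    Polynomial.C (coeff α.1 (gg k (T x.1) * monomial x.2.1 1)) + Polynomial.X ^ (a x.1) * Polynomial.C (coeff α.1 (f x.1 * monomial x.2.1 1))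
  have hA0 : ∀ α x, (A.map (Polynomial.eval 0)) α x = coeff α.1 (gg k (T x.1) * monomial x.2.1 1) := by
    intro α x
    simp only [A, Matrix.map_apply, Matrix.of_apply]
    simp [(ha x.1).ne']
  have hr0 : Fintype.card S ≤ (A.map (Polynomial.eval 0)).rank + Q.card := by
    let ρ : MvPolynomial Sg k →ₗ[k] (S → k) := LinearMap.pi fun α => lcoeff k α.1
    have hρ : ∀ q α, ρ q α = coeff α.1 q := fun q α => rfl
    have h1 : (⊤ : Submodule k (S → k)) ≤ Submodule.span k (Set.range (A.map (Polynomial.eval 0)).col) ⊔ Submodule.span k (Q.image ρ : Finset _) := by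
      have h2 : (⊤ : Submodule k (S → k)) ≤ (Fil k m).map ρ := by
        intro v _
        refine ⟨∑ α : S, monomial α.1 (v α), ?_, ?_⟩
        · refine Submodule.sum_mem _ fun α _ => ?_
          unfold Fil
          rw [monomial_mem_restrictSupport, ← hS']
          left; exact α.2
        · funext α
          rw [hρ, coeff_sum, Finset.sum_eq_single α]
          · simp
          · intro β _ hβ
            rw [coeff_monomial, if_neg]
            exact fun h => hβ (Subtype.ext h)
          · simp
      refine h2.trans ((Submodule.map_mono hQ).trans ?_)
      rw [Submodule.map_sup]
      refine sup_le_sup ?_ ?_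
      · rw [Submodule.map_le_iff_le_comap]
        refine UU_le fun i q hq => ?_
        have h3 : Fil k (m - cd (T i)) ≤ ((Submodule.span k (Set.range (A.map (Polynomial.eval 0)).col)).comap ρ).comap (LinearMap.mulLeft k (gg k (T i))) := by
          conv_lhs => unfold Fil
          rw [restrictSupport_eq_span, Submodule.span_le]
          rintro _ ⟨β, hβ, rfl⟩
          refine Submodule.subset_span ⟨⟨i, ⟨β, by simpa using hβ⟩⟩, ?_⟩
          funext α
          exact hA0 α _
        exact h3 hq
      · rw [Submodule.map_span, Finset.coe_image]
    have h3 := Submodule.finrank_mono h1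
    rw [finrank_top, Module.finrank_fintype_fun_eq_card] at h3
    refine h3.trans ((Submodule.finrank_add_le_finrank_add_finrank _ _).trans ?_)
    rw [Matrix.rank_eq_finrank_span_cols]
    refine Nat.add_le_add_left ?_ _
    exact (finrank_span_finset_le_card _).trans Finset.card_image_le
  have hrt := rank_semicont A t htr
  let Ev : Matrix n S L := Matrix.of fun j α => eval (P j) (monomial α.1 1)
  have hEA : Ev * A.map (Polynomial.aeval t) = 0 := by
    ext j x
    rw [Matrix.mul_apply]
    have hin : map (algebraMap k L) (gg k (T x.1) * monomial x.2.1 1) + C (t ^ a x.1) * map (algebraMap k L) (f x.1 * monomial x.2.1 1) ∈ Fil L m := by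
      have e1 := Fil_mul (Fil_gg k (T x.1)) (hmon k x)
      have e2 := Fil_mul (hf x.1) (hmon k x)
      rw [add_tsub_cancel_of_le (hle _)] at e1 e2
      refine Submodule.add_mem _ (Fil_map _ e1) ?_
      rw [C_mul']
      exact Submodule.smul_mem _ _ (Fil_map _ e2)
    have := Fil_eval S hS' (P j) _ hin
    rw [Matrix.zero_apply]
    refine Eq.trans (Eq.symm ?_) (Eq.trans this.symm ?_)
    · · refine Finset.sum_congr rfl fun α _ => ?_
        simp only [Ev, A, Matrix.map_apply, Matrix.of_apply]
        congr 1
        rw [coeff_add, coeff_C_mul, coeff_map, coeff_map]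
        rw [map_add, map_mul, map_pow, Polynomial.aeval_C, Polynomial.aeval_C, Polynomial.aeval_X]
    · rw [map_add, map_mul (eval (P j)), eval_C, eval_map, eval_map, ← aeval_def, ← aeval_def, map_mul, map_mul]
      have := hz' j x.1
      linear_combination (aeval (P j) (monomial x.2.1 (1:k))) * this
  have hEr : Fintype.card n ≤ Ev.rank := by
    have hsep : ∀ i j, i ≠ j → ∃ p, P i p ≠ P j p := by
      intro i j hij
      by_contra h
      push Not at h
      exact hij (hP (funext h))
    choose! sp hsp using hsep
    let q : n → MvPolynomial Sg L := fun j => ∏ i ∈ Finset.univ.erase j, C ((P j (sp j i) - P i (sp j i))⁻¹) * (X (sp j i) - C (P i (sp j i)))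
    have hq1 : ∀ j, eval (P j) (q j) = 1 := by
      intro j
      simp only [q, map_prod]
      refine Finset.prod_eq_one fun i hi => ?_
      have := hsp j i (Finset.ne_of_mem_erase hi).symm
      simp [inv_mul_cancel₀ (sub_ne_zero.2 this)]
    have hq0 : ∀ i j, i ≠ j → eval (P i) (q j) = 0 := by
      intro i j hij
      simp only [q, map_prod]
      refine Finset.prod_eq_zero (Finset.mem_erase.2 ⟨hij, Finset.mem_univ _⟩) ?_
      simp
    have hqF : ∀ j, q j ∈ Fil L m := by
      intro j
      have : ∀ s : Finset n, ∏ i ∈ s, C ((P j (sp j i) - P i (sp j i))⁻¹) * (X (sp j i) - C (P i (sp j i))) ∈ Fil L (fun _ => s.card) := by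
        intro s
        induction s using Finset.induction_on with
        | empty => simp [Fil_one]
        | insert x s hx ih =>
          rw [Finset.prod_insert hx, Finset.card_insert_of_notMem hx]
          have : (fun _ : Bool => s.card + 1) = (fun _ => 1) + (fun _ => s.card) := by funext; simp [add_comm]
          rw [this]
          refine Fil_mul ?_ ih
          rw [C_mul']
          refine Submodule.smul_mem _ _ (Submodule.sub_mem _ ?_ (Fil_C _ _))
          refine Fil_mono ?_ (Fil_X (sp j x).1 (sp j x).2)
          intro b; by_cases hb : b = (sp j x).1
          · subst hb; simp
          · simp [hb]
      refine Fil_mono ?_ (this _)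
      intro s
      have : (Finset.univ.erase j).card ≤ Fintype.card n := Finset.card_le_univ _
      simp only [hm]; omega
    have h1 : Ev * (Matrix.of fun (α : S) j => coeff α.1 (q j)) = 1 := by
      ext i j
      rw [Matrix.mul_apply]
      have := Fil_eval S hS' (P i) _ (hqF j)
      refine (this.symm).trans ?_
      by_cases hij : i = j
      · subst hij; simp [hq1]
      · rw [hq0 _ _ hij, Matrix.one_apply_ne hij]
    rw [← Matrix.rank_one (R := L) (n := n), ← h1]
    exact Matrix.rank_mul_le_left _ _
  have := Matrix.rank_add_rank_le_card_of_mul_eq_zero hEA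
  omega

open MvPolynomial

section
variable {K : Type*} [Field K]

noncomputable abbrev Sn (K : Type*) [Field K] (n : ℕ) : Submodule K (MvPolynomial (Fin 3) K) := homogeneousSubmodule (Fin 3) K n

theorem Sn_finrank (n : ℕ) : 2 * Module.finrank K (Sn K n) = (n+1)*(n+2) := by
  have e1 : Sn K n = restrictSupport K {d : Fin 3 →₀ ℕ | d.degree = n} := homogeneousSubmodule_eq_finsupp_supported _ _ _
  have e : Sym (Fin 3) n ≃ {d : Fin 3 →₀ ℕ | d.degree = n} := (Sym.equivNatSum (Fin 3) n).trans (Equiv.refl _)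
  rw [e1, Module.finrank_eq_nat_card_basis (basisRestrictSupport K _), ← Nat.card_congr e, Nat.card_eq_fintype_card,
    Sym.card_sym_eq_choose]
  simp only [Fintype.card_fin]
  rw [show 3 + n - 1 = n + 2 by omega, Nat.choose_symm_add, Nat.choose_two_right]
  simp only [Nat.add_succ_sub_one]
  rw [Nat.mul_div_cancel' ]
  · ring
  · rw [mul_comm]; exact (Nat.even_mul_succ_self (n+1)).two_dvd

instance (n : ℕ) : FiniteDimensional K (Sn K n) := Module.Finite.iff_fg.2 (homogeneousSubmodule_fg _ _ _)

theorem comp_mul {σ : Type*} {a : MvPolynomial σ K} {p : ℕ} (ha : a.IsHomogeneous p) (m : ℕ) (h : MvPolynomial σ K) :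
    homogeneousComponent (m + p) (a * h) = a * homogeneousComponent m h := by
  let _ := MvPolynomial.gradedAlgebra (σ := σ) (R := K)
  have := DirectSum.coe_decompose_mul_of_left_mem_of_le (homogeneousSubmodule σ K) (a := a) (b := h) (n := m + p) (i := p) ha (by omega)
  rw [Nat.add_sub_cancel] at this
  rw [← decomposition.decompose'_apply, ← decomposition.decompose'_apply]
  exact this

noncomputable def mS (a : MvPolynomial (Fin 3) K) (m : ℕ) : Submodule K (MvPolynomial (Fin 3) K) := (Sn K m).map (LinearMap.mulLeft K a)

instance (a : MvPolynomial (Fin 3) K) (m : ℕ) : FiniteDimensional K (mS a m) := by unfold mS; infer_instance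

theorem mS_finrank {a : MvPolynomial (Fin 3) K} (ha : a ≠ 0) (m : ℕ) : Module.finrank K (mS a m) = Module.finrank K (Sn K m) :=
  (LinearEquiv.finrank_eq (Submodule.equivMapOfInjective (LinearMap.mulLeft K a) (mul_right_injective₀ ha) (Sn K m))).symm

theorem mS_finrank_le (a : MvPolynomial (Fin 3) K) (m : ℕ) : Module.finrank K (mS a m) ≤ Module.finrank K (Sn K m) :=
  Submodule.finrank_map_le _ _

theorem Sn_mono {m n : ℕ} (h : m ≤ n) : Module.finrank K (Sn K m) ≤ Module.finrank K (Sn K n) := by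
  have h1 := Sn_finrank (K := K) m
  have h2 := Sn_finrank (K := K) n
  nlinarith

theorem mS_upper {a b : MvPolynomial (Fin 3) K} {p q : ℕ} (ha : a.IsHomogeneous p) (hb : b.IsHomogeneous q) (m : ℕ) :
    Module.finrank K (mS a (m+q) ⊔ mS b (m+p) : Submodule K _) + Module.finrank K (Sn K m) ≤ Module.finrank K (Sn K (m+q)) + Module.finrank K (Sn K (m+p)) := by
  by_cases ha0 : a = 0
  · have : mS a (m+q) = ⊥ := by
      rw [eq_bot_iff]; rintro _ ⟨x, _, rfl⟩; simp [ha0]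
    rw [this, bot_sup_eq]
    have h1 := mS_finrank_le b (m+p)
    have h2 := Sn_mono (K := K) (show m ≤ m + q by omega)
    omega
  by_cases hb0 : b = 0
  · have : mS b (m+p) = ⊥ := by
      rw [eq_bot_iff]; rintro _ ⟨x, _, rfl⟩; simp [hb0]
    rw [this, sup_bot_eq]
    have h1 := mS_finrank_le a (m+q)
    have h2 := Sn_mono (K := K) (show m ≤ m + p by omega)
    omega
  have h := Submodule.finrank_sup_add_finrank_inf_eq (mS a (m+q)) (mS b (m+p))
  rw [mS_finrank ha0, mS_finrank hb0] at h
  rw [← h]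
  refine Nat.add_le_add_left ?_ _
  rw [← mS_finrank (mul_ne_zero ha0 hb0)]
  refine Submodule.finrank_mono ?_
  rintro _ ⟨x, hx, rfl⟩
  have hx' : x.IsHomogeneous m := hx
  refine ⟨⟨b * x, ?_, ?_⟩, ⟨a * x, ?_, ?_⟩⟩
  · have := hb.mul hx'; rw [add_comm] at this; exact this
  · simp [mul_assoc]
  · have := ha.mul hx'; rw [add_comm] at this; exact this
  · simp; ring

theorem mS_lower {a b : MvPolynomial (Fin 3) K} {p q : ℕ} (ha : a.IsHomogeneous p) (hap : Prime a) (hab : ¬ a ∣ b) (m : ℕ) :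
    Module.finrank K (Sn K (m+q)) + Module.finrank K (Sn K (m+p)) ≤ Module.finrank K (mS a (m+q) ⊔ mS b (m+p) : Submodule K _) + Module.finrank K (Sn K m) := by
  have hb0 : b ≠ 0 := by rintro rfl; exact hab (dvd_zero _)
  have h := Submodule.finrank_sup_add_finrank_inf_eq (mS a (m+q)) (mS b (m+p))
  rw [mS_finrank hap.ne_zero, mS_finrank hb0] at h
  rw [← h]
  refine Nat.add_le_add_left ?_ _
  rw [← mS_finrank (mul_ne_zero hap.ne_zero hb0)]
  refine Submodule.finrank_mono ?_
  rintro x ⟨⟨f, hf, hfx⟩, ⟨g, hg, hgx⟩⟩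
  rw [LinearMap.mulLeft_apply] at hfx hgx
  have : a ∣ b * g := ⟨f, by rw [hgx, hfx]⟩
  obtain ⟨g', rfl⟩ := (hap.dvd_or_dvd this).resolve_left hab
  refine ⟨homogeneousComponent m g', homogeneousComponent_mem _ _, ?_⟩
  have h1 := comp_mul ha m g'
  rw [homogeneousComponent_of_mem hg, if_pos rfl] at h1
  rw [LinearMap.mulLeft_apply, ← hgx, h1]; ring

theorem linear_prime {v : MvPolynomial (Fin 3) K} (hv : v.IsHomogeneous 1) (h0 : v ≠ 0) : Prime v := by
  rw [← irreducible_iff_prime]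
  have htd := hv.totalDegree h0
  refine ⟨fun hu => ?_, fun a b hab => ?_⟩
  · rw [MvPolynomial.isUnit_iff_totalDegree_of_isReduced] at hu
    omega
  · have ha : a ≠ 0 := by rintro rfl; simp at hab; exact h0 hab
    have hb : b ≠ 0 := by rintro rfl; simp at hab; exact h0 hab
    have h1 := totalDegree_mul_of_isDomain ha hb
    rw [← hab, htd] at h1
    have key : ∀ a : MvPolynomial (Fin 3) K, a ≠ 0 → a.totalDegree = 0 → IsUnit a := by
      intro a ha h
      rw [totalDegree_eq_zero_iff_eq_C] at h
      rw [h]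
      refine IsUnit.map C (isUnit_iff_ne_zero.2 fun hc => ha ?_)
      rw [h, hc, C_0]
    rcases Nat.eq_zero_or_pos a.totalDegree with h | h
    · exact Or.inl (key a ha h)
    · exact Or.inr (key b hb (by omega))

theorem koszul3 {g0 g1 g2 v0 v1 v2 : MvPolynomial (Fin 3) K} {e : ℕ} (he : 2 ≤ e) (h0 : g0.IsHomogeneous e) (h1 : g1.IsHomogeneous e)
    (h2 : g2.IsHomogeneous e) (hv0 : v0.IsHomogeneous 1) (hv1 : v1.IsHomogeneous 1) (hv2 : v2.IsHomogeneous 1) 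
    (n0 : ℕ) (hn : ∀ m ≥ n0, ∀ f ∈ Sn K (m + e), ∃ a ∈ Sn K m, ∃ b ∈ Sn K m, ∃ c ∈ Sn K m, f = g0 * a + g1 * b + g2 * c)
    (h : v0 * g0 + v1 * g1 + v2 * g2 = 0) : v2 = 0 := by
  by_contra hv
  have hp := linear_prime hv2 hv
  have q1 := Sn_finrank (K := K) (n0 + 1)
  have q2 := Sn_finrank (K := K) (n0 + 1 + e)
  have q3 := Sn_finrank (K := K) (n0 + e)
  have q4 := Sn_finrank (K := K) (n0 + e + e)
  have q5 := Sn_finrank (K := K) (n0 + e + 1)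
  have q6 := Sn_finrank (K := K) (n0 + e + (e + 1))
  have hA : mS v2 (n0 + e + e) ≤ mS g0 (n0 + 1 + e) ⊔ mS g1 (n0 + 1 + e) := by
    rintro _ ⟨f, hf, rfl⟩
    obtain ⟨a, ha, b, hb, c, hc, rfl⟩ := hn (n0 + e) (by omega) f hf
    have : ∀ {v x : MvPolynomial (Fin 3) K}, v.IsHomogeneous 1 → x ∈ Sn K (n0 + e) → v * x ∈ Sn K (n0 + 1 + e) := by
      intro v x hv hx
      have := hv.mul hx
      rw [show 1 + (n0 + e) = n0 + 1 + e by ring] at this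
      exact this
    rw [Submodule.mem_sup]
    refine ⟨_, ⟨v2 * a - v0 * c, Submodule.sub_mem _ (this hv2 ha) (this hv0 hc), rfl⟩, _, ⟨v2 * b - v1 * c, Submodule.sub_mem _ (this hv2 hb) (this hv1 hc), rfl⟩, ?_⟩
    simp only [LinearMap.mulLeft_apply]
    linear_combination (-c) * h
  have hup := mS_upper h0 h1 (n0 + 1)
  have main : ∀ g : MvPolynomial (Fin 3) K, mS g (n0 + 1 + e) ≤ mS g0 (n0 + 1 + e) ⊔ mS g1 (n0 + 1 + e) → v2 ∣ g := by
    intro g hg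
    by_contra hd
    have hlow := mS_lower (q := e) hv2 hp hd (n0 + e)
    rw [show n0 + e + 1 = n0 + 1 + e by ring] at *
    have := Submodule.finrank_mono (sup_le hA hg)
    nlinarith
  obtain ⟨w0, hw0⟩ := main g0 le_sup_left
  obtain ⟨w1, hw1⟩ := main g1 le_sup_right
  have hup2 := mS_upper hv2 h2 (n0 + e)
  have hS : Sn K (n0 + e + (e + 1)) ≤ mS v2 (n0 + e + e) ⊔ mS g2 (n0 + e + 1) := by
    intro f hf
    rw [show n0 + e + (e + 1) = n0 + e + 1 + e by ring] at hf
    obtain ⟨a, ha, b, hb, c, hc, hfe⟩ := hn (n0 + e + 1) (by omega) f hf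
    have k1 := comp_mul hv2 (n0 + e + e) (w0 * a + w1 * b)
    have k2 : v2 * (w0 * a + w1 * b) = f - g2 * c := by rw [hfe, hw0, hw1]; ring
    have k3 : f - g2 * c ∈ Sn K (n0 + e + e + 1) := by
      rw [show n0 + e + e + 1 = n0 + e + 1 + e by ring]
      refine Submodule.sub_mem _ hf ?_
      have := h2.mul (show c.IsHomogeneous _ from hc)
      rw [add_comm] at this; exact this
    rw [k2, homogeneousComponent_of_mem k3, if_pos rfl] at k1
    rw [Submodule.mem_sup]
    refine ⟨_, ⟨homogeneousComponent (n0+e+e) (w0*a+w1*b), homogeneousComponent_mem _ _, rfl⟩, _, ⟨c, hc, rfl⟩, ?_⟩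
    simp only [LinearMap.mulLeft_apply]
    rw [← k1]; ring
  have := Submodule.finrank_mono hS
  nlinarith
end

theorem exists_n0 {K : Type*} [Field K] [IsAlgClosed K] (G : Fin 3 → MvPolynomial (Fin 3) K) {e : ℕ} (hG : ∀ i, (G i).IsHomogeneous e)
    (hz : ∀ x : Fin 3 → K, (∀ i, eval x (G i) = 0) → x = 0) :
    (∃ N, ∀ k, (X k : MvPolynomial (Fin 3) K) ^ N ∈ Ideal.span (Set.range G)) ∧
    ∃ n0, ∀ m ≥ n0, ∀ f ∈ Sn K (m + e), ∃ a : Fin 3 → MvPolynomial (Fin 3) K, (∀ i, a i ∈ Sn K m) ∧ f = ∑ i, G i * a i := by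
  set I := Ideal.span (Set.range G) with hI
  have hX : ∀ k, (X k : MvPolynomial (Fin 3) K) ∈ I.radical := by
    intro k
    rw [← vanishingIdeal_zeroLocus_eq_radical (K := K), mem_vanishingIdeal_iff]
    intro x hx
    rw [hI, zeroLocus_span] at hx
    have : x = 0 := hz x fun i => by simpa using hx (G i) ⟨i, rfl⟩
    simp [this]
  have hX2 : ∀ k, ∃ N, (X k : MvPolynomial (Fin 3) K) ^ N ∈ I := fun k => hX k
  choose N hN using hX2
  have hM : ∀ k, (X k : MvPolynomial (Fin 3) K) ^ (∑ k, N k) ∈ I := fun k =>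
    Ideal.pow_mem_of_pow_mem _ (hN k) (Finset.single_le_sum (f := N) (fun _ _ => Nat.zero_le _) (Finset.mem_univ k))
  set M := ∑ k, N k
  refine ⟨⟨M, hM⟩, 3 * M, ?_⟩
  intro m hm f hf
  have hfI : f ∈ I := by
    rw [f.as_sum]
    refine Ideal.sum_mem _ fun α hα => ?_
    have hdeg : α.degree = m + e := by
      by_contra h
      exact (mem_support_iff.1 hα) (IsHomogeneous.coeff_eq_zero hf h)
    have : ∃ k, M ≤ α k := by
      by_contra h
      push Not at h
      have h1 : α.degree = ∑ k, α k := Finsupp.degree_eq_sum α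
      rw [Fin.sum_univ_three] at h1
      have := h 0; have := h 1; have := h 2; omega
    obtain ⟨k, hk⟩ := this
    have : monomial α (coeff α f) = monomial (α - Finsupp.single k M) (coeff α f) * X k ^ M := by
      rw [X_pow_eq_monomial, monomial_mul, mul_one, tsub_add_cancel_of_le]
      rw [Finsupp.single_le_iff]; exact hk
    rw [this]
    exact Ideal.mul_mem_left _ _ (hM k)
  rw [hI, Ideal.mem_span_range_iff_exists_fun] at hfI
  obtain ⟨c, hc⟩ := hfI
  refine ⟨fun i => homogeneousComponent m (c i), fun i => homogeneousComponent_mem _ _, ?_⟩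
  have : homogeneousComponent (m + e) (∑ i, c i * G i) = f := by
    rw [hc, homogeneousComponent_of_mem hf, if_pos rfl]
  rw [← this, map_sum]
  refine Finset.sum_congr rfl fun i _ => ?_
  rw [mul_comm, comp_mul (hG i)]

theorem koszul {K : Type*} [Field K] [IsAlgClosed K] (G : Fin 3 → MvPolynomial (Fin 3) K) {e : ℕ} (he : 2 ≤ e) (hG : ∀ i, (G i).IsHomogeneous e)
    (hz : ∀ x : Fin 3 → K, (∀ i, eval x (G i) = 0) → x = 0) (V : Fin 3 → MvPolynomial (Fin 3) K) (hV : ∀ i, (V i).IsHomogeneous 1)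
    (h : ∑ i, V i * G i = 0) : V = 0 := by
  obtain ⟨-, n0, hn⟩ := exists_n0 G hG hz
  rw [Fin.sum_univ_three] at h
  simp only [Fin.sum_univ_three] at hn
  have h2 := koszul3 he (hG 0) (hG 1) (hG 2) (hV 0) (hV 1) (hV 2) n0 (fun m hm f hf => by
    obtain ⟨a, ha, hf⟩ := hn m hm f hf
    exact ⟨_, ha 0, _, ha 1, _, ha 2, hf⟩) h
  have h0 := koszul3 he (hG 1) (hG 2) (hG 0) (hV 1) (hV 2) (hV 0) n0 (fun m hm f hf => by
    obtain ⟨a, ha, hf⟩ := hn m hm f hf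
    exact ⟨_, ha 1, _, ha 2, _, ha 0, by rw [hf]; ring⟩) (by rw [← h]; ring)
  have h1 := koszul3 he (hG 2) (hG 0) (hG 1) (hV 2) (hV 0) (hV 1) n0 (fun m hm f hf => by
    obtain ⟨a, ha, hf⟩ := hn m hm f hf
    exact ⟨_, ha 2, _, ha 0, _, ha 1, by rw [hf]; ring⟩) (by rw [← h]; ring)
  funext i
  fin_cases i <;> assumption

open MvPolynomial

section
variable {K : Type*} [Field K]

noncomputable abbrev SS (K : Type*) [Field K] := MvPolynomial (Bool × Fin 3) K

theorem pderiv_deg {σ : Type*} (i : σ) (a : MvPolynomial σ K) (h : pderiv i a ≠ 0) : (pderiv i a).totalDegree < a.totalDegree := by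
  classical
  obtain ⟨m, hm, he⟩ : ∃ m ∈ (pderiv i a).support, (pderiv i a).totalDegree = m.sum fun _ e => e := by
    have := Finset.exists_mem_eq_sup (pderiv i a).support (support_nonempty.2 h) (fun s => s.sum fun _ e => e)
    simpa [totalDegree] using this
  rw [mem_support_iff, coeff_pderiv] at hm
  have h1 : m + Finsupp.single i 1 ∈ a.support := mem_support_iff.2 (left_ne_zero_of_mul hm)
  have h2 := le_totalDegree h1
  rw [Finsupp.sum_add_index' (by simp) (by simp), Finsupp.sum_single_index rfl] at h2
  omega

theorem mul_pderiv_zero {σ : Type*} (i : σ) (s a : MvPolynomial σ K) (ha : a ≠ 0) (h : s * a = pderiv i a) : s = 0 := by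
  by_contra hs
  have h1 := pderiv_deg i a (h ▸ mul_ne_zero hs ha)
  rw [← h, totalDegree_mul_of_isDomain hs ha] at h1
  omega

theorem const_of_pderiv {σ : Type*} [CharZero K] (a : MvPolynomial σ K) (h : ∀ i, pderiv i a = 0) : a = C (coeff 0 a) := by
  classical
  ext m
  rw [coeff_C]
  split_ifs with hm
  · rw [← hm]
  · obtain ⟨i, hi⟩ : ∃ i, m i ≠ 0 := by
      by_contra hc; push Not at hc; exact hm (Finsupp.ext fun i => by simp [hc])
    have h1 := coeff_pderiv (i := i) a (m - Finsupp.single i 1)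
    have h2 : m - Finsupp.single i 1 + Finsupp.single i 1 = m := tsub_add_cancel_of_le (by rw [Finsupp.single_le_iff]; omega)
    rw [h i, h2, coeff_zero] at h1
    rcases mul_eq_zero.1 h1.symm with h | h
    · exact h
    · exact absurd h (Nat.cast_add_one_ne_zero _)

open Polynomial in
noncomputable def cmf (δ : Derivation K (SS K) (SS K)) (f : (SS K)[X]) : (SS K)[X] := ∑ n ∈ Finset.range (f.natDegree + 1), Polynomial.monomial n (δ (f.coeff n))

open Polynomial in
theorem coeff_cmf (δ : Derivation K (SS K) (SS K)) (f : (SS K)[X]) (n : ℕ) : (cmf δ f).coeff n = δ (f.coeff n) := by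
  unfold cmf
  rw [finset_sum_coeff]
  simp only [Polynomial.coeff_monomial]
  rw [Finset.sum_ite_eq']
  split_ifs with h
  · rfl
  · rw [Polynomial.coeff_eq_zero_of_natDegree_lt (by simpa using h), map_zero]

open Polynomial in
noncomputable def cm (δ : Derivation K (SS K) (SS K)) : Derivation K (SS K)[X] (SS K)[X] := Derivation.mk'
  { toFun := cmf δ
    map_add' := fun f g => by ext1 n; simp [coeff_cmf]
    map_smul' := fun f g => by ext1 n; simp [coeff_cmf] } fun f g => by
    ext1 n
    simp only [LinearMap.coe_mk, AddHom.coe_mk, smul_eq_mul, Polynomial.coeff_add, coeff_cmf, Polynomial.coeff_mul, map_sum, Derivation.leibniz, Finset.sum_add_distrib]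
    congr 1
    rw [← Finset.Nat.sum_antidiagonal_swap]
    rfl

open Polynomial in
theorem coeff_cm (δ : Derivation K (SS K) (SS K)) (f : (SS K)[X]) (n : ℕ) : (cm δ f).coeff n = δ (f.coeff n) := coeff_cmf δ f n

open Polynomial in
theorem cm_C (δ : Derivation K (SS K) (SS K)) (a : SS K) : cm δ (Polynomial.C a) = Polynomial.C (δ a) := by
  ext1 n; rw [coeff_cm, Polynomial.coeff_C, Polynomial.coeff_C]; split_ifs <;> simp
open Polynomial in
theorem cm_X (δ : Derivation K (SS K) (SS K)) : cm δ Polynomial.X = 0 := by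
  ext1 n; rw [coeff_cm, Polynomial.coeff_X]; split_ifs <;> simp

noncomputable def yk (K : Type*) [Field K] (k : Fin 3) : Polynomial (SS K) := Polynomial.C (X (false,k)) + Polynomial.X * Polynomial.C (X (true,k))

noncomputable def gk (f : MvPolynomial (Fin 3) K) : Polynomial (SS K) := aeval (yk K) f

theorem der_gk (D : Derivation K (Polynomial (SS K)) (Polynomial (SS K))) (hD : ∀ k, D (yk K k) = 0) (f : MvPolynomial (Fin 3) K) : D (gk f) = 0 := by
  unfold gk
  induction f using MvPolynomial.induction_on with
  | C a => rw [aeval_C]; exact D.map_algebraMap a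
  | add p q hp hq => rw [map_add, map_add, hp, hq, add_zero]
  | mul_X p n hp => rw [map_mul, D.leibniz, hp, aeval_X, hD]; simp

noncomputable def DN (N : Fin 3) : Derivation K (Polynomial (SS K)) (Polynomial (SS K)) := cm (pderiv (true, N)) - (Polynomial.X : Polynomial (SS K)) • cm (pderiv (false, N))

theorem DN_yk (N k : Fin 3) : DN N (yk K k) = 0 := by
  simp only [DN, yk, Derivation.sub_apply, Derivation.smul_apply, map_add, Derivation.leibniz, cm_C, cm_X, pderiv_X, smul_eq_mul]
  by_cases h : N = k
  · simp [h]
  · simp [h, Ne.symm h]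

noncomputable def EE : Derivation K (SS K) (SS K) := ∑ k : Fin 3, (X (true, k) : SS K) • pderiv (false, k)

noncomputable def DT : Derivation K (Polynomial (SS K)) (Polynomial (SS K)) := Polynomial.derivative'.restrictScalars K - cm EE

theorem DT_yk (k : Fin 3) : DT (yk K k) = 0 := by
  fin_cases k <;> simp [DT, yk, EE, cm_C, cm_X, Fin.sum_univ_three, Pi.single_apply]

theorem coeff_DT (f : Polynomial (SS K)) (n : ℕ) : (DT f).coeff n = f.coeff (n+1) * (n+1) - EE (f.coeff n) := by
  simp [DT, coeff_cm, Polynomial.coeff_derivative]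

theorem coeff_DN_zero (N : Fin 3) (f : Polynomial (SS K)) : (DN N f).coeff 0 = pderiv (true,N) (f.coeff 0) := by
  simp [DN, coeff_cm]
theorem coeff_DN_succ (N : Fin 3) (f : Polynomial (SS K)) (n : ℕ) : (DN N f).coeff (n+1) = pderiv (true,N) (f.coeff (n+1)) - pderiv (false, N) (f.coeff n) := by
  simp [DN, coeff_cm]

theorem DN_natDegree (N : Fin 3) (f : Polynomial (SS K)) : (DN N f).natDegree ≤ f.natDegree + 1 := by
  rw [Polynomial.natDegree_le_iff_coeff_eq_zero]
  intro n hn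
  obtain ⟨m, rfl⟩ : ∃ m, n = m + 1 := ⟨n-1, by omega⟩
  rw [coeff_DN_succ, Polynomial.coeff_eq_zero_of_natDegree_lt (by omega), Polynomial.coeff_eq_zero_of_natDegree_lt (by omega)]
  simp
end

open MvPolynomial

section
variable {K : Type*} [Field K]

theorem par_lemma {R ι : Type*} [CommRing R] [IsDomain R] [UniqueFactorizationMonoid R] [Fintype ι] [Nonempty ι] (L : ι → R) (hL : L ≠ 0) :
    ∃ (κ : R) (V : ι → R), κ ≠ 0 ∧ (∀ i, L i = κ * V i) ∧ ∀ b : ι → R, (∀ i j, V i * b j = V j * b i) → ∀ j, V j ∣ b j := by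
  classical
  let _ : NormalizedGCDMonoid R := Classical.choice inferInstance
  obtain ⟨V, h1, h2⟩ := Finset.extract_gcd L (s := Finset.univ) Finset.univ_nonempty
  refine ⟨Finset.univ.gcd L, V, ?_, fun i => h1 i (Finset.mem_univ _), ?_⟩
  · intro h
    rw [Finset.gcd_eq_zero_iff] at h
    exact hL (funext fun i => h i (Finset.mem_univ _))
  · intro b hb j
    have h3 : V j ∣ Finset.univ.gcd fun i => V i * b j := Finset.dvd_gcd fun i _ => by rw [hb i j]; exact dvd_mul_right _ _
    have h4 := Finset.gcd_mul_right' Finset.univ V (b j)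
    rw [h2, one_mul] at h4
    exact h3.trans h4.dvd

theorem hom_scale {σ R A : Type*} [CommRing R] [CommRing A] [Algebra R A] {f : MvPolynomial σ R} {e : ℕ} (hf : f.IsHomogeneous e) (t : A) (a : σ → A) :
    aeval (fun k => t * a k) f = t ^ e * aeval a f := by
  rw [f.as_sum, map_sum, map_sum, Finset.mul_sum]
  refine Finset.sum_congr rfl fun α hα => ?_
  have hdeg : α.degree = e := by
    by_contra h
    exact (mem_support_iff.1 hα) (IsHomogeneous.coeff_eq_zero hf h)
  rw [aeval_monomial, aeval_monomial]
  simp only [mul_pow]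
  rw [Finsupp.prod_mul, ← hdeg]
  have : (α.prod fun _ b => t ^ b) = t ^ α.degree := by
    rw [Finsupp.prod, Finset.prod_pow_eq_pow_sum]; rfl
  rw [this]; ring

theorem gk_natDegree {f : MvPolynomial (Fin 3) K} {e : ℕ} (hf : f.IsHomogeneous e) (h0 : f ≠ 0) : e ≤ (gk f).natDegree := by
  let φ : SS K →ₐ[K] MvPolynomial (Fin 3) K := aeval fun p : Bool × Fin 3 => if p.1 then X p.2 else 0
  have h1 : (gk f).map φ.toRingHom = Polynomial.X ^ e * Polynomial.C f := by
    have h2 : (Polynomial.mapAlgHom φ).comp (aeval (yk K)) = (aeval fun k : Fin 3 => (Polynomial.X * Polynomial.C (X k) : Polynomial (MvPolynomial (Fin 3) K))) := by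
      apply MvPolynomial.algHom_ext
      intro k
      simp [yk, φ]
    have h3 := DFunLike.congr_fun h2 f
    have h4 : (gk f).map φ.toRingHom = (Polynomial.mapAlgHom φ).comp (aeval (yk K)) f := rfl
    rw [h4, h3]
    rw [hom_scale hf]
    congr 1
    have := aeval_algebraMap_apply (R := K) (Polynomial (MvPolynomial (Fin 3) K)) (X : Fin 3 → MvPolynomial (Fin 3) K) f
    rw [aeval_X_left_apply] at this
    exact this
  have h2 := Polynomial.natDegree_map_le (f := φ.toRingHom) (p := gk f)
  rw [h1, Polynomial.natDegree_mul_C h0, Polynomial.natDegree_X_pow] at h2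
  exact h2

theorem dvd_comb {R : Type*} [CommRing R] {d c u v a b : R} {N : ℕ} (h1 : d ∣ c * u ^ N) (h2 : d ∣ c * v ^ N) : d ∣ c * (a * u + b * v) ^ (N + N) := by
  rw [add_pow, Finset.mul_sum]
  refine Finset.dvd_sum fun i _ => ?_
  rcases le_total N i with hi | hi
  · rw [mul_pow a u, ← Nat.sub_add_cancel hi, pow_add u]
    refine h1.trans ⟨u ^ (i - N) * a ^ (i - N + N) * (b * v) ^ (N + N - (i - N + N)) * ((N+N).choose (i - N + N) : ℕ), ?_⟩
    ring
  · have hi2 : N ≤ N + N - i := by omega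
    generalize N + N - i = r at *
    rw [mul_pow b v, ← Nat.sub_add_cancel hi2, pow_add v]
    refine h2.trans ⟨v ^ (r - N) * b ^ (r - N + N) * (a * u) ^ i * ((N+N).choose i : ℕ), ?_⟩
    ring

theorem deg_zero_of_par (G : Fin 3 → MvPolynomial (Fin 3) K) {e : ℕ} (hG : ∀ i, (G i).IsHomogeneous e)
    (hN : ∃ N, ∀ k, (X k : MvPolynomial (Fin 3) K) ^ N ∈ Ideal.span (Set.range G)) (c : Fin 3 → Polynomial (SS K))
    (hc : ∀ i j, c i * gk (G j) = c j * gk (G i)) (hd : ∀ i, (c i).natDegree < e) : c = 0 := by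
  obtain ⟨N, hN⟩ := hN
  funext j
  by_contra hcj
  have hcj : c j ≠ 0 := hcj
  have h1 : ∀ k, gk (G j) ∣ c j * yk K k ^ N := by
    intro k
    obtain ⟨a, ha⟩ := Ideal.mem_span_range_iff_exists_fun.1 (hN k)
    have := congrArg (aeval (yk K)) ha
    rw [map_sum, map_pow, aeval_X] at this
    rw [← this, Finset.mul_sum]
    refine Finset.dvd_sum fun i _ => ?_
    rw [map_mul]
    refine ⟨c i * aeval (yk K) (a i), ?_⟩
    have := hc i j
    unfold gk at *
    linear_combination (-(aeval (yk K) (a i))) * this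
  set s : SS K := X (false,0) * X (true,1) - X (false,1) * X (true,0) with hs
  have hs0 : s ≠ 0 := by
    intro h
    have := congrArg (eval (fun p : Bool × Fin 3 => if p = (false,0) ∨ p = (true,1) then (1:K) else 0)) h
    simp [hs] at this
  have h2 : (Polynomial.C s : Polynomial (SS K)) = Polynomial.C (X (true,1)) * yk K 0 + (- Polynomial.C (X (true,0) : SS K)) * yk K 1 := by
    simp only [hs, yk, Polynomial.C_sub, Polynomial.C_mul]; ring
  have h3 : gk (G j) ∣ c j * Polynomial.C s ^ (N + N) := by
    rw [h2]; exact dvd_comb (h1 0) (h1 1)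
  rw [← Polynomial.C_pow] at h3
  have h4 : c j * Polynomial.C (s ^ (N+N)) ≠ 0 := mul_ne_zero hcj (by simpa using fun h => absurd h hs0)
  have h5 := Polynomial.natDegree_le_of_dvd h3 h4
  rw [Polynomial.natDegree_mul_C (pow_ne_zero _ hs0)] at h5
  have h6 : G j ≠ 0 := by
    intro h
    obtain ⟨q, hq⟩ := h3
    rw [h] at hq
    simp [gk] at hq
    rcases hq with h | h
    · exact hcj h
    · exact hs0 h.1
  have := gk_natDegree (hG j) h6
  have := hd j
  omega
end

open MvPolynomial

section
variable {K : Type*} [Field K]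

theorem DN_zero_of_dvd (N : Fin 3) (V : Polynomial (SS K)) (hd : V.natDegree ≤ 1) (h : V ∣ DN N V) : DN N V = 0 := by
  obtain ⟨q, hq⟩ := h
  by_cases hV : V = 0
  · simp [hV]
  by_cases hq0 : q = 0
  · rw [hq, hq0, mul_zero]
  exfalso
  have hdeg : (DN N V).natDegree = V.natDegree + q.natDegree := by rw [hq, Polynomial.natDegree_mul hV hq0]
  have hc0 := congrArg (fun p => Polynomial.coeff p 0) hq
  have hcs := fun n => congrArg (fun p => Polynomial.coeff p (n+1)) hq
  simp only [coeff_DN_zero, coeff_DN_succ] at hc0 hcs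
  by_cases hb : V.coeff 1 = 0
  · have hV1 : V = Polynomial.C (V.coeff 0) := by
      apply Polynomial.eq_C_of_natDegree_eq_zero
      by_contra hne
      have : V.natDegree = 1 := by omega
      rw [← this] at hb
      exact hV (Polynomial.leadingCoeff_eq_zero.1 hb)
    have ha : V.coeff 0 ≠ 0 := fun h => hV (by rw [hV1, h, Polynomial.C_0])
    apply hq0
    have key : ∀ n, (V * q).coeff n = V.coeff 0 * q.coeff n := by
      intro n; conv_lhs => rw [hV1]
      rw [Polynomial.coeff_C_mul]
    ext1 n
    rw [Polynomial.coeff_zero]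
    have hz : ∀ n, V.coeff (n+1) = 0 := fun n => by rw [hV1, Polynomial.coeff_C_succ]
    rcases n with _ | _ | n
    · rw [key] at hc0
      exact mul_pderiv_zero (true, N) _ _ ha (by rw [hc0, mul_comm])
    · have := hcs 0
      rw [key, hz, map_zero, zero_sub] at this
      have := mul_pderiv_zero (false, N) (- q.coeff 1) _ ha (by rw [← neg_neg (pderiv _ _), this]; ring)
      simpa using this
    · have := hcs (n+1)
      rw [key, hz, hz, map_zero, map_zero, zero_sub, neg_zero] at this
      exact (mul_eq_zero.1 this.symm).resolve_left ha
  · have hV1 : V = Polynomial.C (V.coeff 0) + Polynomial.C (V.coeff 1) * Polynomial.X := by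
      rw [add_comm]; exact Polynomial.eq_X_add_C_of_natDegree_le_one hd
    have hdV : V.natDegree = 1 := le_antisymm hd (Polynomial.le_natDegree_of_ne_zero hb)
    have hqd : q.natDegree ≤ 1 := by have := DN_natDegree N V; omega
    have hq1 : q = Polynomial.C (q.coeff 0) + Polynomial.C (q.coeff 1) * Polynomial.X := by
      rw [add_comm]; exact Polynomial.eq_X_add_C_of_natDegree_le_one hqd
    have hexp : V * q = Polynomial.C (V.coeff 0 * q.coeff 0) + Polynomial.C (V.coeff 0 * q.coeff 1 + V.coeff 1 * q.coeff 0) * Polynomial.X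
        + Polynomial.C (V.coeff 1 * q.coeff 1) * Polynomial.X ^ 2 := by
      conv_lhs => rw [hV1, hq1]
      simp only [Polynomial.C_mul, Polynomial.C_add]; ring
    have e1 := hcs 0
    have e2 := hcs 1
    have hV2 : V.coeff 2 = 0 := Polynomial.coeff_eq_zero_of_natDegree_lt (by omega)
    rw [hexp] at hc0 e1 e2
    simp [Polynomial.coeff_X, Polynomial.coeff_X_pow, Polynomial.coeff_C, -Polynomial.C_mul, -map_mul, -map_add, -Polynomial.C_add] at hc0 e1 e2
    rw [hV2, map_zero, zero_sub] at e2
    have f1 : q.coeff 1 = 0 := by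
      have := mul_pderiv_zero (false, N) (- q.coeff 1) _ hb (by rw [← neg_neg (pderiv _ _), e2]; ring)
      simpa using this
    have f0 : q.coeff 0 = 0 := by
      by_cases ha : V.coeff 0 = 0
      · rw [ha, f1, map_zero, sub_zero] at e1
        exact mul_pderiv_zero (true, N) _ _ hb (by rw [e1]; ring)
      · exact mul_pderiv_zero (true, N) _ _ ha (by rw [hc0]; ring)
    apply hq0
    rw [hq1, f0, f1]; simp

theorem affine_form [CharZero K] (V : Polynomial (SS K)) (hd : V.natDegree ≤ 1) (h : ∀ N, DN N V = 0) :
    ∃ (c b : K) (m : Fin 3 → K), V = Polynomial.C (C c) + Polynomial.X * Polynomial.C (C b) + ∑ k, Polynomial.C (C (m k)) * yk K k := by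
  have e0 : ∀ N, pderiv (true, N) (V.coeff 0) = 0 := fun N => by rw [← coeff_DN_zero, h]; simp
  have e1 : ∀ N, pderiv (true, N) (V.coeff 1) = pderiv (false, N) (V.coeff 0) := fun N => by
    have := coeff_DN_succ N V 0
    rw [h] at this
    simpa using (sub_eq_zero.1 this.symm)
  have hV2 : V.coeff 2 = 0 := Polynomial.coeff_eq_zero_of_natDegree_lt (by omega)
  have e2 : ∀ N, pderiv (false, N) (V.coeff 1) = 0 := fun N => by
    have := coeff_DN_succ N V 1
    rw [h, hV2, map_zero, zero_sub] at this
    simpa using this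
  have comm : ∀ (i j : Bool × Fin 3) (a : SS K), pderiv i (pderiv j a) = pderiv j (pderiv i a) := by
    intro i j a
    ext m
    simp only [coeff_pderiv]
    rw [add_right_comm]
    by_cases hij : i = j
    · rw [hij]
    · simp [hij, Ne.symm hij]; ring
  have hm : ∀ N, ∃ m : K, pderiv (false, N) (V.coeff 0) = C m := by
    intro N
    refine ⟨_, const_of_pderiv _ ?_⟩
    rintro ⟨_ | _, M⟩
    · rw [← e1, comm, e2, map_zero]
    · rw [comm, e0, map_zero]
  choose m hm using hm
  have hA := const_of_pderiv (V.coeff 0 - ∑ k, C (m k) * X (false, k)) (by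
    rintro ⟨_ | _, M⟩
    · rw [map_sub, hm, map_sum]
      simp [Pi.single_apply, Finset.sum_ite_eq]
    · rw [map_sub, e0, map_sum]
      simp)
  have hB := const_of_pderiv (V.coeff 1 - ∑ k, C (m k) * X (true, k)) (by
    rintro ⟨_ | _, M⟩
    · rw [map_sub, e2, map_sum]
      simp
    · rw [map_sub, e1, hm, map_sum]
      simp [Pi.single_apply, Finset.sum_ite_eq])
  refine ⟨coeff 0 (V.coeff 0 - ∑ k, C (m k) * X (false, k)), coeff 0 (V.coeff 1 - ∑ k, C (m k) * X (true, k)), m, ?_⟩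
  · rw [← hA, ← hB]
    have hV1 : V = Polynomial.C (V.coeff 0) + Polynomial.C (V.coeff 1) * Polynomial.X := by
      rw [add_comm]; exact Polynomial.eq_X_add_C_of_natDegree_le_one hd
    conv_lhs => rw [hV1]
    simp only [yk, Fin.sum_univ_three, Polynomial.C_sub, Polynomial.C_add, Polynomial.C_mul]
    ring

theorem no_lin_syz [IsAlgClosed K] [CharZero K] (G : Fin 3 → MvPolynomial (Fin 3) K) {e : ℕ} (he : 4 ≤ e) (hG : ∀ i, (G i).IsHomogeneous e)
    (hz : ∀ x : Fin 3 → K, (∀ i, eval x (G i) = 0) → x = 0) (L : Fin 3 → Polynomial (SS K)) (hL : ∀ j, (L j).natDegree ≤ 1)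
    (h : ∑ j, L j * gk (G j) = 0) : L = 0 := by
  by_contra hL0
  obtain ⟨κ, V, hκ, hLV, hpar⟩ := par_lemma L hL0
  have hVd : ∀ j, (V j).natDegree ≤ 1 := by
    intro j
    by_cases hv : V j = 0
    · simp [hv]
    have := hL j
    rw [hLV, Polynomial.natDegree_mul hκ hv] at this
    omega
  have hV : ∑ j, V j * gk (G j) = 0 := by
    refine (mul_eq_zero.1 (?_ : κ * _ = 0)).resolve_left hκ
    rw [← h, Finset.mul_sum]
    exact Finset.sum_congr rfl fun j _ => by rw [hLV]; ring
  have hDV : ∀ N, ∑ j, DN N (V j) * gk (G j) = 0 := by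
    intro N
    have := congrArg (DN N) hV
    rw [map_sum, map_zero] at this
    rw [← this]
    refine Finset.sum_congr rfl fun j _ => ?_
    rw [Derivation.leibniz, der_gk _ (DN_yk N)]
    simp [mul_comm]
  have hpr : ∀ N i j, V i * DN N (V j) = V j * DN N (V i) := by
    intro N
    have hDd : ∀ j, (DN N (V j)).natDegree ≤ 2 := fun j => (DN_natDegree N _).trans (by have := hVd j; omega)
    have hm : ∀ i j, (V i * DN N (V j) - V j * DN N (V i)).natDegree < e := by
      intro i j
      refine lt_of_le_of_lt (b := 3) ((Polynomial.natDegree_sub_le _ _).trans (max_le ?_ ?_)) (by omega)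
      · exact Polynomial.natDegree_mul_le.trans (by have := hVd i; have := hDd j; omega)
      · exact Polynomial.natDegree_mul_le.trans (by have := hVd j; have := hDd i; omega)
    have h1 := hV
    have h2 := hDV N
    rw [Fin.sum_univ_three] at h1 h2
    have hc := deg_zero_of_par G hG (exists_n0 G hG hz).1
      ![V 1 * DN N (V 2) - V 2 * DN N (V 1), V 2 * DN N (V 0) - V 0 * DN N (V 2), V 0 * DN N (V 1) - V 1 * DN N (V 0)] ?_ ?_
    · have c0 := congrFun hc 0
      have c1 := congrFun hc 1
      have c2 := congrFun hc 2
      simp only [Matrix.cons_val, Pi.zero_apply] at c0 c1 c2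
      intro i j
      fin_cases i <;> fin_cases j <;> simp only [Fin.zero_eta, Fin.mk_one, Fin.reduceFinMk] <;> grind
    · intro i j
      fin_cases i <;> fin_cases j <;> simp only [Fin.zero_eta, Fin.mk_one, Fin.reduceFinMk, Matrix.cons_val]
      · linear_combination DN N (V 2) * h1 - V 2 * h2
      · linear_combination (-DN N (V 1)) * h1 + V 1 * h2
      · linear_combination (-DN N (V 2)) * h1 + V 2 * h2
      · linear_combination DN N (V 0) * h1 - V 0 * h2
      · linear_combination DN N (V 1) * h1 - V 1 * h2
      · linear_combination (-DN N (V 0)) * h1 + V 0 * h2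
    · intro i
      fin_cases i
      · exact hm 1 2
      · exact hm 2 0
      · exact hm 0 1
  have hD0 : ∀ N j, DN N (V j) = 0 := fun N j => DN_zero_of_dvd N _ (hVd j) (hpar (fun j => DN N (V j)) (hpr N) j)
  choose c b m hcbm using fun j => affine_form (V j) (hVd j) (fun N => hD0 N j)
  -- specialise
  let φ : SS K →ₐ[K] MvPolynomial (Fin 3) K := aeval fun p : Bool × Fin 3 => if p.1 then 0 else X p.2
  have hφ : ∀ f : MvPolynomial (Fin 3) K, (Polynomial.mapAlgHom φ) (gk f) = Polynomial.C f := by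
    intro f
    have h2 : (Polynomial.mapAlgHom φ).comp (aeval (yk K)) = (aeval fun k : Fin 3 => (Polynomial.C (X k) : Polynomial (MvPolynomial (Fin 3) K))) := by
      apply MvPolynomial.algHom_ext
      intro k
      simp [yk, φ]
    have h3 := DFunLike.congr_fun h2 f
    have := aeval_algebraMap_apply (R := K) (Polynomial (MvPolynomial (Fin 3) K)) (X : Fin 3 → MvPolynomial (Fin 3) K) f
    rw [aeval_X_left_apply] at this
    exact h3.trans this
  have hV' : ∀ j, (Polynomial.mapAlgHom φ) (V j) = Polynomial.C (C (c j) + ∑ k, C (m j k) * X k) + Polynomial.X * Polynomial.C (C (b j)) := by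
    intro j
    have hC : ∀ a : K, φ (C a) = C a := fun a => by simp [φ]
    rw [hcbm j]
    simp only [yk, Fin.sum_univ_three, map_add, map_mul, Polynomial.coe_mapAlgHom, Polynomial.map_C, Polynomial.map_X, RingHom.coe_coe, hC, φ, aeval_X]
    simp [Polynomial.map_add, Polynomial.map_mul]
    ring
  have hs := congrArg (Polynomial.mapAlgHom φ) hV
  rw [map_sum, map_zero] at hs
  simp only [map_mul, hφ, hV'] at hs
  have hs0 := congrArg (fun p => Polynomial.coeff p 0) hs
  have hs1 := congrArg (fun p => Polynomial.coeff p 1) hs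
  simp only [Polynomial.finsetSum_coeff, Polynomial.coeff_mul_C, Polynomial.coeff_add, Polynomial.coeff_C_zero, Polynomial.mul_coeff_zero, Polynomial.coeff_X_zero, zero_mul, add_zero, Polynomial.coeff_zero, Polynomial.coeff_X_one, Polynomial.coeff_C_succ, zero_add, one_mul] at hs0 hs1
  have cz : ∀ b : Fin 3 → K, ∑ j, C (b j) * G j = 0 → b = 0 := by
    intro b hb
    have := koszul G (by omega) hG hz (fun j => X 0 * C (b j)) (fun j => by simpa using (isHomogeneous_X K (0 : Fin 3)).mul (isHomogeneous_C (Fin 3) (b j))) (by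
      simp only [mul_assoc, ← Finset.mul_sum, hb, mul_zero])
    funext j
    have := congrFun this j
    simpa using this
  have hb : b = 0 := cz b hs1
  have hlin : ∀ j, (∑ k, C (m j k) * X k : MvPolynomial (Fin 3) K).IsHomogeneous 1 := fun j =>
    IsHomogeneous.sum _ _ _ fun k _ => by simpa using (isHomogeneous_C (Fin 3) (m j k)).mul (isHomogeneous_X K k)
  have hc : c = 0 := by
    apply cz
    have := congrArg (homogeneousComponent e) hs0
    rw [map_sum, map_zero] at this
    rw [← this]
    refine Finset.sum_congr rfl fun j _ => ?_
    rw [add_mul, map_add, homogeneousComponent_of_mem (n := 0 + e) ((isHomogeneous_C (Fin 3) (c j)).mul (hG j)),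
      homogeneousComponent_of_mem (n := 1 + e) ((hlin j).mul (hG j)), if_pos (by omega), if_neg (by omega), add_zero]
  have hm : ∀ j k, m j k = 0 := by
    have hk := koszul G (by omega) hG hz (fun j => ∑ k, C (m j k) * X k) hlin (by simpa [hc] using hs0)
    intro j k
    have := congrArg (coeff (Finsupp.single k 1)) (congrFun hk j)
    simpa [coeff_sum, coeff_C_mul, coeff_X', Finsupp.single_left_inj] using this
  apply hL0
  funext j
  rw [hLV, hcbm]
  simp [hb, hc, hm]
end

open MvPolynomial

section
variable {K : Type*} [Field K]

theorem DT_ord [CharZero K] (w : Polynomial (SS K)) (m : ℕ) (h0 : ∀ i < m, w.coeff i = 0) (h1 : w.coeff m ≠ 0) (k : ℕ) (hk : k ≤ m) :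
    (∀ i < m - k, (DT^[k] w).coeff i = 0) ∧ (DT^[k] w).coeff (m - k) ≠ 0 := by
  induction k with
  | zero => exact ⟨h0, h1⟩
  | succ k ih =>
    obtain ⟨i0, i1⟩ := ih (by omega)
    rw [Function.iterate_succ_apply']
    constructor
    · intro i hi
      rw [coeff_DT, i0 _ (by omega), i0 _ (by omega)]; simp
    · rw [coeff_DT, i0 (m - (k+1)) (by omega), show m - (k+1) + 1 = m - k by omega, map_zero, sub_zero]
      exact mul_ne_zero i1 (Nat.cast_add_one_ne_zero _)

theorem DT_natDegree (f : Polynomial (SS K)) (h : f.natDegree ≤ 1) : (DT f).natDegree ≤ 1 := by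
  rw [Polynomial.natDegree_le_iff_coeff_eq_zero] at h ⊢
  intro n hn
  rw [coeff_DT, h _ (by omega), h _ hn]; simp

theorem wron [CharZero K] (G : Fin 3 → MvPolynomial (Fin 3) K) 
    (H : ∀ L : Fin 3 → Polynomial (SS K), (∀ j, (L j).natDegree ≤ 1) → ∑ j, L j * gk (G j) = 0 → L = 0)
    (L : Fin 3 → Polynomial (SS K)) (hL : ∀ j, (L j).natDegree ≤ 1) (h : ∀ i < 6, (∑ j, L j * gk (G j)).coeff i = 0) : L = 0 := by
  classical
  by_contra hL0
  have hw : ∑ j, L j * gk (G j) ≠ 0 := fun h => hL0 (H L hL h)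
  set w := ∑ j, L j * gk (G j) with hwd
  set m := w.natTrailingDegree
  have hm1 : w.coeff m ≠ 0 := by
    have := Polynomial.trailingCoeff_nonzero_iff_nonzero.2 hw
    exact this
  have hm0 : ∀ i < m, w.coeff i = 0 := fun i hi => Polynomial.coeff_eq_zero_of_lt_natTrailingDegree hi
  have hm6 : 6 ≤ m := by
    by_contra hc; exact hm1 (h m (by omega))
  have hLk : ∀ k j, (DT^[k] (L j)).natDegree ≤ 1 := by
    intro k j
    induction k with
    | zero => exact hL j
    | succ k ih => rw [Function.iterate_succ_apply']; exact DT_natDegree _ ih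
  have hwk : ∀ k, DT^[k] w = ∑ j, DT^[k] (L j) * gk (G j) := by
    intro k
    induction k with
    | zero => rfl
    | succ k ih =>
      rw [Function.iterate_succ_apply', ih, map_sum]
      refine Finset.sum_congr rfl fun j _ => ?_
      rw [Derivation.leibniz, der_gk _ DT_yk, Function.iterate_succ_apply']
      simp [mul_comm]
  have hli : LinearIndependent (SS K) (fun (k : Fin 7) (p : Bool × Fin 3) => (DT^[k] (L p.2)).coeff (if p.1 then 1 else 0)) := by
    rw [Fintype.linearIndependent_iff]
    intro c hc
    have hs : ∀ j, ∑ k : Fin 7, Polynomial.C (c k) * DT^[k] (L j) = 0 := by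
      intro j
      ext1 n
      simp only [Polynomial.finsetSum_coeff, Polynomial.coeff_C_mul, Polynomial.coeff_zero]
      rcases n with _ | _ | n
      · simpa using congrFun hc (false, j)
      · simpa using congrFun hc (true, j)
      · refine Finset.sum_eq_zero fun k _ => ?_
        rw [Polynomial.coeff_eq_zero_of_natDegree_lt (by have := hLk k j; omega), mul_zero]
    have hs2 : ∑ k : Fin 7, Polynomial.C (c k) * DT^[k] w = 0 := by
      simp only [hwk, Finset.mul_sum, ← mul_assoc]
      rw [Finset.sum_comm]
      simp only [← Finset.sum_mul, hs, zero_mul, Finset.sum_const_zero]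
    by_contra hne
    push Not at hne
    obtain ⟨k0, hk0⟩ := hne
    obtain ⟨k, hk, hmax⟩ := Finset.exists_max_image (Finset.univ.filter fun k => c k ≠ 0) id ⟨k0, by simp [hk0]⟩
    simp only [Finset.mem_filter, Finset.mem_univ, true_and, id] at hk hmax
    have := congrArg (fun p => Polynomial.coeff p (m - k)) hs2
    simp only [Polynomial.finsetSum_coeff, Polynomial.coeff_C_mul, Polynomial.coeff_zero] at this
    rw [Finset.sum_eq_single k] at this
    · exact mul_ne_zero hk (DT_ord w m hm0 hm1 k (by omega)).2 this
    · intro b _ hb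
      by_cases hcb : c b = 0
      · rw [hcb, zero_mul]
      have := hmax b hcb
      have hlt : b < k := lt_of_le_of_ne this hb
      have hlt : (b:ℕ) < k := hlt
      rw [(DT_ord w m hm0 hm1 b (by omega)).1 _ (by omega), mul_zero]
    · simp
  have := hli.fintype_card_le_finrank
  simp at this

theorem nd_exists [IsAlgClosed K] [CharZero K] (G : Fin 3 → MvPolynomial (Fin 3) K) {e : ℕ} (he : 4 ≤ e) (hG : ∀ i, (G i).IsHomogeneous e)
    (hz : ∀ x : Fin 3 → K, (∀ i, eval x (G i) = 0) → x = 0) :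
    ∃ P Q : Fin 3 → K, ∀ A B : Fin 3 → K, (∀ i < 6, (∑ j, (Polynomial.C (A j) + Polynomial.X * Polynomial.C (B j)) *
      aeval (fun k => Polynomial.C (P k) + Polynomial.X * Polynomial.C (Q k)) (G j)).coeff i = 0) → A = 0 ∧ B = 0 := by
  classical
  let ε : Bool × Fin 3 ≃ Fin 6 := Fintype.equivOfCardEq (by simp)
  let M : Matrix (Bool × Fin 3) (Bool × Fin 3) (SS K) := fun r p => ((if p.1 then Polynomial.X else 1) * gk (G p.2)).coeff (ε r)
  have hexp : ∀ {R : Type _} [CommRing R] (v : Bool × Fin 3 → R) (g : Fin 3 → Polynomial R) (n : ℕ), 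
     (∑ j, (Polynomial.C (v (false, j)) + Polynomial.X * Polynomial.C (v (true, j))) * g j).coeff n = ∑ p : Bool × Fin 3, ((if p.1 then Polynomial.X else 1) * g p.2).coeff n * v p := by
    intro R _ v g n
    rw [Fintype.sum_prod_type]
    simp only [Fintype.sum_bool, if_true, Bool.false_eq_true, if_false, one_mul, ← Finset.sum_add_distrib, Polynomial.finsetSum_coeff]
    refine Finset.sum_congr rfl fun j _ => ?_
    rw [← Polynomial.coeff_mul_C, ← Polynomial.coeff_mul_C, ← Polynomial.coeff_add]
    congr 1; ring
  have hM : M.det ≠ 0 := by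
    intro h0
    obtain ⟨v, hv, hMv⟩ := Matrix.exists_mulVec_eq_zero_iff.2 h0
    apply hv
    have := wron G (fun L hL h => no_lin_syz G he hG hz L hL h) (fun j => Polynomial.C (v (false, j)) + Polynomial.X * Polynomial.C (v (true, j)))
      (fun j => by compute_degree) (by
        intro i hi
        rw [hexp v]
        have := congrFun hMv (ε.symm ⟨i, hi⟩)
        simpa [Matrix.mulVec, dotProduct, M] using this)
    funext p
    have h1 := congrFun this p.2
    have h2 := congrArg (fun q => Polynomial.coeff q 0) h1
    have h3 := congrArg (fun q => Polynomial.coeff q 1) h1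
    obtain ⟨b, j⟩ := p
    cases b
    · simpa using h2
    · simpa [Polynomial.coeff_C] using h3
  obtain ⟨z, hzz⟩ : ∃ z, eval z M.det ≠ 0 := by
    by_contra hc
    push Not at hc
    exact hM (MvPolynomial.funext fun z => by rw [hc z, map_zero])
  refine ⟨fun k => z (false, k), fun k => z (true, k), ?_⟩
  intro A B hAB
  have hev : ∀ f : MvPolynomial (Fin 3) K, (gk f).map (eval z) = aeval (fun k => Polynomial.C (z (false, k)) + Polynomial.X * Polynomial.C (z (true, k))) f := by
    intro f
    have h2 : (Polynomial.mapAlgHom (aeval z : SS K →ₐ[K] K)).comp (aeval (yk K)) = (aeval fun k : Fin 3 => Polynomial.C (z (false, k)) + Polynomial.X * Polynomial.C (z (true, k))) := by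
      apply MvPolynomial.algHom_ext
      intro k
      simp [yk]
    rw [← h2]; rfl
  rw [RingHom.map_det] at hzz
  let v : Bool × Fin 3 → K := fun p => if p.1 then B p.2 else A p.2
  have hv : v = 0 := by
    by_contra hv
    refine hzz (Matrix.exists_mulVec_eq_zero_iff.1 ⟨v, hv, ?_⟩)
    funext r
    have := hAB (ε r) (ε r).2
    have h2 := hexp v (fun j => aeval (fun k => Polynomial.C (z (false, k)) + Polynomial.X * Polynomial.C (z (true, k))) (G j)) (ε r)
    simp only [v, if_true, Bool.false_eq_true, if_false] at h2
    rw [this] at h2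
    rw [Pi.zero_apply, h2]
    simp only [Matrix.mulVec, dotProduct, RingHom.mapMatrix_apply, Matrix.map_apply, M, v]
    refine Finset.sum_congr rfl fun p _ => ?_
    rw [← hev]
    change eval z (Polynomial.coeff _ _) * _ = _
    rw [← Polynomial.coeff_map, Polynomial.map_mul]
    congr 3
    split_ifs <;> simp
  exact ⟨funext fun j => congrFun hv (false, j), funext fun j => congrFun hv (true, j)⟩
end

open MvPolynomial

section
noncomputable def TP {R A σ : Type*} [CommRing R] [CommRing A] [Algebra R A] (f : MvPolynomial σ R) (x v : σ → A) : Polynomial A :=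
  aeval (fun j => Polynomial.C (x j) + Polynomial.X * Polynomial.C (v j)) f

noncomputable def DTP {R A σ : Type*} [Fintype σ] [CommRing R] [CommRing A] [Algebra R A] (f : MvPolynomial σ R) (x v a b : σ → A) : Polynomial A :=
  ∑ j, TP (pderiv j f) x v * (Polynomial.C (a j) + Polynomial.X * Polynomial.C (b j))

theorem aeval_taylor {ι R A : Type*} [Fintype ι] [CommRing R] [CommRing A] [Algebra R A] (f : MvPolynomial ι R) (P y : ι → A) (e : A) (he : e ^ 2 = 0) :
    aeval (fun j => P j + e * y j) f = aeval P f + e * ∑ j, aeval P (pderiv j f) * y j := by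
  have h := mv_taylor (map (algebraMap R A) f) P y e
  rw [he, zero_dvd_iff] at h
  simp only [pderiv_map, eval_map, ← aeval_def] at h
  linear_combination h

theorem DTP_dual {R A σ : Type*} [Fintype σ] [CommRing R] [CommRing A] [Algebra R A] (f : MvPolynomial σ R) (x v a b : σ → A) (e : A) (he : e ^ 2 = 0) :
    TP f (fun j => x j + e * a j) (fun j => v j + e * b j) = TP f x v + Polynomial.C e * DTP f x v a b := by
  have := aeval_taylor f (fun j => Polynomial.C (x j) + Polynomial.X * Polynomial.C (v j)) (fun j => Polynomial.C (a j) + Polynomial.X * Polynomial.C (b j)) (Polynomial.C e) (by rw [← Polynomial.C_pow, he, Polynomial.C_0])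
  unfold DTP
  unfold TP
  rw [← this]
  congr 2
  funext j
  simp only [Polynomial.C_add, Polynomial.C_mul]; ring

theorem dual_eval {ι R A : Type*} [Fintype ι] [CommRing R] [CommRing A] [Algebra R A] (f : MvPolynomial ι R) (P y : ι → A) :
    aeval (fun j => (TrivSqZeroExt.inl (P j) + TrivSqZeroExt.inr (y j) : DualNumber A)) f = TrivSqZeroExt.inl (aeval P f) + TrivSqZeroExt.inr (∑ j, aeval P (pderiv j f) * y j) := by
  have h := aeval_taylor f (fun j => algebraMap A (DualNumber A) (P j)) (fun j => algebraMap A (DualNumber A) (y j)) DualNumber.eps (by rw [pow_two, DualNumber.eps_mul_eps])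
  have q1 : ∀ p : A, (TrivSqZeroExt.inr p : DualNumber A) = DualNumber.eps * algebraMap A (DualNumber A) p := fun p => by
    ext <;> simp [TrivSqZeroExt.algebraMap_eq_inl]
  have q2 : ∀ p : A, (TrivSqZeroExt.inl p : DualNumber A) = algebraMap A (DualNumber A) p := fun p => rfl
  have q3 : ∀ g : MvPolynomial ι R, aeval (fun j => algebraMap A (DualNumber A) (P j)) g = algebraMap A (DualNumber A) (aeval P g) := fun g => aeval_algebraMap_apply (R := R) (DualNumber A) P g
  simp only [q3] at h
  simp only [q1, q2]
  rw [h, map_sum]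
  simp only [map_mul]

variable {K : Type*} [Field K]

theorem vanish_alg [Infinite K] {F : MvPolynomial (Fin 6) K} {W : Submodule K (Fin 6 → K)} (hW : ∀ w ∈ W, eval w F = 0)
    {A : Type*} [CommRing A] [Algebra K A] (w : Fin 3 → Fin 6 → K) (hw : ∀ k, w k ∈ W) (s : Fin 3 → A) :
    aeval (fun j => ∑ k, s k * algebraMap K A (w k j)) F = 0 := by
  have h : bind₁ (fun j => ∑ k, X k * C (w k j)) F = (0 : MvPolynomial (Fin 3) K) := by
    refine MvPolynomial.funext fun s => ?_
    rw [map_zero]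
    have : eval s (bind₁ (fun j => ∑ k, X k * C (w k j)) F) = eval (∑ k, s k • w k) F := by
      change aeval s _ = _
      rw [aeval_bind₁]
      simp only [map_sum, map_mul, aeval_X, aeval_C]
      change eval _ F = _
      congr 2
    rw [this]
    exact hW _ (Submodule.sum_mem _ fun k _ => Submodule.smul_mem _ _ (hw k))
  have := congrArg (aeval s) h
  rw [aeval_bind₁, map_zero] at this
  simpa using this

theorem DTP_W [Infinite K] {F : MvPolynomial (Fin 6) K} {W : Submodule K (Fin 6 → K)} (hW : ∀ w ∈ W, eval w F = 0)
    (b : Module.Basis (Fin 3) K W) {x v y z : Fin 6 → K} (hx : x ∈ W) (hv : v ∈ W) (hy : y ∈ W) (hz : z ∈ W) : TP F x v = 0 ∧ DTP F x v y z = 0 := by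
  have hrep : ∀ {x : Fin 6 → K} (hx : x ∈ W) (j), x j = ∑ k, b.repr ⟨x, hx⟩ k * (b k : Fin 6 → K) j := by
    intro x hx j
    have := congrArg (fun u : W => (u : Fin 6 → K) j) (b.sum_repr ⟨x, hx⟩)
    simp only [AddSubmonoidClass.coe_finsetSum, Submodule.coe_smul, Finset.sum_apply, Pi.smul_apply, smul_eq_mul] at this
    exact this.symm
  have h1 : TP F x v = 0 := by
    have := vanish_alg hW (A := Polynomial K) (fun k => (b k : Fin 6 → K)) (fun k => (b k).2) (fun k => Polynomial.C (b.repr ⟨x, hx⟩ k) + Polynomial.X * Polynomial.C (b.repr ⟨v, hv⟩ k))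
    rw [← this]
    unfold TP
    congr 2
    funext j
    rw [hrep hx j, hrep hv j]
    simp only [map_sum, map_mul, Finset.mul_sum, ← Finset.sum_add_distrib]
    exact Finset.sum_congr rfl fun k _ => by rw [← Polynomial.C_eq_algebraMap]; ring
  refine ⟨h1, ?_⟩
  have h2 := vanish_alg hW (A := DualNumber (Polynomial K)) (fun k => (b k : Fin 6 → K)) (fun k => (b k).2) (fun k => (TrivSqZeroExt.inl (Polynomial.C (b.repr ⟨x, hx⟩ k) + Polynomial.X * Polynomial.C (b.repr ⟨v, hv⟩ k)) + DualNumber.eps * TrivSqZeroExt.inl (Polynomial.C (b.repr ⟨y, hy⟩ k) + Polynomial.X * Polynomial.C (b.repr ⟨z, hz⟩ k))))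
  have h3 := dual_eval F (fun j => (Polynomial.C (x j) + Polynomial.X * Polynomial.C (v j))) (fun j => (Polynomial.C (y j) + Polynomial.X * Polynomial.C (z j)))
  have h4 : aeval (fun j => (TrivSqZeroExt.inl (Polynomial.C (x j) + Polynomial.X * Polynomial.C (v j)) + TrivSqZeroExt.inr (Polynomial.C (y j) + Polynomial.X * Polynomial.C (z j)) : DualNumber (Polynomial K))) F = 0 := by
    rw [← h2]
    congr 2
    funext j
    have q2 : ∀ p : K, (algebraMap K (DualNumber (Polynomial K)) p) = TrivSqZeroExt.inl (Polynomial.C p) := fun p => rfl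
    rw [hrep hx j, hrep hv j, hrep hy j, hrep hz j]
    ext1
    · simp [q2, map_sum, Finset.mul_sum, ← Finset.sum_add_distrib, TrivSqZeroExt.fst_sum]
      exact Finset.sum_congr rfl fun k _ => by ring
    · simp [q2, map_sum, Finset.mul_sum, ← Finset.sum_add_distrib, TrivSqZeroExt.snd_sum]
      exact Finset.sum_congr rfl fun k _ => by ring
  rw [h4] at h3
  have h5 := congrArg TrivSqZeroExt.snd h3
  simp only [TrivSqZeroExt.snd_add, TrivSqZeroExt.snd_inl, TrivSqZeroExt.snd_inr, zero_add, TrivSqZeroExt.snd_zero] at h5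
  exact h5.symm
end

open MvPolynomial

section
variable {K : Type*} [Field K]

theorem plane_data (W : Submodule K (Fin 6 → K)) (hW : Module.finrank K W = 3) :
    ∃ (A : Matrix (Fin 3) (Fin 6) K) (n : Fin 3 → Fin 6 → K), (∀ x, x ∈ W ↔ A.mulVec x = 0) ∧ ∀ k, A.mulVec (n k) = Pi.single k 1 := by
  have h1 : Module.finrank K ((Fin 6 → K) ⧸ W) = Module.finrank K (Fin 3 → K) := by
    have := Submodule.finrank_quotient_add_finrank W
    simp at this ⊢
    omega
  let e := LinearEquiv.ofFinrankEq _ _ h1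
  let f : (Fin 6 → K) →ₗ[K] (Fin 3 → K) := e.toLinearMap ∘ₗ W.mkQ
  have hs : Function.Surjective f := e.surjective.comp (Submodule.mkQ_surjective W)
  have hm : ∀ x, (LinearMap.toMatrix' f).mulVec x = f x := fun x => by
    rw [← Matrix.toLin'_apply, Matrix.toLin'_toMatrix']
  choose n hn using fun k : Fin 3 => hs (Pi.single k 1)
  refine ⟨LinearMap.toMatrix' f, n, fun x => ?_, fun k => by rw [hm, hn]⟩
  rw [hm]
  simp [f]

theorem DTP_add {R A σ : Type*} [Fintype σ] [CommRing R] [CommRing A] [Algebra R A] (f : MvPolynomial σ R) (x v a b a' b' : σ → A) :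
    DTP f x v (a + a') (b + b') = DTP f x v a b + DTP f x v a' b' := by
  unfold DTP
  rw [← Finset.sum_add_distrib]
  refine Finset.sum_congr rfl fun j _ => ?_
  simp only [Pi.add_apply, Polynomial.C_add]; ring

theorem mulVec_sum_n {A : Matrix (Fin 3) (Fin 6) K} {n : Fin 3 → Fin 6 → K} (hn : ∀ k, A.mulVec (n k) = Pi.single k 1) (c : Fin 3 → K) :
    A.mulVec (∑ k, c k • n k) = c := by
  rw [Matrix.mulVec_sum]
  simp only [Matrix.mulVec_smul, hn]
  funext i
  simp [Pi.single_apply]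

theorem DTP_n {F : MvPolynomial (Fin 6) K} (x v : Fin 6 → K) (n : Fin 3 → Fin 6 → K) (c e : Fin 3 → K) :
    DTP F x v (∑ k, c k • n k) (∑ k, e k • n k) = ∑ k, (Polynomial.C (c k) + Polynomial.X * Polynomial.C (e k)) * ∑ j, TP (pderiv j F) x v * Polynomial.C (n k j) := by
  unfold DTP
  simp only [Finset.mul_sum]
  rw [Finset.sum_comm]
  refine Finset.sum_congr rfl fun j _ => ?_
  simp only [Finset.sum_apply, Pi.smul_apply, smul_eq_mul, map_sum, Finset.mul_sum, ← Finset.sum_add_distrib, Polynomial.C_mul]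
  refine Finset.sum_congr rfl fun k _ => ?_
  ring

def NDv (F : MvPolynomial (Fin 6) K) (W : Submodule K (Fin 6 → K)) (x v : Fin 6 → K) : Prop :=
  ∀ a b, (∀ i < 6, (DTP F x v a b).coeff i = 0) → a ∈ W ∧ b ∈ W

theorem L_nd [IsAlgClosed K] [CharZero K] {d : ℕ} (hd : 5 ≤ d) (F : MvPolynomial (Fin 6) K)
    (hF : F.IsHomogeneous d)
    (hsmooth : ∀ x : Fin 6 → K, (∀ i, eval x (pderiv i F) = 0) → x = 0)
    (W : Submodule K (Fin 6 → K)) (hW : Module.finrank K W = 3) (hFW : ∀ w ∈ W, eval w F = 0) :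
    ∃ x ∈ W, ∃ v ∈ W, NDv F W x v := by
  obtain ⟨A, n, hA, hn⟩ := plane_data W hW
  let w := Module.finBasisOfFinrankEq K W hW
  have : Infinite K := inferInstance
  let G : Fin 3 → MvPolynomial (Fin 3) K := fun i => ∑ j, aeval (fun j => ∑ k, X k * C ((w k : Fin 6 → K) j)) (pderiv j F) * C (n i j)
  have hG : ∀ i, (G i).IsHomogeneous (d - 1) := by
    intro i
    refine IsHomogeneous.sum _ _ _ fun j _ => ?_
    rw [← add_zero (d - 1)]
    refine IsHomogeneous.mul ?_ (isHomogeneous_C _ _)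
    have := (hF.pderiv (i := j)).aeval (n := 1) (fun j => ∑ k, X k * C ((w k : Fin 6 → K) j)) (fun j => by
      refine IsHomogeneous.sum _ _ _ fun k _ => ?_
      exact (isHomogeneous_X _ _).mul (isHomogeneous_C _ _))
    simpa using this
  have hmem : ∀ s : Fin 3 → K, (fun j => ∑ k, s k * (w k : Fin 6 → K) j) ∈ W := by
    intro s
    have : (fun j => ∑ k, s k * (w k : Fin 6 → K) j) = ∑ k, s k • (w k : Fin 6 → K) := by
      funext j; simp
    rw [this]
    exact Submodule.sum_mem _ fun k _ => Submodule.smul_mem _ _ (w k).2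
  have hdec : ∀ a : Fin 6 → K, a - ∑ k, A.mulVec a k • n k ∈ W := by
    intro a
    rw [hA, Matrix.mulVec_sub, mulVec_sum_n hn, sub_self]
  have hz : ∀ x : Fin 3 → K, (∀ i, eval x (G i) = 0) → x = 0 := by
    intro s hs
    have h0 : (fun j => ∑ k, s k * (w k : Fin 6 → K) j) = 0 := by
      apply hsmooth
      set x : Fin 6 → K := (fun j => ∑ k, s k * (w k : Fin 6 → K) j) with hx
      have hTP : ∀ f : MvPolynomial (Fin 6) K, TP f x 0 = Polynomial.C (eval x f) := by
        intro f
        unfold TP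
        simp only [Pi.zero_apply, Polynomial.C_0, mul_zero, add_zero]
        exact aeval_algebraMap_apply (R := K) (Polynomial K) x f
      have hD : ∀ a : Fin 6 → K, DTP F x 0 a 0 = Polynomial.C (∑ j, eval x (pderiv j F) * a j) := by
        intro a
        unfold DTP
        simp only [hTP, Pi.zero_apply, Polynomial.C_0, mul_zero, add_zero, map_sum, map_mul]
      have hW0 : ∀ a ∈ W, ∑ j, eval x (pderiv j F) * a j = 0 := by
        intro a ha
        have := (DTP_W hFW w (hmem s) W.zero_mem ha W.zero_mem).2
        rw [← hx, hD] at this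
        exact Polynomial.C_eq_zero.1 this
      have hn0 : ∀ i, ∑ j, eval x (pderiv j F) * n i j = 0 := by
        intro i
        rw [← hs i]
        simp only [G, map_sum, map_mul, eval_C]
        refine Finset.sum_congr rfl fun j _ => ?_
        congr 1
        change _ = aeval s (bind₁ _ _)
        rw [aeval_bind₁]
        simp only [map_sum, map_mul, aeval_X, aeval_C]
        rfl
      intro i
      have h1 := hW0 _ (hdec (Pi.single i 1))
      simp only [Pi.sub_apply, mul_sub, Finset.sum_sub_distrib] at h1
      have h2 : ∑ j, eval x (pderiv j F) * (∑ k, A.mulVec (Pi.single i 1) k • n k) j = 0 := by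
        simp only [Finset.sum_apply, Pi.smul_apply, smul_eq_mul, Finset.mul_sum]
        rw [Finset.sum_comm]
        refine Finset.sum_eq_zero fun k _ => ?_
        have := hn0 k
        calc _ = A.mulVec (Pi.single i 1) k * ∑ j, eval x (pderiv j F) * n k j := by
              rw [Finset.mul_sum]; exact Finset.sum_congr rfl fun j _ => by ring
          _ = 0 := by rw [this, mul_zero]
      rw [h2, sub_zero] at h1
      simpa [Pi.single_apply] using h1
    have h1 : ∑ k, s k • w k = 0 := by
      apply Subtype.ext
      funext j
      have := congrFun h0 j
      simpa using this
    have := Fintype.linearIndependent_iff.1 w.linearIndependent s h1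
    funext k; exact this k
  obtain ⟨P, Q, hPQ⟩ := nd_exists G (e := d - 1) (by omega) hG hz
  refine ⟨_, hmem P, _, hmem Q, ?_⟩
  intro a b hab
  set x : Fin 6 → K := (fun j => ∑ k, P k * (w k : Fin 6 → K) j) with hx
  set v : Fin 6 → K := (fun j => ∑ k, Q k * (w k : Fin 6 → K) j) with hv
  have h1 : DTP F x v a b = ∑ j, (Polynomial.C (A.mulVec a j) + Polynomial.X * Polynomial.C (A.mulVec b j)) * aeval (fun k => Polynomial.C (P k) + Polynomial.X * Polynomial.C (Q k)) (G j) := by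
    have e1 : DTP F x v a b = DTP F x v ((a - ∑ k, A.mulVec a k • n k) + ∑ k, A.mulVec a k • n k) ((b - ∑ k, A.mulVec b k • n k) + ∑ k, A.mulVec b k • n k) := by
      rw [sub_add_cancel, sub_add_cancel]
    rw [e1, DTP_add, (DTP_W hFW w (hmem P) (hmem Q) (hdec a) (hdec b)).2, zero_add, DTP_n]
    refine Finset.sum_congr rfl fun i _ => ?_
    congr 1
    simp only [G, map_sum, map_mul]
    refine Finset.sum_congr rfl fun j _ => ?_
    congr 1
    · change _ = aeval _ (bind₁ _ _)
      rw [aeval_bind₁]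
      unfold TP
      congr 2
      funext j
      simp only [map_sum, map_mul, aeval_X, aeval_C, hx, hv, Finset.mul_sum, ← Finset.sum_add_distrib, ← Polynomial.C_eq_algebraMap]
      exact Finset.sum_congr rfl fun k _ => by ring
    · rw [aeval_C]; rfl
  obtain ⟨h2, h3⟩ := hPQ (A.mulVec a) (A.mulVec b) (fun i hi => by rw [← h1]; exact hab i hi)
  exact ⟨(hA a).2 h2, (hA b).2 h3⟩
end

open MvPolynomial

section
variable {K : Type*} [Field K]

theorem TP_map {R A B σ : Type*} [CommRing R] [CommRing A] [Algebra R A] [CommRing B] [Algebra R B] (φ : A →ₐ[R] B) (f : MvPolynomial σ R) (x v : σ → A) :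
    (TP f x v).map (φ : A →+* B) = TP f (fun j => φ (x j)) (fun j => φ (v j)) := by
  unfold TP
  have h := MvPolynomial.map_aeval (fun j => Polynomial.C (x j) + Polynomial.X * Polynomial.C (v j)) (Polynomial.mapAlgHom φ : Polynomial A →+* Polynomial B) f
  have h2 : ((Polynomial.mapAlgHom φ : Polynomial A →+* Polynomial B)) = Polynomial.mapRingHom (φ : A →+* B) := rfl
  have h3 : (aeval (fun j => Polynomial.C (φ (x j)) + Polynomial.X * Polynomial.C (φ (v j)))) = (Polynomial.mapAlgHom φ).comp (aeval (R := R) (fun j => Polynomial.C (x j) + Polynomial.X * Polynomial.C (v j))) := by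
    apply MvPolynomial.algHom_ext
    intro i
    simp
  rw [h3]
  rfl

/-- polynomial functions -/
noncomputable def PF (K : Type*) [Field K] (ι : Type*) : Subalgebra K ((ι → K) → K) := (aeval (R := K) (fun i (c : ι → K) => c i)).range

theorem PF_eval {ι : Type*} (q : MvPolynomial ι K) (c : ι → K) : aeval (R := K) (fun i (c : ι → K) => c i) q c = eval c q := by
  have : (Pi.evalAlgHom K (fun _ : ι → K => K) c).comp (aeval (R := K) (fun i (c : ι → K) => c i)) = aeval c := by
    apply MvPolynomial.algHom_ext
    intro i; simp
  exact DFunLike.congr_fun this q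

theorem mem_PF {ι : Type*} {f : (ι → K) → K} : f ∈ PF K ι ↔ ∃ q : MvPolynomial ι K, ∀ c, f c = eval c q := by
  constructor
  · rintro ⟨q, rfl⟩
    exact ⟨q, fun c => PF_eval q c⟩
  · rintro ⟨q, hq⟩
    exact ⟨q, by funext c; rw [hq]; exact PF_eval q c⟩

theorem PF_coord {ι : Type*} (i : ι) : (fun c : ι → K => c i) ∈ PF K ι := mem_PF.2 ⟨X i, fun c => by simp⟩
theorem PF_const {ι : Type*} (a : K) : (fun _ : ι → K => a) ∈ PF K ι := mem_PF.2 ⟨C a, fun c => by simp⟩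
theorem PF_mul {ι : Type*} {f g : (ι → K) → K} (hf : f ∈ PF K ι) (hg : g ∈ PF K ι) : (fun c => f c * g c) ∈ PF K ι := (PF K ι).mul_mem hf hg
theorem PF_neg {ι : Type*} {f : (ι → K) → K} (hf : f ∈ PF K ι) : (fun c => - f c) ∈ PF K ι := (PF K ι).neg_mem hf
theorem PF_sum {ι κ : Type*} (s : Finset κ) {f : κ → (ι → K) → K} (hf : ∀ k ∈ s, f k ∈ PF K ι) : (fun c => ∑ k ∈ s, f k c) ∈ PF K ι := by
  have := (PF K ι).sum_mem hf
  convert this using 1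
  funext c; simp
theorem PF_prod {ι κ : Type*} (s : Finset κ) {f : κ → (ι → K) → K} (hf : ∀ k ∈ s, f k ∈ PF K ι) : (fun c => ∏ k ∈ s, f k c) ∈ PF K ι := by
  have := (PF K ι).prod_mem hf
  convert this using 1
  funext c; simp
theorem PF_det {ι m : Type*} [Fintype m] [DecidableEq m] {M : (ι → K) → Matrix m m K} (hM : ∀ i j, (fun c => M c i j) ∈ PF K ι) : (fun c => (M c).det) ∈ PF K ι := by
  simp only [Matrix.det_apply']
  exact PF_sum _ fun σ _ => PF_mul (PF_const _) (PF_prod _ fun i _ => hM _ _)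
theorem PF_adj {ι m : Type*} [Fintype m] [DecidableEq m] {M : (ι → K) → Matrix m m K} (hM : ∀ i j, (fun c => M c i j) ∈ PF K ι) (i j : m) : (fun c => (M c).adjugate i j) ∈ PF K ι := by
  simp only [Matrix.adjugate_apply]
  refine PF_det fun a b => ?_
  simp only [Matrix.updateRow_apply]
  by_cases h : a = j
  · simp only [h, if_true]; exact PF_const _
  · simp only [h, if_false]; exact hM _ _

theorem PF_TP {ι : Type*} (f : MvPolynomial (Fin 6) K) {x v : (ι → K) → Fin 6 → K} (hx : ∀ j, (fun c => x c j) ∈ PF K ι) (hv : ∀ j, (fun c => v c j) ∈ PF K ι) (i : ℕ) :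
    (fun c => (TP f (x c) (v c)).coeff i) ∈ PF K ι := by
  choose x' hx' using fun j => mem_PF.1 (hx j)
  choose v' hv' using fun j => mem_PF.1 (hv j)
  refine mem_PF.2 ⟨(TP f x' v').coeff i, fun c => ?_⟩
  have := TP_map (aeval c) f x' v'
  have h2 := congrArg (fun p => p.coeff i) this
  simp only [Polynomial.coeff_map] at h2
  have e1 : x c = fun j => aeval c (x' j) := by funext j; exact hx' j c
  have e2 : v c = fun j => aeval c (v' j) := by funext j; exact hv' j c
  rw [e1, e2, ← h2]
  rfl

theorem PF_exists [Infinite K] {ι κ : Type*} (s : Finset κ) (f : κ → (ι → K) → K) (hf : ∀ k ∈ s, f k ∈ PF K ι) (hne : ∀ k ∈ s, ∃ c, f k c ≠ 0) :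
    ∃ c, ∀ k ∈ s, f k c ≠ 0 := by
  choose! q hq using fun k (hk : k ∈ s) => mem_PF.1 (hf k hk)
  have h0 : ∏ k ∈ s, q k ≠ 0 := by
    refine Finset.prod_ne_zero_iff.2 fun k hk h => ?_
    obtain ⟨c, hc⟩ := hne k hk
    exact hc (by rw [hq k hk, h, map_zero])
  by_contra! h
  apply h0
  refine MvPolynomial.funext fun c => ?_
  obtain ⟨k, hk, h1⟩ := h c
  rw [map_zero, map_prod]
  exact Finset.prod_eq_zero hk (by rw [← hq k hk, h1])

/-- the 6x6 matrix -/
noncomputable def NN (F : MvPolynomial (Fin 6) K) (n : Fin 3 → Fin 6 → K) (x v : Fin 6 → K) : Matrix (Fin 2 × Fin 3) (Fin 2 × Fin 3) K :=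
  Matrix.of fun r s => (Polynomial.X ^ (s.1 : ℕ) * ∑ j, TP (pderiv j F) x v * Polynomial.C (n s.2 j)).coeff (finProdFinEquiv r : Fin (2 * 3))

theorem NN_mulVec (F : MvPolynomial (Fin 6) K) (n : Fin 3 → Fin 6 → K) (x v : Fin 6 → K) (c : Fin 2 × Fin 3 → K) (r) :
    (NN F n x v).mulVec c r = (DTP F x v (∑ k, c (0, k) • n k) (∑ k, c (1, k) • n k)).coeff (finProdFinEquiv r : Fin (2 * 3)) := by
  rw [DTP_n, Matrix.mulVec, dotProduct, Fintype.sum_prod_type, Polynomial.finsetSum_coeff, Fin.sum_univ_two, ← Finset.sum_add_distrib]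
  refine Finset.sum_congr rfl fun k _ => ?_
  simp only [NN, Matrix.of_apply, Fin.val_zero, Fin.val_one, pow_zero, pow_one, one_mul]
  rw [add_mul, Polynomial.coeff_add, Polynomial.coeff_C_mul, mul_right_comm, Polynomial.coeff_mul_C]
  ring

theorem ND_iff [Infinite K] {F : MvPolynomial (Fin 6) K} {W : Submodule K (Fin 6 → K)} (hW : Module.finrank K W = 3) (hFW : ∀ w ∈ W, eval w F = 0)
    {A : Matrix (Fin 3) (Fin 6) K} {n : Fin 3 → Fin 6 → K} (hA : ∀ x, x ∈ W ↔ A.mulVec x = 0) (hn : ∀ k, A.mulVec (n k) = Pi.single k 1) {x v : Fin 6 → K} (hx : x ∈ W) (hv : v ∈ W) :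
    NDv F W x v ↔ (NN F n x v).det ≠ 0 := by
  have hdec : ∀ a : Fin 6 → K, a - ∑ k, A.mulVec a k • n k ∈ W := by
    intro a
    rw [hA, Matrix.mulVec_sub, mulVec_sum_n hn, sub_self]
  have hD : ∀ a b, DTP F x v a b = DTP F x v (∑ k, A.mulVec a k • n k) (∑ k, A.mulVec b k • n k) := by
    intro a b
    have e1 : DTP F x v a b = DTP F x v ((a - ∑ k, A.mulVec a k • n k) + ∑ k, A.mulVec a k • n k) ((b - ∑ k, A.mulVec b k • n k) + ∑ k, A.mulVec b k • n k) := by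
      rw [sub_add_cancel, sub_add_cancel]
    rw [e1, DTP_add, (DTP_W hFW (Module.finBasisOfFinrankEq K W hW) hx hv (hdec a) (hdec b)).2, zero_add]
  constructor
  · intro h hdet
    obtain ⟨c, hc0, hc⟩ := Matrix.exists_mulVec_eq_zero_iff.2 hdet
    apply hc0
    have := h (∑ k, c (0, k) • n k) (∑ k, c (1, k) • n k) (fun i hi => by
      have := congrFun hc (finProdFinEquiv.symm (⟨i, hi⟩ : Fin (2 * 3)))
      rw [NN_mulVec] at this
      simpa using this)
    rw [hA, hA, mulVec_sum_n hn (fun k => c (0, k)), mulVec_sum_n hn (fun k => c (1, k))] at this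
    funext ⟨b, k⟩
    fin_cases b
    · exact congrFun this.1 k
    · exact congrFun this.2 k
  · intro hdet a b hab
    let c : Fin 2 × Fin 3 → K := fun s => if s.1 = 0 then A.mulVec a s.2 else A.mulVec b s.2
    have hc : (NN F n x v).mulVec c = 0 := by
      funext r
      rw [NN_mulVec]
      have := hab (finProdFinEquiv r : Fin (2 * 3)) (finProdFinEquiv r : Fin (2 * 3)).2
      rw [hD] at this
      simpa [c] using this
    have hc0 : c = 0 := by
      by_contra h
      exact hdet (Matrix.exists_mulVec_eq_zero_iff.1 ⟨c, h, hc⟩)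
    rw [hA, hA]
    constructor
    · funext k; simpa [c] using congrFun hc0 (0, k)
    · funext k; simpa [c] using congrFun hc0 (1, k)
end

open MvPolynomial

section
def xs {A : Type*} [CommRing A] (p : Sg → A) : Fin 6 → A := ![1, p (true,0), p (true,1), p (true,2), 0, 0]
def vs {A : Type*} [CommRing A] (p : Sg → A) : Fin 6 → A := ![1, p (false,0), 0, 0, p (false,1), p (false,2)]
def xs0 {A : Type*} [CommRing A] (p : Sg → A) : Fin 6 → A := ![0, p (true,0), p (true,1), p (true,2), 0, 0]
def vs0 {A : Type*} [CommRing A] (p : Sg → A) : Fin 6 → A := ![0, p (false,0), 0, 0, p (false,1), p (false,2)]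

variable {K : Type*} [Field K]

theorem TP_smul {e : ℕ} {g : MvPolynomial (Fin 6) K} (hg : g.IsHomogeneous e) {α β : K} (hα : α ≠ 0) (x v : Fin 6 → K) :
    TP g (α • x) (β • v) = Polynomial.C (α ^ e) * (TP g x v).comp (Polynomial.C (β / α) * Polynomial.X) := by
  have h1 : (TP g x v).comp (Polynomial.C (β / α) * Polynomial.X) = TP g x ((β / α) • v) := by
    unfold TP
    have : ((aeval (R := K) (fun j => Polynomial.C (x j) + Polynomial.X * Polynomial.C (((β / α) • v) j)) : MvPolynomial (Fin 6) K →ₐ[K] Polynomial K) : MvPolynomial (Fin 6) K →+* Polynomial K) = (Polynomial.compRingHom (Polynomial.C (β / α) * Polynomial.X)).comp ((aeval (R := K) (fun j => Polynomial.C (x j) + Polynomial.X * Polynomial.C (v j))) : MvPolynomial (Fin 6) K →+* Polynomial K) := by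
      apply MvPolynomial.ringHom_ext
      · intro r; simp
      · intro i
        simp
        ring
    exact (RingHom.congr_fun this g).symm
  rw [h1]
  unfold TP
  rw [Polynomial.C_pow, ← hom_scale hg]
  congr 2
  funext j
  simp only [Pi.smul_apply, smul_eq_mul, mul_add, ← Polynomial.C_mul]
  have : β * v j = α * (β / α * v j) := by field_simp
  rw [this, Polynomial.C_mul (a := α) (b := (β / α * v j))]; ring

theorem NDv_smul {d : ℕ} {F : MvPolynomial (Fin 6) K} (hF : F.IsHomogeneous d) {W : Submodule K (Fin 6 → K)} {x v : Fin 6 → K} {α β : K} (hα : α ≠ 0) (hβ : β ≠ 0)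
    (h : NDv F W (α • x) (β • v)) : NDv F W x v := by
  intro a b hab
  have h1 : DTP F (α • x) (β • v) (α • a) (β • b) = Polynomial.C (α ^ (d - 1) * α) * (DTP F x v a b).comp (Polynomial.C (β / α) * Polynomial.X) := by
    unfold DTP
    simp only [← Polynomial.coe_compRingHom_apply, map_sum, Finset.mul_sum]
    refine Finset.sum_congr rfl fun j _ => ?_
    rw [TP_smul (hF.pderiv) hα, map_mul, map_mul]
    simp only [Pi.smul_apply, smul_eq_mul, Polynomial.coe_compRingHom_apply, Polynomial.add_comp, Polynomial.mul_comp, Polynomial.C_comp, Polynomial.X_comp]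
    have : β * b j = α * (β / α * b j) := by field_simp
    rw [this]
    simp only [Polynomial.C_mul]
    ring
  have h2 := h (α • a) (β • b) (fun i hi => by
    rw [h1, Polynomial.coeff_C_mul, Polynomial.comp_C_mul_X_coeff, hab i hi]; ring)
  exact ⟨(Submodule.smul_mem_iff _ hα).1 h2.1, (Submodule.smul_mem_iff _ hβ).1 h2.2⟩

abbrev I66 := Fin 6 × Fin 6
/-- column vectors of the product -/
def Cm (c : I66 → K) : Matrix (Fin 6) (Fin 6) K := Matrix.of fun i j => c (i, j)
def Bm (e : Fin 3 → Fin 6) (A : Matrix (Fin 3) (Fin 6) K) (c : I66 → K) : Matrix (Fin 3) (Fin 3) K := (A * Cm c).submatrix id e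
def um (A : Matrix (Fin 3) (Fin 6) K) (c : I66 → K) : Fin 3 → K := fun i => (A * Cm c) i 0
def solv (e : Fin 3 → Fin 6) (A : Matrix (Fin 3) (Fin 6) K) (c : I66 → K) : Fin 3 → K := - ((Bm e A c).adjugate.mulVec (um A c))
def hatv (e : Fin 3 → Fin 6) (A : Matrix (Fin 3) (Fin 6) K) (c : I66 → K) : Fin 6 → K :=
  fun i => (Bm e A c).det * c (i, 0) + ∑ k, solv e A c k * c (i, e k)

theorem mulVec_cols (e : Fin 3 → Fin 6) (A : Matrix (Fin 3) (Fin 6) K) (c : I66 → K) (α : K) (y : Fin 3 → K) :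
    A.mulVec (fun i => α * c (i, 0) + ∑ k, y k * c (i, e k)) = α • um A c + (Bm e A c).mulVec y := by
  funext r
  simp only [Matrix.mulVec, dotProduct, um, Bm, Pi.add_apply, Pi.smul_apply, smul_eq_mul, Matrix.submatrix_apply, Matrix.mul_apply, Cm, Matrix.of_apply, id, mul_add, Finset.sum_add_distrib, Finset.mul_sum, Finset.sum_mul]
  congr 1
  · exact Finset.sum_congr rfl fun j _ => by ring
  · rw [Finset.sum_comm]
    exact Finset.sum_congr rfl fun j _ => Finset.sum_congr rfl fun j _ => by ring

theorem A_hatv (e : Fin 3 → Fin 6) (A : Matrix (Fin 3) (Fin 6) K) (c : I66 → K) : A.mulVec (hatv e A c) = 0 := by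
  unfold hatv
  rw [mulVec_cols, solv, Matrix.mulVec_neg, Matrix.mulVec_mulVec, Matrix.mul_adjugate, Matrix.smul_mulVec, Matrix.one_mulVec, add_neg_cancel]

theorem PF_AC (A : Matrix (Fin 3) (Fin 6) K) (i j) : (fun c => (A * Cm c) i j) ∈ PF K I66 := by
  simp only [Matrix.mul_apply, Cm, Matrix.of_apply]
  exact PF_sum _ fun k _ => PF_mul (PF_const _) (PF_coord _)
theorem PF_Bdet (e) (A : Matrix (Fin 3) (Fin 6) K) : (fun c => (Bm e A c).det) ∈ PF K I66 := PF_det fun i j => PF_AC A _ _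
theorem PF_hatv (e) (A : Matrix (Fin 3) (Fin 6) K) (i) : (fun c => hatv e A c i) ∈ PF K I66 := by
  unfold hatv
  refine (PF K I66).add_mem (PF_mul (PF_Bdet e A) (PF_coord _)) (PF_sum _ fun k _ => PF_mul ?_ (PF_coord _))
  simp only [solv, Pi.neg_apply, Matrix.mulVec, dotProduct]
  exact PF_neg (PF_sum _ fun j _ => PF_mul (PF_adj (fun i j => PF_AC A _ _) _ _) (PF_AC A _ _))
theorem PF_NN (F : MvPolynomial (Fin 6) K) (n : Fin 3 → Fin 6 → K) {x v : (I66 → K) → Fin 6 → K} (hx : ∀ j, (fun c => x c j) ∈ PF K I66) (hv : ∀ j, (fun c => v c j) ∈ PF K I66) :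
    (fun c => (NN F n (x c) (v c)).det) ∈ PF K I66 := by
  refine PF_det fun r s => ?_
  simp only [NN, Matrix.of_apply, Polynomial.coeff_X_pow_mul', Polynomial.finsetSum_coeff, Polynomial.coeff_mul_C]
  split_ifs
  · exact PF_sum _ fun j _ => PF_mul (PF_TP _ hx hv _) (PF_const _)
  · exact PF_const _

abbrev ex : Fin 3 → Fin 6 := ![1,2,3]
abbrev ev : Fin 3 → Fin 6 := ![1,4,5]

/-- special matrix -/
def Cxv (n : Fin 3 → Fin 6 → K) (x v : Fin 6 → K) : I66 → K := fun ij => (![x - n 1, n 0, n 1, n 2, v - x + n 1, n 2] ij.2) ij.1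

theorem special {W : Submodule K (Fin 6 → K)} {A : Matrix (Fin 3) (Fin 6) K} {n : Fin 3 → Fin 6 → K} (hA : ∀ x, x ∈ W ↔ A.mulVec x = 0) (hn : ∀ k, A.mulVec (n k) = Pi.single k 1) {x v : Fin 6 → K} (hx : x ∈ W) (hv : v ∈ W) :
    (Bm ex A (Cxv n x v)).det = 1 ∧ (Bm ev A (Cxv n x v)).det = 1 ∧ hatv ex A (Cxv n x v) = x ∧ hatv ev A (Cxv n x v) = v := by
  have hcol : ∀ i j, (A * Cm (Cxv n x v)) i j = A.mulVec (![x - n 1, n 0, n 1, n 2, v - x + n 1, n 2] j) i := fun i j => rfl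
  have hx' := (hA x).1 hx
  have hv' := (hA v).1 hv
  have hB : Bm ex A (Cxv n x v) = 1 := by
    ext i j
    simp only [Bm, Matrix.submatrix_apply, hcol]
    fin_cases j <;> fin_cases i <;> simp [ex, hn, Matrix.one_apply]
  have hB' : Bm ev A (Cxv n x v) = 1 := by
    ext i j
    simp only [Bm, Matrix.submatrix_apply, hcol]
    fin_cases j <;> fin_cases i <;> simp [ev, hn, Matrix.one_apply, Matrix.mulVec_add, Matrix.mulVec_sub, hx', hv']
  have hu : um A (Cxv n x v) = - Pi.single 1 1 := by
    funext i
    simp only [um, hcol]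
    simp [hn, Matrix.mulVec_sub, hx']
  refine ⟨by rw [hB, Matrix.det_one], by rw [hB', Matrix.det_one], ?_, ?_⟩
  · funext i
    simp [hatv, solv, hB, hu, Fin.sum_univ_three, ex, Cxv]
  · funext i
    simp [hatv, solv, hB', hu, Fin.sum_univ_three, ev, Cxv]

theorem C5_C [IsAlgClosed K] [CharZero K] {d : ℕ} (hd : 5 ≤ d) (F : MvPolynomial (Fin 6) K)
    (hF : F.IsHomogeneous d)
    (hsmooth : ∀ x : Fin 6 → K, (∀ i, eval x (pderiv i F) = 0) → x = 0)
    {n : Type} [Fintype n] (W : n → Submodule K (Fin 6 → K)) (hinj : Function.Injective W) (hW : ∀ j, Module.finrank K (W j) = 3) (hFW : ∀ j, ∀ w ∈ W j, eval w F = 0) :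
    ∃ (M : Matrix (Fin 6) (Fin 6) K) (p : n → Sg → K), Function.Injective p ∧ ∀ j, M.mulVec (xs (p j)) ∈ W j ∧ M.mulVec (vs (p j)) ∈ W j ∧
      NDv F (W j) (M.mulVec (xs (p j))) (M.mulVec (vs (p j))) ∧
      ∀ y : Sg → K, M.mulVec (xs0 y) ∈ W j → M.mulVec (vs0 y) ∈ W j → y = 0 := by
  classical
  have : Infinite K := inferInstance
  choose A nn hA hn using fun j => plane_data (W j) (hW j)
  choose x0 hx0 v0 hv0 hnd using fun j => L_nd hd F hF hsmooth (W j) (hW j) (hFW j)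
  have hdist : ∀ j j', j ≠ j' → ∃ x ∈ W j, ∃ i, (A j').mulVec x i ≠ 0 := by
    intro j j' hjj
    by_contra! h
    have h1 : W j ≤ W j' := fun x hx => (hA j' x).2 (funext fun i => h x hx i)
    exact hjj (hinj (Submodule.eq_of_le_of_finrank_eq h1 (by rw [hW, hW])))
  choose! x1 hx1 i1 hi1 using hdist
  have P1 := PF_exists (K := K) (Finset.univ : Finset n) (fun j c => (Bm ex (A j) c).det * (Bm ev (A j) c).det * (NN F (nn j) (hatv ex (A j) c) (hatv ev (A j) c)).det * ∏ j' ∈ Finset.univ.erase j, (A j').mulVec (hatv ex (A j) c) (i1 j j')) 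
  have hq : ∀ j j', (fun c => (A j').mulVec (hatv ex (A j) c) (i1 j j')) ∈ PF K I66 := by
    intro j j'
    simp only [Matrix.mulVec, dotProduct]
    exact PF_sum _ fun i _ => PF_mul (PF_const _) (PF_hatv _ _ _)
  obtain ⟨c, hc⟩ := P1 (fun j _ => PF_mul (PF_mul (PF_mul (PF_Bdet _ _) (PF_Bdet _ _)) (PF_NN _ _ (PF_hatv _ _) (PF_hatv _ _))) (PF_prod _ fun j' _ => hq j j')) (by
    intro j _
    have P2 := PF_exists (K := K) (Finset.univ : Finset (Option n)) (fun j' => match j' with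
      | none => fun c => (Bm ex (A j) c).det * (Bm ev (A j) c).det * (NN F (nn j) (hatv ex (A j) c) (hatv ev (A j) c)).det
      | some j' => fun c => if j' = j then 1 else (A j').mulVec (hatv ex (A j) c) (i1 j j')) (by
        rintro (_ | j') _
        · exact PF_mul (PF_mul (PF_Bdet _ _) (PF_Bdet _ _)) (PF_NN _ _ (PF_hatv _ _) (PF_hatv _ _))
        · dsimp only
          split_ifs
          · exact PF_const _
          · exact hq j j') (by
        rintro (_ | j') _
        · refine ⟨Cxv (nn j) (x0 j) (v0 j), ?_⟩
          obtain ⟨h1, h2, h3, h4⟩ := special (hA j) (hn j) (hx0 j) (hv0 j)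
          dsimp only
          rw [h1, h2, h3, h4, one_mul, one_mul]
          exact (ND_iff (hW j) (hFW j) (hA j) (hn j) (hx0 j) (hv0 j)).1 (hnd j)
        · by_cases hj : j' = j
          · exact ⟨0, by simp [hj]⟩
          · refine ⟨Cxv (nn j) (x1 j j') (v0 j), ?_⟩
            obtain ⟨h1, h2, h3, h4⟩ := special (hA j) (hn j) (hx1 j j' (Ne.symm hj)) (hv0 j)
            simp only [hj, if_false]
            rw [h3]
            exact hi1 j j' (Ne.symm hj))
    obtain ⟨c, hc⟩ := P2
    refine ⟨c, mul_ne_zero (hc none (Finset.mem_univ _)) (Finset.prod_ne_zero_iff.2 fun j' hj' => ?_)⟩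
    have := hc (some j') (Finset.mem_univ _)
    simp only [Finset.ne_of_mem_erase hj', if_false] at this
    exact this)
  have hc' := fun j => hc j (Finset.mem_univ _)
  simp only [mul_ne_zero_iff, Finset.prod_ne_zero_iff, Finset.mem_erase, Finset.mem_univ, and_true] at hc'
  let p : n → Sg → K := fun j s => if s.1 then solv ex (A j) c s.2 / (Bm ex (A j) c).det else solv ev (A j) c s.2 / (Bm ev (A j) c).det
  have hxs : ∀ j, (Bm ex (A j) c).det • (Cm c).mulVec (xs (p j)) = hatv ex (A j) c := by
    intro j
    have := (hc' j).1.1.1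
    funext i
    simp only [Matrix.mulVec, dotProduct, Fin.sum_univ_six, Fin.sum_univ_three, hatv, p, Cm, ex, Pi.smul_apply, smul_eq_mul, Matrix.of_apply]
    simp [xs]
    generalize (Bm ![1, 2, 3] (A j) c).det = D at *
    field_simp
    ring
  have hvs : ∀ j, (Bm ev (A j) c).det • (Cm c).mulVec (vs (p j)) = hatv ev (A j) c := by
    intro j
    have := (hc' j).1.1.2
    funext i
    simp only [Matrix.mulVec, dotProduct, Fin.sum_univ_six, Fin.sum_univ_three, hatv, p, Cm, ev, Pi.smul_apply, smul_eq_mul, Matrix.of_apply]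
    simp [vs]
    generalize (Bm ![1, 4, 5] (A j) c).det = D at *
    field_simp
    ring
  have hmx : ∀ j, hatv ex (A j) c ∈ W j := fun j => (hA j _).2 (A_hatv _ _ _)
  have hmv : ∀ j, hatv ev (A j) c ∈ W j := fun j => (hA j _).2 (A_hatv _ _ _)
  have hMx : ∀ j, (Cm c).mulVec (xs (p j)) ∈ W j := fun j => by
    have := hmx j
    rw [← hxs j] at this
    exact (Submodule.smul_mem_iff _ (hc' j).1.1.1).1 this
  have hMv : ∀ j, (Cm c).mulVec (vs (p j)) ∈ W j := fun j => by
    have := hmv j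
    rw [← hvs j] at this
    exact (Submodule.smul_mem_iff _ (hc' j).1.1.2).1 this
  refine ⟨Cm c, p, ?_, fun j => ⟨hMx j, hMv j, ?_, ?_⟩⟩
  · intro j j' hjj
    by_contra hne
    apply (hc' j).2 j' (Ne.symm hne)
    have h1 := hMx j'
    rw [← hjj] at h1
    rw [← hxs j, Matrix.mulVec_smul, (hA j' _).1 h1]
    simp
  · refine NDv_smul hF (hc' j).1.1.1 (hc' j).1.1.2 ?_
    rw [hxs, hvs]
    exact (ND_iff (hW j) (hFW j) (hA j) (hn j) (hmx j) (hmv j)).2 (hc' j).1.2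
  · intro y h1 h2
    rw [hA] at h1 h2
    have e1 : (Cm c).mulVec (xs0 y) = fun i => 0 * c (i, 0) + ∑ k, (fun k => y (true, k)) k * c (i, ex k) := by
      funext i
      simp [Matrix.mulVec, dotProduct, Fin.sum_univ_succ, xs0, Cm, ex]
      ring
    have e2 : (Cm c).mulVec (vs0 y) = fun i => 0 * c (i, 0) + ∑ k, (fun k => y (false, k)) k * c (i, ev k) := by
      funext i
      simp [Matrix.mulVec, dotProduct, Fin.sum_univ_succ, vs0, Cm, ev]
      ring
    rw [e1, mulVec_cols, zero_smul, zero_add] at h1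
    rw [e2, mulVec_cols, zero_smul, zero_add] at h2
    have k1 := Matrix.eq_zero_of_mulVec_eq_zero (hc' j).1.1.1 h1
    have k2 := Matrix.eq_zero_of_mulVec_eq_zero (hc' j).1.1.2 h2
    funext ⟨b, k⟩
    cases b
    · exact congrFun k2 k
    · exact congrFun k1 k
end

open MvPolynomial

section
/-- nondegenerate zero, left inverse form -/
def NDs {R ι κ : Type*} [CommRing R] [Fintype ι] [Fintype κ] [DecidableEq ι] (f : κ → MvPolynomial ι R) (p : ι → R) : Prop :=
  (∀ i, eval p (f i) = 0) ∧ ∃ J : Matrix ι κ R, J * (Matrix.of fun i l => eval p (pderiv l (f i))) = 1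

theorem NDs_map {R S ι κ : Type*} [CommRing R] [CommRing S] [Fintype ι] [Fintype κ] [DecidableEq ι] {f : κ → MvPolynomial ι R} {p : ι → R} (φ : R →+* S)
    (h : NDs f p) : NDs (fun i => map φ (f i)) (fun j => φ (p j)) := by
  obtain ⟨h1, J, hJ⟩ := h
  have e : ∀ g : MvPolynomial ι R, eval (fun j => φ (p j)) (map φ g) = φ (eval p g) := fun g => by
    rw [eval_map]; exact (eval₂_comp φ p g).symm
  refine ⟨fun i => by rw [e, h1, map_zero], J.map φ, ?_⟩
  have := congrArg (fun M : Matrix ι ι R => M.map φ) hJ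
  simp only [Matrix.map_mul] at this
  rw [Matrix.map_one φ (map_zero φ) (map_one φ)] at this
  rw [← this]
  congr 1
  ext i l
  simp [pderiv_map, e]

theorem NDs_inj {R ι κ : Type*} [CommRing R] [Fintype ι] [Fintype κ] [DecidableEq ι] {f : κ → MvPolynomial ι R} {p : ι → R} (h : NDs f p)
    (y : ι → R) (hy : ∀ i, ∑ j, eval p (pderiv j (f i)) * y j = 0) : y = 0 := by
  obtain ⟨h1, J, hJ⟩ := h
  have : (Matrix.of fun i l => eval p (pderiv l (f i))).mulVec y = 0 := by
    funext i; exact hy i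
  rw [← Matrix.one_mulVec y, ← hJ, ← Matrix.mulVec_mulVec, this, Matrix.mulVec_zero]

theorem NDs_of_inj {k ι κ : Type*} [Field k] [Fintype ι] [Fintype κ] [DecidableEq ι] [DecidableEq κ] {f : κ → MvPolynomial ι k} {p : ι → k} (h : ∀ i, eval p (f i) = 0)
    (hy : ∀ y : ι → k, (∀ i, ∑ j, eval p (pderiv j (f i)) * y j = 0) → y = 0) : NDs f p := by
  refine ⟨h, ?_⟩
  set M : Matrix κ ι k := (Matrix.of fun i l => eval p (pderiv l (f i))) with hM
  have hker : LinearMap.ker (Matrix.toLin' M) = ⊥ := by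
    rw [LinearMap.ker_eq_bot']
    intro y h
    exact hy y fun i => congrFun h i
  obtain ⟨g, hg⟩ := LinearMap.exists_leftInverse_of_injective _ hker
  refine ⟨LinearMap.toMatrix' g, ?_⟩
  have := congrArg LinearMap.toMatrix' hg
  rw [LinearMap.toMatrix'_comp, LinearMap.toMatrix'_toLin', LinearMap.toMatrix'_id] at this
  exact this

theorem hensel_ND {k ι κ : Type*} [Field k] [Fintype ι] [Fintype κ] [DecidableEq ι] [DecidableEq κ] (hc : Fintype.card κ = Fintype.card ι)
    (f : κ → MvPolynomial ι (PowerSeries k)) (p : ι → k) (h : NDs (fun i => map PowerSeries.constantCoeff (f i)) p) :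
    ∃ P : ι → PowerSeries k, (∀ j, PowerSeries.constantCoeff (P j) = p j) ∧ NDs f P := by
  obtain ⟨P, hP, hz⟩ := hensel_mv hc f p h.1 (NDs_inj h)
  refine ⟨P, hP, hz, ?_⟩
  obtain ⟨_, J, hJ⟩ := h
  set M : Matrix κ ι (PowerSeries k) := (Matrix.of fun i l => eval P (pderiv l (f i))) with hM
  let J' : Matrix ι κ (PowerSeries k) := J.map PowerSeries.C
  have hdet : IsUnit (J' * M).det := by
    rw [PowerSeries.isUnit_iff_constantCoeff, RingHom.map_det, RingHom.mapMatrix_apply, Matrix.map_mul]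
    have : (J'.map PowerSeries.constantCoeff) * (M.map PowerSeries.constantCoeff) = 1 := by
      rw [← hJ]
      congr 1
      ext i l
      simp only [hM, Matrix.map_apply, Matrix.of_apply, pderiv_map, eval_map]
      have : p = fun j => PowerSeries.constantCoeff (P j) := funext fun j => (hP j).symm
      rw [this]
      exact (eval₂_comp _ P _)
    rw [this]; simp
  refine ⟨(J' * M)⁻¹ * J', ?_⟩
  rw [Matrix.mul_assoc, Matrix.nonsing_inv_mul _ hdet]

theorem NDs_of_dual {k ι κ : Type*} [Field k] [Fintype ι] [Fintype κ] [DecidableEq ι] [DecidableEq κ] {f : κ → MvPolynomial ι k} {p : ι → k} (h : ∀ i, eval p (f i) = 0)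
    (hy : ∀ y : ι → k, (∀ i, aeval (fun j => (TrivSqZeroExt.inl (p j) + TrivSqZeroExt.inr (y j) : DualNumber k)) (f i) = 0) → y = 0) : NDs f p := by
  refine NDs_of_inj h fun y h2 => hy y fun i => ?_
  rw [dual_eval]
  have e1 : aeval p (f i) = 0 := h i
  have e2 : ∑ j, aeval p (pderiv j (f i)) * y j = 0 := h2 i
  rw [e1, e2]; simp

theorem TP_hom {R S A B σ : Type*} [CommRing R] [CommRing S] [CommRing A] [CommRing B] [Algebra R A] [Algebra S B] (φ : R →+* S) (ψ : A →+* B)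
    (h : ∀ r, ψ (algebraMap R A r) = algebraMap S B (φ r)) (F : MvPolynomial σ R) (x v : σ → A) :
    (TP F x v).map ψ = TP (map φ F) (fun j => ψ (x j)) (fun j => ψ (v j)) := by
  unfold TP
  have : (Polynomial.mapRingHom ψ).comp ((aeval (R := R) (fun j => Polynomial.C (x j) + Polynomial.X * Polynomial.C (v j)) : MvPolynomial σ R →ₐ[R] Polynomial A) : MvPolynomial σ R →+* Polynomial A)
    = ((aeval (R := S) (fun j => Polynomial.C (ψ (x j)) + Polynomial.X * Polynomial.C (ψ (v j))) : MvPolynomial σ S →ₐ[S] Polynomial B) : MvPolynomial σ S →+* Polynomial B).comp (map φ) := by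
    apply MvPolynomial.ringHom_ext
    · intro r
      simp [Polynomial.algebraMap_apply, h]
    · intro i; simp
  exact RingHom.congr_fun this F

theorem TP_aeval {R A B σ : Type*} [CommRing R] [CommRing A] [CommRing B] [Algebra R A] [Algebra A B] [Algebra R B] [IsScalarTower R A B]
    (F : MvPolynomial σ R) (x v : σ → A) (t : B) :
    Polynomial.aeval t (TP F x v) = aeval (fun j => algebraMap A B (x j) + t * algebraMap A B (v j)) F := by
  unfold TP
  have : ((Polynomial.aeval (R := A) t).restrictScalars R).comp (aeval (R := R) (fun j => Polynomial.C (x j) + Polynomial.X * Polynomial.C (v j))) = aeval (R := R) (fun j => algebraMap A B (x j) + t * algebraMap A B (v j)) := by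
    apply MvPolynomial.algHom_ext
    intro i
    simp
    ring
  exact DFunLike.congr_fun this F

/-- graded induction -/
theorem graded {σ R B : Type*} [CommRing R] [CommRing B] [Algebra R B] (S : ℕ → AddSubmonoid B) (hmul : ∀ m n a b, a ∈ S m → b ∈ S n → a * b ∈ S (m + n))
    (hC : ∀ r : R, algebraMap R B r ∈ S 0) (g : σ → B) (hg : ∀ j, g j ∈ S 1) {d : ℕ} {F : MvPolynomial σ R} (hF : F.IsHomogeneous d) : aeval g F ∈ S d := by
  have hone : (1 : B) ∈ S 0 := by simpa using hC 1
  have hpow : ∀ j n, g j ^ n ∈ S n := by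
    intro j n
    induction n with
    | zero => simpa using hone
    | succ n ih => rw [pow_succ]; exact hmul _ _ _ _ ih (hg j)
  rw [aeval_def, eval₂_eq]
  refine AddSubmonoid.sum_mem _ fun m hm => ?_
  have h1 : ∑ i ∈ m.support, m i = d := by
    have := hF (mem_support_iff.1 hm)
    rw [Finsupp.weight_apply] at this
    simpa [Finsupp.sum] using this
  have h2 : ∀ s : Finset σ, ∏ i ∈ s, g i ^ m i ∈ S (∑ i ∈ s, m i) := by
    classical
    intro s
    induction s using Finset.induction_on with
    | empty => simpa using hone
    | insert a s ha ih =>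
      rw [Finset.prod_insert ha, Finset.sum_insert ha]
      exact hmul _ _ _ _ (hpow _ _) ih
  have := hmul _ _ _ _ (hC (coeff m F)) (h2 m.support)
  rwa [h1, zero_add] at this

theorem TP_natDegree {R A σ : Type*} [CommRing R] [CommRing A] [Algebra R A] {d : ℕ} {F : MvPolynomial σ R} (hF : F.IsHomogeneous d) (x v : σ → A) : (TP F x v).natDegree ≤ d := by
  let S : ℕ → AddSubmonoid (Polynomial A) := fun n =>
    { carrier := {p | p.natDegree ≤ n}
      zero_mem' := by simp
      add_mem' := fun {a b} ha hb => (Polynomial.natDegree_add_le _ _).trans (max_le ha hb) }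
  refine graded S (fun m n a b ha hb => Polynomial.natDegree_mul_le.trans (add_le_add ha hb)) (fun r => ?_) _ (fun j => ?_) hF
  · change (algebraMap R (Polynomial A) r).natDegree ≤ 0
    rw [Polynomial.algebraMap_apply]; simp
  · change (Polynomial.C (x j) + Polynomial.X * Polynomial.C (v j)).natDegree ≤ 1
    compute_degree

theorem TP_shift {R A σ : Type*} [CommRing R] [CommRing A] [Algebra R A] {d : ℕ} {F : MvPolynomial σ R} (hF : F.IsHomogeneous d) (x w : σ → A) :
    TP F x (fun j => x j + w j) = ∑ i ∈ Finset.range (d + 1), Polynomial.C ((TP F x w).coeff i) * (1 + Polynomial.X) ^ (d - i) * Polynomial.X ^ i := by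
  apply Polynomial.coe_injective
  have hu : IsUnit (1 + PowerSeries.X : PowerSeries A) := by
    rw [PowerSeries.isUnit_iff_constantCoeff]; simp
  obtain ⟨V, hV⟩ := hu.exists_right_inv
  have hc : ∀ a : A, algebraMap A (PowerSeries A) a = PowerSeries.C a := fun a => rfl
  have h1 : ((TP F x (fun j => x j + w j) : Polynomial A) : PowerSeries A) = (1 + PowerSeries.X) ^ d * Polynomial.aeval (PowerSeries.X * V) (TP F x w) := by
    rw [TP_aeval, ← hom_scale hF]
    have h2 := TP_aeval F x (fun j => x j + w j) (PowerSeries.X : PowerSeries A)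
    have h3 : ∀ q : Polynomial A, Polynomial.aeval (PowerSeries.X : PowerSeries A) q = (q : PowerSeries A) := by
      intro q
      have : (Polynomial.aeval (PowerSeries.X : PowerSeries A)) = Polynomial.coeToPowerSeries.algHom (R := A) A := by
        apply Polynomial.algHom_ext; simp
      rw [this]; simp
    rw [h3] at h2
    rw [h2]
    congr 2
    funext j
    simp only [hc, map_add]
    linear_combination (- PowerSeries.X * PowerSeries.C (w j)) * hV
  rw [h1, Polynomial.aeval_eq_sum_range' (Nat.lt_succ_of_le (TP_natDegree hF x w)), Finset.mul_sum]
  have hs : ∀ s : Finset ℕ, ∀ f : ℕ → Polynomial A, ((∑ i ∈ s, f i : Polynomial A) : PowerSeries A) = ∑ i ∈ s, (f i : PowerSeries A) := fun s f => map_sum Polynomial.coeToPowerSeries.ringHom f s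
  rw [hs]
  refine Finset.sum_congr rfl fun i hi => ?_
  have hi' : i ≤ d := Nat.lt_succ_iff.1 (Finset.mem_range.1 hi)
  simp only [Polynomial.coe_mul, Polynomial.coe_pow, Polynomial.coe_C, Polynomial.coe_X, Polynomial.coe_add, Polynomial.coe_one, Algebra.smul_def, hc, mul_pow]
  have : (1 + PowerSeries.X : PowerSeries A) ^ d = (1 + PowerSeries.X) ^ (d - i) * (1 + PowerSeries.X) ^ i := by
    rw [← pow_add]; congr 1; omega
  rw [this]
  have h5 : (1 + PowerSeries.X : PowerSeries A) ^ i * V ^ i = 1 := by rw [← mul_pow, hV, one_pow]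
  linear_combination (PowerSeries.C ((TP F x w).coeff i) * (1 + PowerSeries.X) ^ (d - i) * PowerSeries.X ^ i) * h5
end

open MvPolynomial

section
noncomputable def ff {R : Type*} [CommRing R] (F : MvPolynomial (Fin 6) R) (i : ℕ) : MvPolynomial Sg R := (TP F (xs (X : Sg → MvPolynomial Sg R)) (vs X)).coeff i

theorem xs_hom {A B : Type*} [CommRing A] [CommRing B] (φ : A →+* B) (p : Sg → A) (j) : φ (xs p j) = xs (fun s => φ (p s)) j := by
  fin_cases j <;> simp [xs]
theorem vs_hom {A B : Type*} [CommRing A] [CommRing B] (φ : A →+* B) (p : Sg → A) (j) : φ (vs p j) = vs (fun s => φ (p s)) j := by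
  fin_cases j <;> simp [vs]
theorem xs0_hom {A B : Type*} [CommRing A] [CommRing B] (φ : A →+* B) (p : Sg → A) (j) : φ (xs0 p j) = xs0 (fun s => φ (p s)) j := by
  fin_cases j <;> simp [xs0]
theorem vs0_hom {A B : Type*} [CommRing A] [CommRing B] (φ : A →+* B) (p : Sg → A) (j) : φ (vs0 p j) = vs0 (fun s => φ (p s)) j := by
  fin_cases j <;> simp [vs0]
theorem xs_add {A : Type*} [CommRing A] (p y : Sg → A) (e : A) : xs (fun s => p s + e * y s) = fun j => xs p j + e * xs0 y j := by
  funext j; fin_cases j <;> simp [xs, xs0]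
theorem vs_add {A : Type*} [CommRing A] (p y : Sg → A) (e : A) : vs (fun s => p s + e * y s) = fun j => vs p j + e * vs0 y j := by
  funext j; fin_cases j <;> simp [vs, vs0]

theorem ff_aeval {R A : Type*} [CommRing R] [CommRing A] [Algebra R A] (F : MvPolynomial (Fin 6) R) (p : Sg → A) (i : ℕ) :
    aeval p (ff F i) = (TP F (xs p) (vs p)).coeff i := by
  have h := TP_map (aeval (R := R) p) F (xs X) (vs X)
  have h2 := congrArg (fun q => q.coeff i) h
  simp only [Polynomial.coeff_map] at h2
  have e1 : (fun j => aeval (R := R) p (xs X j)) = xs p := by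
    funext j
    exact (xs_hom (aeval (R := R) p : MvPolynomial Sg R →+* A) X j).trans (by simp)
  have e2 : (fun j => aeval (R := R) p (vs X j)) = vs p := by
    funext j
    exact (vs_hom (aeval (R := R) p : MvPolynomial Sg R →+* A) X j).trans (by simp)
  rw [e1, e2] at h2
  rw [← h2]; rfl

theorem ff_map {R S : Type*} [CommRing R] [CommRing S] (φ : R →+* S) (F : MvPolynomial (Fin 6) R) (i : ℕ) :
    map φ (ff F i) = ff (map φ F) i := by
  have h := TP_hom φ (map φ : MvPolynomial Sg R →+* MvPolynomial Sg S) (fun r => by simp [MvPolynomial.algebraMap_eq]) F (xs X) (vs X)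
  have h2 := congrArg (fun q => q.coeff i) h
  simp only [Polynomial.coeff_map, xs_hom, vs_hom, map_X] at h2
  exact h2

theorem ff_Fil {R : Type*} [CommRing R] {d : ℕ} {F : MvPolynomial (Fin 6) R} (hF : F.IsHomogeneous d) {i : ℕ} (hi : i ≤ d) (m : Bool → ℕ) (h1 : d - i ≤ m true) (h2 : i ≤ m false) : ff F i ∈ Fil R m := by
  let S : ℕ → AddSubmonoid (Polynomial (MvPolynomial Sg R)) := fun n =>
    { carrier := {p | ∀ i j, n = i + j → p.coeff i ∈ Fil R (fun b => if b then j else i) ∧ ∀ i, n < i → p.coeff i = 0}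
      zero_mem' := by intro i j _; simp
      add_mem' := by
        intro a b ha hb i j h
        refine ⟨?_, fun i hi => ?_⟩
        · rw [Polynomial.coeff_add]; exact Submodule.add_mem _ (ha i j h).1 (hb i j h).1
        · rw [Polynomial.coeff_add, (ha _ j h).2 i hi, (hb _ j h).2 i hi, add_zero] }
  have key : TP F (xs (X : Sg → MvPolynomial Sg R)) (vs X) ∈ S d := by
    refine graded S (fun m n a b ha hb => ?_) (fun r => ?_) _ (fun j => ?_) hF
    · have hb0 : ∀ i, n < i → b.coeff i = 0 := (hb 0 n (by omega)).2
      have ha0 : ∀ i, m < i → a.coeff i = 0 := (ha 0 m (by omega)).2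
      intro i j hij
      refine ⟨?_, fun i hi => ?_⟩
      · rw [Polynomial.coeff_mul]
        refine Submodule.sum_mem _ fun st hst => ?_
        rw [Finset.HasAntidiagonal.mem_antidiagonal] at hst
        by_cases h1 : m < st.1
        · rw [ha0 _ h1, zero_mul]; exact Submodule.zero_mem _
        by_cases h2 : n < st.2
        · rw [hb0 _ h2, mul_zero]; exact Submodule.zero_mem _
        refine Fil_mono ?_ (Fil_mul (ha st.1 (m - st.1) (by omega)).1 (hb st.2 (n - st.2) (by omega)).1)
        intro s; cases s <;> simp <;> omega
      · rw [Polynomial.coeff_mul]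
        refine Finset.sum_eq_zero fun st hst => ?_
        rw [Finset.HasAntidiagonal.mem_antidiagonal] at hst
        by_cases h1 : m < st.1
        · rw [ha0 _ h1, zero_mul]
        · rw [hb0 st.2 (by omega), mul_zero]
    · intro i j hij
      rw [Polynomial.algebraMap_apply]
      have h0 : i = 0 := by omega
      subst h0
      refine ⟨?_, fun i hi => ?_⟩
      · simp only [Polynomial.algebraMap_eq, Polynomial.coeff_C_zero]
        exact Fil_C _ _
      · exact Polynomial.coeff_C_ne_zero (by omega)
    · intro i' j' hij
      have hx : ∀ j, xs (X : Sg → MvPolynomial Sg R) j ∈ Fil R (fun b => if b then 1 else 0) := by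
        have e : (fun b => if b then 1 else 0 : Bool → ℕ) = Pi.single true 1 := by funext b; cases b <;> simp
        rw [e]
        intro j
        fin_cases j
        · exact Fil_one _
        · exact Fil_X _ _
        · exact Fil_X _ _
        · exact Fil_X _ _
        · exact Submodule.zero_mem _
        · exact Submodule.zero_mem _
      have hv : ∀ j, vs (X : Sg → MvPolynomial Sg R) j ∈ Fil R (fun b => if b then 0 else 1) := by
        have e : (fun b => if b then 0 else 1 : Bool → ℕ) = Pi.single false 1 := by funext b; cases b <;> simp
        rw [e]
        intro j
        fin_cases j
        · exact Fil_one _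
        · exact Fil_X _ _
        · exact Submodule.zero_mem _
        · exact Submodule.zero_mem _
        · exact Fil_X _ _
        · exact Fil_X _ _
      refine ⟨?_, fun i hi => ?_⟩
      · have : (i' = 0 ∧ j' = 1) ∨ (i' = 1 ∧ j' = 0) := by omega
        rcases this with ⟨rfl, rfl⟩ | ⟨rfl, rfl⟩
        · simpa using hx j
        · simpa [Polynomial.coeff_C] using hv j
      · obtain ⟨i, rfl⟩ : ∃ k, i = k + 2 := ⟨i - 2, by omega⟩
        simp [Polynomial.coeff_C]
  refine Fil_mono ?_ (key i (d - i) (by omega)).1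
  intro s; cases s <;> simp <;> omega

variable {K : Type*} [Field K]

theorem TP_comp {A : Type*} [CommRing A] [Algebra K A] (M : Matrix (Fin 6) (Fin 6) K) (F : MvPolynomial (Fin 6) K) (x v : Fin 6 → A) :
    TP (aeval (fun i => ∑ k, C (M i k) * X k) F : MvPolynomial (Fin 6) K) x v = TP F (fun i => ∑ k, algebraMap K A (M i k) * x k) (fun i => ∑ k, algebraMap K A (M i k) * v k) := by
  unfold TP
  change aeval _ (bind₁ _ _) = _
  rw [aeval_bind₁]
  congr 2
  funext i
  simp only [map_sum, map_mul, aeval_X, aeval_C, Finset.mul_sum, ← Finset.sum_add_distrib]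
  refine Finset.sum_congr rfl fun k _ => ?_
  rw [Polynomial.algebraMap_apply]; ring

theorem DTP_map {R A B σ : Type*} [Fintype σ] [CommRing R] [CommRing A] [Algebra R A] [CommRing B] [Algebra R B] (φ : A →ₐ[R] B) (f : MvPolynomial σ R) (x v a b : σ → A) :
    (DTP f x v a b).map (φ : A →+* B) = DTP f (fun j => φ (x j)) (fun j => φ (v j)) (fun j => φ (a j)) (fun j => φ (b j)) := by
  unfold DTP
  simp only [Polynomial.map_sum, Polynomial.map_mul, TP_map, Polynomial.map_add, Polynomial.map_C, Polynomial.map_X]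
  rfl

theorem TP_dual (F : MvPolynomial (Fin 6) K) (x v a b : Fin 6 → K) (i : ℕ) :
    (TP F (fun j => (TrivSqZeroExt.inl (x j) + DualNumber.eps * TrivSqZeroExt.inl (a j) : DualNumber K)) (fun j => (TrivSqZeroExt.inl (v j) + DualNumber.eps * TrivSqZeroExt.inl (b j) : DualNumber K))).coeff i = TrivSqZeroExt.inl ((TP F x v).coeff i) + DualNumber.eps * TrivSqZeroExt.inl ((DTP F x v a b).coeff i) := by
  rw [DTP_dual F (fun j => (TrivSqZeroExt.inl (x j) : DualNumber K)) (fun j => (TrivSqZeroExt.inl (v j) : DualNumber K)) (fun j => (TrivSqZeroExt.inl (a j) : DualNumber K)) (fun j => (TrivSqZeroExt.inl (b j) : DualNumber K)) DualNumber.eps (by rw [pow_two, DualNumber.eps_mul_eps])]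
  have h1 := TP_map (Algebra.ofId K (DualNumber K)) F x v
  have h2 := DTP_map (Algebra.ofId K (DualNumber K)) F x v a b
  have h3 : ∀ r : K, (Algebra.ofId K (DualNumber K)) r = TrivSqZeroExt.inl r := fun r => rfl
  simp only [h3] at h1 h2
  rw [← h1, ← h2, Polynomial.coeff_add, Polynomial.coeff_C_mul, Polynomial.coeff_map, Polynomial.coeff_map]
  rfl

theorem inl_inr_eps (p y : K) : (TrivSqZeroExt.inl p + TrivSqZeroExt.inr y : DualNumber K) = TrivSqZeroExt.inl p + DualNumber.eps * TrivSqZeroExt.inl y := by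
  ext <;> simp

theorem inl_eps_zero {p y : K} (h : (TrivSqZeroExt.inl p + DualNumber.eps * TrivSqZeroExt.inl y : DualNumber K) = 0) : y = 0 := by
  have := congrArg TrivSqZeroExt.snd h
  simpa using this

theorem ff_dual (F : MvPolynomial (Fin 6) K) (p y : Sg → K) (i : ℕ) :
    aeval (fun j => (TrivSqZeroExt.inl (p j) + TrivSqZeroExt.inr (y j) : DualNumber K)) (ff F i) = TrivSqZeroExt.inl ((TP F (xs p) (vs p)).coeff i) + DualNumber.eps * TrivSqZeroExt.inl ((DTP F (xs p) (vs p) (xs0 y) (vs0 y)).coeff i) := by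
  simp only [inl_inr_eps]
  rw [ff_aeval, xs_add, vs_add, ← TP_dual]
  congr 2
  · funext j
    exact (congrArg₂ (fun a b => a + DualNumber.eps * b) (xs_hom (TrivSqZeroExt.inlHom K K) p j) (xs0_hom (TrivSqZeroExt.inlHom K K) y j)).symm
  · funext j
    exact (congrArg₂ (fun a b => a + DualNumber.eps * b) (vs_hom (TrivSqZeroExt.inlHom K K) p j) (vs0_hom (TrivSqZeroExt.inlHom K K) y j)).symm

theorem DTP_comp (M : Matrix (Fin 6) (Fin 6) K) (F : MvPolynomial (Fin 6) K) (x v a b : Fin 6 → K) (i : ℕ) :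
    (DTP (aeval (fun i => ∑ k, C (M i k) * X k) F : MvPolynomial (Fin 6) K) x v a b).coeff i = (DTP F (M.mulVec x) (M.mulVec v) (M.mulVec a) (M.mulVec b)).coeff i := by
  have h1 := TP_dual (aeval (fun i => ∑ k, C (M i k) * X k) F) x v a b i
  have h2 := TP_dual F (M.mulVec x) (M.mulVec v) (M.mulVec a) (M.mulVec b) i
  rw [TP_comp] at h1
  have h3 : ∀ x a : Fin 6 → K, (fun i => ∑ k, algebraMap K (DualNumber K) (M i k) * (TrivSqZeroExt.inl (x k) + DualNumber.eps * TrivSqZeroExt.inl (a k) : DualNumber K)) = fun i => (TrivSqZeroExt.inl (M.mulVec x i) + DualNumber.eps * TrivSqZeroExt.inl (M.mulVec a i) : DualNumber K) := by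
    intro x a
    have q2 : ∀ p : K, (algebraMap K (DualNumber K) p) = TrivSqZeroExt.inl p := fun p => rfl
    funext i
    simp only [← q2, Matrix.mulVec, dotProduct, map_sum, map_mul, Finset.mul_sum, ← Finset.sum_add_distrib]
    exact Finset.sum_congr rfl fun k _ => by ring
  rw [h3, h3, h2] at h1
  have := congrArg TrivSqZeroExt.snd h1
  simpa using this.symm

theorem C5_main [IsAlgClosed K] [CharZero K] {d : ℕ} (hd : 5 ≤ d) (F : MvPolynomial (Fin 6) K)
    (hF : F.IsHomogeneous d)
    (hsmooth : ∀ x : Fin 6 → K, (∀ i, eval x (pderiv i F) = 0) → x = 0)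
    {n : Type} [Fintype n] (W : n → Submodule K (Fin 6 → K)) (hinj : Function.Injective W) (hW : ∀ j, Module.finrank K (W j) = 3) (hFW : ∀ j, ∀ w ∈ W j, eval w F = 0) :
    ∃ (F' : MvPolynomial (Fin 6) K) (p : n → Sg → K), F'.IsHomogeneous d ∧ Function.Injective p ∧ ∀ j, NDs (fun i : Fin 6 => ff F' i) (p j) := by
  have : Infinite K := inferInstance
  obtain ⟨M, p, hp, h⟩ := C5_C hd F hF hsmooth W hinj hW hFW
  refine ⟨aeval (fun i => ∑ k, C (M i k) * X k) F, p, ?_, hp, fun j => ?_⟩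
  · have := hF.aeval (n := 1) (fun i => ∑ k, (C (M i k) * X k : MvPolynomial (Fin 6) K)) (fun j => by
      refine IsHomogeneous.sum _ _ _ fun k _ => ?_
      have := (isHomogeneous_C (Fin 6) (M j k)).mul (isHomogeneous_X K k)
      simpa using this)
    simpa using this
  · obtain ⟨hx, hv, hnd, hy⟩ := h j
    have hz : ∀ i : ℕ, (TP (aeval (fun i => ∑ k, C (M i k) * X k) F : MvPolynomial (Fin 6) K) (xs (p j)) (vs (p j))).coeff i = 0 := by
      intro i
      rw [TP_comp]
      have := (DTP_W (hFW j) (Module.finBasisOfFinrankEq K _ (hW j)) hx hv hx hv).1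
      change (TP F (M.mulVec (xs (p j))) (M.mulVec (vs (p j)))).coeff i = 0
      rw [this]; simp
    refine NDs_of_dual (fun i => ?_) fun y h2 => ?_
    · have := ff_aeval (aeval (fun i => ∑ k, C (M i k) * X k) F : MvPolynomial (Fin 6) K) (p j) i
      rw [hz] at this
      exact this
    · have h3 := hnd (M.mulVec (xs0 y)) (M.mulVec (vs0 y)) (fun i hi => by
        have := h2 ⟨i, hi⟩
        rw [ff_dual] at this
        have := inl_eps_zero this
        rwa [DTP_comp] at this)
      exact hy y h3.1 h3.2
end

open MvPolynomial

section
def TT (d : ℕ) : Pat := fun i s => (Finset.range (if s then d - i else i)).image (fun j => 6 * j + i + 2)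

theorem TT_good (d : ℕ) : GoodPat (TT d) := by
  constructor
  · intro i j s hij
    rw [Finset.disjoint_left]
    intro a ha hb
    simp only [TT, Finset.mem_image] at ha hb
    obtain ⟨x, _, rfl⟩ := ha
    obtain ⟨y, _, h⟩ := hb
    apply hij
    apply Fin.ext
    omega
  · intro i s h
    simp [TT] at h

theorem TT_cd (d : ℕ) (i : Fin 6) : cd (TT d i) = fun s => if s then d - i else (i : ℕ) := by
  funext s
  simp only [cd, TT]
  rw [Finset.card_image_of_injective, Finset.card_range]
  intro a b h
  simp only at h
  omega

theorem MM_val (d : ℕ) (hd : 5 ≤ d) : (MM (fun i => cd (TT d i)) : ℤ) = 225 * (d : ℤ)^3 - 1096 * (d : ℤ)^2 + 1200 * d := by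
  obtain ⟨e, rfl⟩ := Nat.exists_eq_add_of_le hd
  have h1 : MM (fun i => cd (TT (5 + e) i)) = (5 + e) * (60*(e+4)*(e+3)+40*(e+4)*(e+2)+30*(e+4)*(e+1)+24*(e+4)*e+20*(e+3)*(e+2)+15*(e+3)*(e+1)+12*(e+3)*e+10*(e+2)*(e+1)+8*(e+2)*e+6*(e+1)*e) := by
    unfold MM
    simp only [TT_cd]
    have hgen : ∀ a0 a1 a2 a3 a4 a5 : ℕ, ((Polynomial.C a0 * Polynomial.X + Polynomial.C 0) * (Polynomial.C a1 * Polynomial.X + Polynomial.C 1) * (Polynomial.C a2 * Polynomial.X + Polynomial.C 2) * (Polynomial.C a3 * Polynomial.X + Polynomial.C 3) * (Polynomial.C a4 * Polynomial.X + Polynomial.C 4) * (Polynomial.C a5 * Polynomial.X + Polynomial.C 5) : Polynomial ℕ).coeff 3 = a0 * (60*a1*a2+40*a1*a3+30*a1*a4+24*a1*a5+20*a2*a3+15*a2*a4+12*a2*a5+10*a3*a4+8*a3*a5+6*a4*a5) := by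
      intro a0 a1 a2 a3 a4 a5
      have hh : ((Polynomial.C a0 * Polynomial.X + Polynomial.C 0) * (Polynomial.C a1 * Polynomial.X + Polynomial.C 1) * (Polynomial.C a2 * Polynomial.X + Polynomial.C 2) * (Polynomial.C a3 * Polynomial.X + Polynomial.C 3) * (Polynomial.C a4 * Polynomial.X + Polynomial.C 4) * (Polynomial.C a5 * Polynomial.X + Polynomial.C 5) : Polynomial ℕ)
        = Polynomial.C (a0 * (60*a1*a2+40*a1*a3+30*a1*a4+24*a1*a5+20*a2*a3+15*a2*a4+12*a2*a5+10*a3*a4+8*a3*a5+6*a4*a5)) * Polynomial.X ^ 3 + Polynomial.C (120 * a0) * Polynomial.X ^ 1 + Polynomial.C (a0 * (120 * a1 + 60 * a2 + 40 * a3 + 30 * a4 + 24 * a5)) * Polynomial.X ^ 2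
          + Polynomial.C (a0 * (a3*a4*a5*2 + a2*a4*a5*3 + a2*a3*a5*4 + a2*a3*a4*5 + a1*a4*a5*6 + a1*a3*a5*8 + a1*a3*a4*10+a1*a2*a5*12+a1*a2*a4*15+a1*a2*a3*20)) * Polynomial.X ^ 4 + Polynomial.C (a0 * (a2*a3*a4*a5+2*a1*a3*a4*a5+3*a1*a2*a4*a5+4*a1*a2*a3*a5+5*a1*a2*a3*a4)) * Polynomial.X ^ 5 + Polynomial.C (a0*a1*a2*a3*a4*a5) * Polynomial.X ^ 6 := by
        simp only [Polynomial.C_add, Polynomial.C_mul]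
        have n : ∀ m : ℕ, (Polynomial.C m : Polynomial ℕ) = (m : Polynomial ℕ) := fun m => by simp
        rw [n 0, n 1, n 2, n 3, n 4, n 5, n 6, n 8, n 10, n 12, n 15, n 20, n 24, n 30, n 40, n 60, n 120]
        push_cast
        ring
      rw [hh]
      simp only [Polynomial.coeff_add, Polynomial.coeff_C_mul_X_pow]
      norm_num
    have := hgen (5 + e) (4 + e) (3 + e) (2 + e) (1 + e) e
    rw [Fin.prod_univ_six]
    have s1 : 5 + e - 1 = 4 + e := by omega
    have s2 : 5 + e - 2 = 3 + e := by omega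
    have s3 : 5 + e - 3 = 2 + e := by omega
    have s4 : 5 + e - 4 = 1 + e := by omega
    have s5 : 5 + e - 5 = e := by omega
    simp only [if_true, Bool.false_eq_true, if_false]
    have q : ((0 : Fin 6) : ℕ) = 0 ∧ ((1 : Fin 6) : ℕ) = 1 ∧ ((2 : Fin 6) : ℕ) = 2 ∧ ((3 : Fin 6) : ℕ) = 3 ∧ ((4 : Fin 6) : ℕ) = 4 ∧ ((5 : Fin 6) : ℕ) = 5 := ⟨rfl, rfl, rfl, rfl, rfl, rfl⟩
    obtain ⟨q0, q1, q2, q3, q4, q5⟩ := q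
    rw [q0, q1, q2, q3, q4, q5, s1, s2, s3, s4, s5, Nat.sub_zero, this]
    ring
  rw [h1]
  push_cast
  ring

theorem tr_X (k : Type) [Field k] : Transcendental k (algebraMap (PowerSeries k) (FractionRing (PowerSeries k)) PowerSeries.X) := by
  rw [transcendental_algebraMap_iff (IsFractionRing.injective _ _)]
  rw [transcendental_iff]
  intro q hq
  have : (Polynomial.aeval (PowerSeries.X : PowerSeries k)) = Polynomial.coeToPowerSeries.algHom (R := k) k := by
    apply Polynomial.algHom_ext; simp
  rw [this] at hq
  simpa using hq

theorem aeval_eval_C {k : Type} [Field k] (P : Sg → PowerSeries k) (g : MvPolynomial Sg k) : aeval (fun s => algebraMap (PowerSeries k) (FractionRing (PowerSeries k)) (P s)) g = algebraMap (PowerSeries k) (FractionRing (PowerSeries k)) (eval P (map PowerSeries.C g)) := by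
  rw [eval_map]
  exact aeval_algebraMap_apply (R := k) (FractionRing (PowerSeries k)) P g

/-- bezout for power series points -/
theorem bezout_ps {k : Type} [Field k] [CharZero k] {d : ℕ} (hd : 5 ≤ d) {F : MvPolynomial (Fin 6) k} (hF : F.IsHomogeneous d) (a : Fin 6 → ℕ) (ha : ∀ i, 0 < a i) {n : Type} [Fintype n]
    (P : n → Sg → PowerSeries k) (hP : Function.Injective P) (hz : ∀ j (i : Fin 6), eval (P j) (map PowerSeries.C (ff F i)) + PowerSeries.X ^ a i * eval (P j) (map PowerSeries.C (gg k (TT d i))) = 0) :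
    (Fintype.card n : ℤ) ≤ 225 * (d : ℤ)^3 - 1096 * (d : ℤ)^2 + 1200 * d := by
  rw [← MM_val d hd]
  have := bezout (L := FractionRing (PowerSeries k)) _ (tr_X k) (TT d) (TT_good d) (fun i => ff F i) (fun i => by
      refine ff_Fil hF (by have := i.2; omega) _ ?_ ?_
      · rw [TT_cd]; simp
      · rw [TT_cd]; simp) a ha (fun j s => algebraMap (PowerSeries k) (FractionRing (PowerSeries k)) (P j s)) (by
      intro j j' h
      apply hP
      funext s
      exact IsFractionRing.injective (PowerSeries k) (FractionRing (PowerSeries k)) (congrFun h s)) (by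
      intro j i
      rw [aeval_eval_C, aeval_eval_C, ← map_pow, ← map_mul, ← map_add, hz, map_zero])
  exact_mod_cast this

theorem map_cc_C {k : Type*} [Field k] {σ : Type*} (g : MvPolynomial σ k) : map PowerSeries.constantCoeff (map PowerSeries.C g) = g := by
  rw [map_map]
  have : (PowerSeries.constantCoeff (R := k)).comp PowerSeries.C = RingHom.id k := by ext; simp
  rw [this, map_id]

/-- lifting of nondegenerate zeros -/
theorem lift_zero {k : Type} [Field k] (f g : Fin 6 → MvPolynomial Sg k) (a : Fin 6 → ℕ) (ha : ∀ i, 0 < a i) (p : Sg → k) (hp : NDs f p) :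
    ∃ P : Sg → PowerSeries k, (∀ s, PowerSeries.constantCoeff (P s) = p s) ∧ ∀ i, eval P (map PowerSeries.C (f i)) + PowerSeries.X ^ a i * eval P (map PowerSeries.C (g i)) = 0 := by
  obtain ⟨P, h1, h2⟩ := hensel_ND (κ := Fin 6) (ι := Sg) (by simp [Sg]) (fun i => map PowerSeries.C (f i) + C (PowerSeries.X ^ a i) * map PowerSeries.C (g i)) p (by
    convert hp using 2 with i
    rw [map_add, map_mul, map_cc_C, map_C, map_pow, PowerSeries.constantCoeff_X, zero_pow (ha i).ne', C_0, zero_mul, add_zero])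
  refine ⟨P, h1, fun i => ?_⟩
  simpa using h2.1 i

theorem bound_ge {K : Type} [Field K] [IsAlgClosed K] [CharZero K] {d : ℕ} (hd : 5 ≤ d) (F : MvPolynomial (Fin 6) K)
    (hF : F.IsHomogeneous d) {n : Type} [Fintype n] (p : n → Sg → K) (hp : Function.Injective p) (h : ∀ j, NDs (fun i : Fin 6 => ff F i) (p j)) :
    (Fintype.card n : ℤ) ≤ 225 * (d : ℤ)^3 - 1096 * (d : ℤ)^2 + 1200 * d := by
  choose P hP hz using fun j => lift_zero (fun i : Fin 6 => ff F i) (fun i => gg K (TT d i)) (fun _ => 1) (by simp) (p j) (h j)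
  refine bezout_ps hd hF (fun _ => 1) (by simp) P (fun j j' hj => hp (funext fun s => ?_)) hz
  rw [← hP, ← hP, hj]
end

open MvPolynomial

section
def pz {A : Type*} [CommRing A] (ζ : A) : Sg → A := fun s => if s.2 = 0 then ζ else 0
def zz {A : Type*} [CommRing A] (ζ : A) : Fin 6 → A := ![1, ζ, 0, 0, 0, 0]
def gv {A : Type*} [CommRing A] (p : Sg → A) (k : Fin 6) : A := ∏ s, ∏ c ∈ TT 5 k s, (1 + (c : A) * p (s, 0) + (c : A) ^ 2 * p (s, 1) + (c : A) ^ 3 * p (s, 2))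
def uu {A : Type*} [CommRing A] (y : Sg → A) : Fin 6 → A := fun j => vs0 y j - xs0 y j

theorem xs_pz {A : Type*} [CommRing A] (ζ : A) : xs (pz ζ) = zz ζ := by
  funext j; fin_cases j <;> simp [xs, pz, zz]
theorem vs_pz {A : Type*} [CommRing A] (ζ : A) : vs (pz ζ) = zz ζ := by
  funext j; fin_cases j <;> simp [vs, pz, zz]

theorem zz_hom {A B : Type*} [CommRing A] [CommRing B] (φ : A →+* B) (ζ : A) (j) : φ (zz ζ j) = zz (φ ζ) j := by
  fin_cases j <;> simp [zz]
theorem pz_hom {A B : Type*} [CommRing A] [CommRing B] (φ : A →+* B) (ζ : A) (j) : φ (pz ζ j) = pz (φ ζ) j := by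
  simp only [pz]; split_ifs <;> simp
theorem uu_hom {A B : Type*} [CommRing A] [CommRing B] (φ : A →+* B) (y : Sg → A) (j) : φ (uu y j) = uu (fun s => φ (y s)) j := by
  simp [uu, xs0_hom, vs0_hom]
theorem gv_hom {A B : Type*} [CommRing A] [CommRing B] (φ : A →+* B) (p : Sg → A) (k) : φ (gv p k) = gv (fun s => φ (p s)) k := by
  simp [gv]

theorem gg_gv {R A : Type*} [CommRing R] [CommRing A] [Algebra R A] (p : Sg → A) (k) : aeval p (gg R (TT 5 k)) = gv p k := by
  simp only [gg, gv, map_prod]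
  refine Finset.prod_congr rfl fun s _ => Finset.prod_congr rfl fun c _ => ?_
  simp [lf, Fin.sum_univ_succ, yv]
  ring

noncomputable def psiv {R A : Type*} [CommRing R] [CommRing A] [Algebra R A] (F : MvPolynomial (Fin 6) R) (ζ δ : A) (y : Sg → A) : Fin 6 → A :=
  let p : Sg → A := fun s => pz ζ s + δ * y s
  let x : Fin 6 → A := fun j => zz ζ j + δ * xs0 y j
  let c : ℕ → A := fun i => (TP F x (uu y)).coeff i
  let b : ℕ → A := fun i => (TP F (zz ζ) (xs0 y)).coeff i
  ![b 1 + δ * b 2 + δ ^ 2 * b 3 + δ ^ 3 * b 4 + δ ^ 4 * b 5 + δ ^ 5 * gv p 0,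
    c 1 + δ ^ 5 * (-5 * gv p 0 + gv p 1),
    c 2 + δ ^ 4 * (10 * gv p 0 - 4 * gv p 1 + gv p 2),
    c 3 + δ ^ 3 * (-10 * gv p 0 + 6 * gv p 1 - 3 * gv p 2 + gv p 3),
    c 4 + δ ^ 2 * (5 * gv p 0 - 4 * gv p 1 + 3 * gv p 2 - 2 * gv p 3 + gv p 4),
    c 5 + δ * (- gv p 0 + gv p 1 - gv p 2 + gv p 3 - gv p 4) + gv p 5]

theorem psiv_hom {R S A B : Type*} [CommRing R] [CommRing S] [CommRing A] [CommRing B] [Algebra R A] [Algebra S B] (φ : R →+* S) (ψ : A →+* B)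
    (h : ∀ r, ψ (algebraMap R A r) = algebraMap S B (φ r)) (F : MvPolynomial (Fin 6) R) (ζ δ : A) (y : Sg → A) (i : Fin 6) :
    ψ (psiv F ζ δ y i) = psiv (map φ F) (ψ ζ) (ψ δ) (fun s => ψ (y s)) i := by
  have e := fun x v i => congrArg (fun q => Polynomial.coeff q i) (TP_hom φ ψ h F x v)
  simp only [Polynomial.coeff_map] at e
  have q2 : ψ 2 = 2 := by exact_mod_cast map_natCast ψ 2
  have q3 : ψ 3 = 3 := by exact_mod_cast map_natCast ψ 3
  have q4 : ψ 4 = 4 := by exact_mod_cast map_natCast ψ 4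
  have q5 : ψ 5 = 5 := by exact_mod_cast map_natCast ψ 5
  have q6 : ψ 6 = 6 := by exact_mod_cast map_natCast ψ 6
  have q10 : ψ 10 = 10 := by exact_mod_cast map_natCast ψ 10
  fin_cases i <;> simp [psiv, e, zz_hom, xs0_hom, uu_hom, gv_hom, pz_hom, q2, q3, q4, q5, q6, q10]

noncomputable def PS {R : Type*} [CommRing R] (F : MvPolynomial (Fin 6) R) (ζ δ : R) (i : Fin 6) : MvPolynomial Sg R := psiv F (C ζ) (C δ) X i

theorem PS_map {R S : Type*} [CommRing R] [CommRing S] (φ : R →+* S) (F : MvPolynomial (Fin 6) R) (ζ δ : R) (i) : map φ (PS F ζ δ i) = PS (map φ F) (φ ζ) (φ δ) i := by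
  have := psiv_hom φ (map φ : MvPolynomial Sg R →+* MvPolynomial Sg S) (fun r => by simp [MvPolynomial.algebraMap_eq]) F (C ζ) (C δ) X i
  simpa [PS] using this

theorem PS_aeval {R A : Type*} [CommRing R] [CommRing A] [Algebra R A] (F : MvPolynomial (Fin 6) R) (ζ δ : R) (p : Sg → A) (i) :
    aeval p (PS F ζ δ i) = psiv F (algebraMap R A ζ) (algebraMap R A δ) p i := by
  have := psiv_hom (RingHom.id R) (aeval (R := R) p : MvPolynomial Sg R →+* A) (fun r => by simp) F (C ζ) (C δ) X i
  rw [map_id] at this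
  refine Eq.trans ?_ (this.trans ?_)
  · rfl
  · simp

theorem TP_coeff_zero {R A σ : Type*} [CommRing R] [CommRing A] [Algebra R A] (F : MvPolynomial σ R) (x v : σ → A) : (TP F x v).coeff 0 = aeval x F := by
  have := TP_aeval F x v (0 : A)
  simpa [Polynomial.aeval_def, Polynomial.eval₂_at_zero] using this

theorem TP_scale {R A σ : Type*} [CommRing R] [CommRing A] [Algebra R A] (F : MvPolynomial σ R) (x v : σ → A) (δ : A) (i : ℕ) :
    (TP F x (fun j => δ * v j)).coeff i = (TP F x v).coeff i * δ ^ i := by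
  have := TP_aeval F x v (Polynomial.C δ * Polynomial.X)
  rw [← Polynomial.comp_C_mul_X_coeff]
  have h2 : (TP F x v).comp (Polynomial.C δ * Polynomial.X) = Polynomial.aeval (Polynomial.C δ * Polynomial.X) (TP F x v) := by
    rw [Polynomial.comp, Polynomial.aeval_def]; rfl
  rw [h2, this]
  have h3 : (fun j => Polynomial.C (x j) + Polynomial.X * Polynomial.C (δ * v j)) = (fun j => algebraMap A (Polynomial A) (x j) + Polynomial.C δ * Polynomial.X * algebraMap A (Polynomial A) (v j)) := by
    funext j
    simp only [Polynomial.algebraMap_eq, Polynomial.C_mul]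
    ring
  unfold TP
  rw [h3]

theorem psi_zero {R A : Type*} [CommRing R] [CommRing A] [Algebra R A] {F : MvPolynomial (Fin 6) R} (hF : F.IsHomogeneous 5) (ζ δ : A) (y : Sg → A)
    (hz : aeval (zz ζ) F = 0) (h : ∀ i, psiv F ζ δ y i = 0) (i : Fin 6) :
    (TP F (xs (fun s => pz ζ s + δ * y s)) (vs (fun s => pz ζ s + δ * y s))).coeff i + δ ^ (if i = 5 then 5 else 6) * gv (fun s => pz ζ s + δ * y s) i = 0 := by
  set p : Sg → A := fun s => pz ζ s + δ * y s with hp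
  set x : Fin 6 → A := fun j => zz ζ j + δ * xs0 y j with hx
  set c : ℕ → A := fun i => (TP F x (uu y)).coeff i with hc
  set b : ℕ → A := fun i => (TP F (zz ζ) (xs0 y)).coeff i with hb
  have e1 : xs p = x := by rw [hp, xs_add, xs_pz]
  have e2 : vs p = fun j => x j + δ * uu y j := by
    rw [hp, vs_add, vs_pz]; funext j; simp only [hx, uu]; ring
  rw [e1, e2, TP_shift hF]
  simp only [TP_scale]
  have h0 : (TP F x (uu y)).coeff 0 = δ * (b 1 + δ * b 2 + δ ^ 2 * b 3 + δ ^ 3 * b 4 + δ ^ 4 * b 5) := by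
    rw [TP_coeff_zero]
    have := TP_aeval F (zz ζ) (xs0 y) δ
    rw [Polynomial.aeval_eq_sum_range' (Nat.lt_succ_of_le (TP_natDegree hF _ _))] at this
    have b0 := TP_coeff_zero F (zz ζ) (xs0 y)
    simp only [Finset.sum_range_succ, Finset.range_zero, Finset.sum_empty, smul_eq_mul] at this
    rw [b0, hz] at this
    refine Eq.trans this.symm ?_
    simp only [hb]; ring
  have g0 : b 1 + δ * b 2 + δ ^ 2 * b 3 + δ ^ 3 * b 4 + δ ^ 4 * b 5 + δ ^ 5 * gv p 0 = 0 := h 0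
  have g1 : c 1 + δ ^ 5 * (-5 * gv p 0 + gv p 1) = 0 := h 1
  have g2 : c 2 + δ ^ 4 * (10 * gv p 0 - 4 * gv p 1 + gv p 2) = 0 := h 2
  have g3 : c 3 + δ ^ 3 * (-10 * gv p 0 + 6 * gv p 1 - 3 * gv p 2 + gv p 3) = 0 := h 3
  have g4 : c 4 + δ ^ 2 * (5 * gv p 0 - 4 * gv p 1 + 3 * gv p 2 - 2 * gv p 3 + gv p 4) = 0 := h 4
  have g5 : c 5 + δ * (- gv p 0 + gv p 1 - gv p 2 + gv p 3 - gv p 4) + gv p 5 = 0 := h 5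
  have k0 : c 0 = -δ ^ 6 * gv p 0 := by
    rw [show c 0 = _ from h0]; linear_combination δ * g0
  have hexp : ∑ i ∈ Finset.range (5 + 1), Polynomial.C ((TP F x (uu y)).coeff i * δ ^ i) * (1 + Polynomial.X) ^ (5 - i) * Polynomial.X ^ i
    = Polynomial.C (c 0) * Polynomial.X ^ 0 + Polynomial.C (5 * c 0 + δ * c 1) * Polynomial.X ^ 1 + Polynomial.C (10 * c 0 + 4 * δ * c 1 + δ ^ 2 * c 2) * Polynomial.X ^ 2
     + Polynomial.C (10 * c 0 + 6 * δ * c 1 + 3 * δ ^ 2 * c 2 + δ ^ 3 * c 3) * Polynomial.X ^ 3 + Polynomial.C (5 * c 0 + 4 * δ * c 1 + 3 * δ ^ 2 * c 2 + 2 * δ ^ 3 * c 3 + δ ^ 4 * c 4) * Polynomial.X ^ 4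
     + Polynomial.C (c 0 + δ * c 1 + δ ^ 2 * c 2 + δ ^ 3 * c 3 + δ ^ 4 * c 4 + δ ^ 5 * c 5) * Polynomial.X ^ 5 := by
    simp only [Finset.sum_range_succ, Finset.range_zero, Finset.sum_empty, Polynomial.C_add, Polynomial.C_mul, Polynomial.C_pow, hc]
    have n : ∀ m : ℕ, (Polynomial.C (m : A) : Polynomial A) = (m : Polynomial A) := fun m => by simp
    have n2 : (Polynomial.C (2 : A) : Polynomial A) = 2 := by exact_mod_cast n 2
    have n3 : (Polynomial.C (3 : A) : Polynomial A) = 3 := by exact_mod_cast n 3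
    have n4 : (Polynomial.C (4 : A) : Polynomial A) = 4 := by exact_mod_cast n 4
    have n5 : (Polynomial.C (5 : A) : Polynomial A) = 5 := by exact_mod_cast n 5
    have n6 : (Polynomial.C (6 : A) : Polynomial A) = 6 := by exact_mod_cast n 6
    have n10 : (Polynomial.C (10 : A) : Polynomial A) = 10 := by exact_mod_cast n 10
    rw [n2, n3, n4, n5, n6, n10]
    norm_num
    ring
  rw [hexp]
  clear hexp
  simp only [Polynomial.coeff_add, Polynomial.coeff_C_mul_X_pow]
  fin_cases i
  · simp
    linear_combination k0
  · simp
    linear_combination 5 * k0 + δ * g1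
  · simp
    linear_combination 10 * k0 + 4 * δ * g1 + δ ^ 2 * g2
  · simp
    linear_combination 10 * k0 + 6 * δ * g1 + 3 * δ ^ 2 * g2 + δ ^ 3 * g3
  · simp
    linear_combination 5 * k0 + 4 * δ * g1 + 3 * δ ^ 2 * g2 + 2 * δ ^ 3 * g3 + δ ^ 4 * g4
  · simp
    linear_combination k0 + δ * g1 + δ ^ 2 * g2 + δ ^ 3 * g3 + δ ^ 4 * g4 + δ ^ 5 * g5
end

open MvPolynomial

section
noncomputable def GG (R : Type*) [CommRing R] : MvPolynomial (Fin 6) R :=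
  X 1 ^ 5 - X 0 ^ 5 + (X 2 ^ 2 - X 5 ^ 2) * X 0 ^ 3 + (X 3 ^ 3 - X 5 ^ 3) * X 0 ^ 2 + (X 4 ^ 4 - X 5 ^ 4) * X 0 ^ 1 + X 5 ^ 5

theorem GG_map {R S : Type*} [CommRing R] [CommRing S] (φ : R →+* S) : map φ (GG R) = GG S := by
  simp [GG]

theorem GG_hom (R : Type*) [CommRing R] : (GG R).IsHomogeneous 5 := by
  have h : ∀ (i : Fin 6) (n : ℕ), (X i ^ n : MvPolynomial (Fin 6) R).IsHomogeneous n := fun i n => by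
    simpa using (isHomogeneous_X R i).pow n
  unfold GG
  exact (((((h 1 5).sub (h 0 5)).add (((h 2 2).sub (h 5 2)).mul (h 0 3))).add (((h 3 3).sub (h 5 3)).mul (h 0 2))).add (((h 4 4).sub (h 5 4)).mul (h 0 1))).add (h 5 5)

theorem GG_zz {R A : Type*} [CommRing R] [CommRing A] [Algebra R A] (ζ : A) : aeval (zz ζ) (GG R) = ζ ^ 5 - 1 := by
  simp [GG, zz]

theorem GG_TP {R A : Type*} [CommRing R] [CommRing A] [Algebra R A] (ζ : A) (v : Fin 6 → A) (hv : v 0 = 0) :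
    TP (GG R) (zz ζ) v = Polynomial.C (ζ ^ 5 - 1) * Polynomial.X ^ 0 + Polynomial.C (5 * ζ ^ 4 * v 1) * Polynomial.X ^ 1 + Polynomial.C (10 * ζ ^ 3 * v 1 ^ 2 + v 2 ^ 2 - v 5 ^ 2) * Polynomial.X ^ 2
      + Polynomial.C (10 * ζ ^ 2 * v 1 ^ 3 + v 3 ^ 3 - v 5 ^ 3) * Polynomial.X ^ 3 + Polynomial.C (5 * ζ * v 1 ^ 4 + v 4 ^ 4 - v 5 ^ 4) * Polynomial.X ^ 4
      + Polynomial.C (v 1 ^ 5 + v 5 ^ 5) * Polynomial.X ^ 5 := by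
  have n : ∀ m : ℕ, (Polynomial.C (m : A) : Polynomial A) = (m : Polynomial A) := fun m => by simp
  have n5 : (Polynomial.C (5 : A) : Polynomial A) = 5 := by exact_mod_cast n 5
  have n10 : (Polynomial.C (10 : A) : Polynomial A) = 10 := by exact_mod_cast n 10
  have z : zz ζ 0 = 1 ∧ zz ζ 1 = ζ ∧ zz ζ 2 = 0 ∧ zz ζ 3 = 0 ∧ zz ζ 4 = 0 ∧ zz ζ 5 = 0 := by simp [zz]
  obtain ⟨z0, z1, z2, z3, z4, z5⟩ := z
  simp only [TP, GG, map_add, map_sub, map_mul, map_pow, aeval_X, z0, z1, z2, z3, z4, z5, hv, n5, n10, Polynomial.C_0, Polynomial.C_1]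
  ring

theorem psiv_GG {R A : Type*} [CommRing R] [CommRing A] [Algebra R A] (ζ : A) (y : Sg → A) :
    psiv (GG R) ζ 0 y = ![5 * ζ ^ 4 * y (true, 0), 5 * ζ ^ 4 * (y (false, 0) - y (true, 0)), 10 * ζ ^ 3 * (y (false, 0) - y (true, 0)) ^ 2 + y (true, 1) ^ 2 - y (false, 2) ^ 2,
      10 * ζ ^ 2 * (y (false, 0) - y (true, 0)) ^ 3 - y (true, 2) ^ 3 - y (false, 2) ^ 3, 5 * ζ * (y (false, 0) - y (true, 0)) ^ 4 + y (false, 1) ^ 4 - y (false, 2) ^ 4,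
      (y (false, 0) - y (true, 0)) ^ 5 + y (false, 2) ^ 5 + gv (pz ζ) 5] := by
  have h1 := GG_TP (R := R) ζ (xs0 y) (by simp [xs0])
  have h2 := GG_TP (R := R) ζ (uu y) (by simp [uu, xs0, vs0])
  funext i
  have x1 : xs0 y 1 = y (true, 0) := by simp [xs0]
  have u : uu y 1 = y (false, 0) - y (true, 0) ∧ uu y 2 = - y (true, 1) ∧ uu y 3 = - y (true, 2) ∧ uu y 4 = y (false, 1) ∧ uu y 5 = y (false, 2) := by
    simp [uu, xs0, vs0]
  obtain ⟨u1, u2, u3, u4, u5⟩ := u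
  rw [u1, u2, u3, u4, u5] at h2
  rw [x1] at h1
  fin_cases i <;> simp [psiv, h1, h2, Polynomial.coeff_C_mul_X_pow, Polynomial.coeff_X, -Polynomial.C_mul, -Polynomial.C_add, -Polynomial.C_sub, -map_mul, -map_add, -map_sub, -map_pow, -map_ofNat, Polynomial.coeff_C] <;> ring

theorem ND_GG {K : Type*} [Field K] [CharZero K] (ζ : K) (hζ : ζ ^ 5 = 1) (y : Sg → K) (hc : gv (pz ζ) 5 ≠ 0) (h1 : y (true, 0) = 0) (h2 : y (false, 0) = 0)
    (h3 : y (true, 1) ^ 2 = y (false, 2) ^ 2) (h4 : y (true, 2) ^ 3 = - y (false, 2) ^ 3) (h5 : y (false, 1) ^ 4 = y (false, 2) ^ 4) (h6 : y (false, 2) ^ 5 = - gv (pz ζ) 5) :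
    NDs (PS (GG K) ζ 0) y := by
  have hu : y (false, 2) ≠ 0 := by
    intro h; rw [h] at h6; apply hc; simpa using h6.symm
  have a1 : y (true, 1) ≠ 0 := by intro h; rw [h] at h3; apply hu; simpa using h3.symm
  have a2 : y (true, 2) ≠ 0 := by intro h; rw [h] at h4; apply hu; simpa using h4.symm
  have a3 : y (false, 1) ≠ 0 := by intro h; rw [h] at h5; apply hu; simpa using h5.symm
  have hζ0 : ζ ≠ 0 := by rintro rfl; simp at hζ
  refine NDs_of_dual (fun i => ?_) (fun t ht => ?_)
  · have := PS_aeval (GG K) ζ 0 y i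
    change aeval y (PS (GG K) ζ 0 i) = 0
    rw [this, map_zero, psiv_GG]
    simp only [Algebra.algebraMap_self, RingHom.id_apply]
    fin_cases i
    · simp [h1]
    · simp [h1, h2]
    · simp [h1, h2, h3]
    · simp [h1, h2, h4]
    · simp [h1, h2, h5]
    · simp [h1, h2, h6]
  · simp only [PS_aeval, map_zero, psiv_GG] at ht
    have hg : gv (pz (algebraMap K (DualNumber K) ζ)) 5 = algebraMap K (DualNumber K) (gv (pz ζ) 5) := by
      rw [gv_hom]; simp only [pz_hom]
    rw [hg] at ht
    simp only [TrivSqZeroExt.algebraMap_eq_inl] at ht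
    have s : ∀ i, TrivSqZeroExt.snd (M := K) _ = 0 := fun i => congrArg TrivSqZeroExt.snd (ht i)
    have q0 := s 0
    have q1 := s 1
    have q2 := s 2
    have q3 := s 3
    have q4 := s 4
    have q5 := s 5
    simp [TrivSqZeroExt.snd_pow, TrivSqZeroExt.fst_pow, h1, h2] at q0 q1 q2 q3 q4 q5
    have f5 : TrivSqZeroExt.fst (5 : DualNumber K) = 5 := TrivSqZeroExt.fst_natCast (R := K) (M := K) 5
    rw [f5] at q0 q1
    have n5 : (5 : K) ≠ 0 := by norm_num
    have t1 : t (true, 0) = 0 := by tauto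
    have t2 : t (false, 0) = 0 := by
      rw [t1, sub_zero] at q1; tauto
    have t3 : t (false, 2) = 0 := by tauto
    rw [t3] at q2 q3 q4
    have t4 : t (true, 1) = 0 := by simpa [a1] using q2
    have t5 : t (true, 2) = 0 := by simpa [a2] using q3
    have t6 : t (false, 1) = 0 := by simpa [a3] using q4
    funext s
    obtain ⟨b, j⟩ := s
    cases b <;> fin_cases j <;> simp [t1, t2, t3, t4, t5, t6]

theorem gv5_ne {K : Type*} [Field K] [CharZero K] (ζ : K) (hζ : ζ ^ 5 = 1) : gv (pz ζ) 5 ≠ 0 := by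
  unfold gv
  rw [Finset.prod_ne_zero_iff]
  intro s _
  rw [Finset.prod_ne_zero_iff]
  intro c _ h
  simp [pz] at h
  have h1 : (c : K) * ζ = -1 := by linear_combination h
  have h2 : (c : K) ^ 5 = -1 := by
    have : ((c : K) * ζ) ^ 5 = (-1) ^ 5 := by rw [h1]
    rw [mul_pow, hζ] at this
    linear_combination this
  have h3 : ((c ^ 5 + 1 : ℕ) : K) = 0 := by push_cast; rw [h2]; ring
  exact absurd (Nat.cast_eq_zero.1 h3) (by omega)

theorem prim_roots (K : Type*) [Field K] [IsAlgClosed K] [CharZero K] (m : ℕ) (hm : 0 < m) : ∃ r : Fin m → K, Function.Injective r ∧ ∀ i, r i ^ m = 1 := by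
  haveI : NeZero (m : K) := ⟨by exact_mod_cast hm.ne'⟩
  obtain ⟨ω, hω⟩ := HasEnoughRootsOfUnity.exists_primitiveRoot K m
  refine ⟨fun i => ω ^ (i : ℕ), fun i j h => ?_, fun i => ?_⟩
  · exact Fin.ext (hω.pow_inj i.2 j.2 h)
  · rw [← pow_mul, mul_comm, pow_mul, hω.pow_eq_one, one_pow]

abbrev I600 := Fin 5 × Fin 5 × Fin 2 × Fin 3 × Fin 4

theorem clusters (K : Type) [Field K] [IsAlgClosed K] [CharZero K] : ∃ (ζ : I600 → K) (y : I600 → Sg → K), (∀ i, ζ i ^ 5 = 1) ∧ (∀ i, NDs (PS (GG K) (ζ i) 0) (y i)) ∧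
    ∀ i j, ζ i = ζ j → y i = y j → i = j := by
  obtain ⟨r5, i5, h5⟩ := prim_roots K 5 (by norm_num)
  obtain ⟨r2, i2, h2⟩ := prim_roots K 2 (by norm_num)
  obtain ⟨r3, i3, h3⟩ := prim_roots K 3 (by norm_num)
  obtain ⟨r4, i4, h4⟩ := prim_roots K 4 (by norm_num)
  choose η hη using fun i : Fin 5 => IsAlgClosed.exists_pow_nat_eq (- gv (pz (r5 i)) 5) (n := 5) (by norm_num)
  have hη0 : ∀ i, η i ≠ 0 := fun i h => by
    have := hη i
    rw [h] at this
    exact gv5_ne (r5 i) (h5 i) (by simpa using this.symm)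
  refine ⟨fun i => r5 i.1, fun i s => if s = (false, 2) then η i.1 * r5 i.2.1 else if s = (true, 1) then η i.1 * r5 i.2.1 * r2 i.2.2.1 else
    if s = (true, 2) then - (η i.1 * r5 i.2.1 * r3 i.2.2.2.1) else if s = (false, 1) then η i.1 * r5 i.2.1 * r4 i.2.2.2.2 else 0, fun i => h5 _, fun i => ?_, ?_⟩
  · apply ND_GG _ (h5 _) _ (gv5_ne _ (h5 _)) <;> simp [mul_pow, h2, h3, h4, h5, hη, Odd.neg_pow (show Odd 3 by decide)]
  · rintro ⟨a, b, c, d, e⟩ ⟨a', b', c', d', e'⟩ h1 h2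
    have := i5 h1
    simp only at this
    subst this
    have w1 := congrFun h2 (false, 2)
    have w2 := congrFun h2 (true, 1)
    have w3 := congrFun h2 (true, 2)
    have w4 := congrFun h2 (false, 1)
    have h50 : ∀ i, r5 i ≠ 0 := fun i h => by have := h5 i; rw [h] at this; simp at this
    simp [hη0] at w1
    have := i5 w1
    subst this
    simp [hη0, h50] at w2 w3 w4
    rw [i2 w2, i3 w3, i4 w4]
end

open MvPolynomial

section
theorem aeval_hom {R S A B σ : Type*} [CommRing R] [CommRing S] [CommRing A] [CommRing B] [Algebra R A] [Algebra S B] (φ : R →+* S) (ψ : A →+* B)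
    (h : ∀ r, ψ (algebraMap R A r) = algebraMap S B (φ r)) (F : MvPolynomial σ R) (x : σ → A) :
    ψ (aeval x F) = aeval (fun j => ψ (x j)) (map φ F) := by
  have := congrArg (fun q => Polynomial.coeff q 0) (TP_hom φ ψ h F x x)
  simpa only [Polynomial.coeff_map, TP_coeff_zero] using this

theorem near_lift {K : Type} [Field K] [CharZero K] (Fr : MvPolynomial (Fin 6) (PowerSeries K)) (hFr : map PowerSeries.constantCoeff Fr = GG K) (ζ : K) (hζ : ζ ^ 5 = 1)
    (y : Sg → K) (hy : NDs (PS (GG K) ζ 0) y) : ∃ (ζ' : PowerSeries K) (y' : Sg → PowerSeries K), PowerSeries.constantCoeff ζ' = ζ ∧ (∀ s, PowerSeries.constantCoeff (y' s) = y s) ∧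
      aeval (zz ζ') Fr = 0 ∧ NDs (PS Fr ζ' 0) y' := by
  obtain ⟨P, h1, h2⟩ := hensel_ND (ι := Unit) (κ := Unit) rfl (fun _ => aeval (zz (X () : MvPolynomial Unit (PowerSeries K))) Fr) (fun _ => ζ) (by
    have e : map PowerSeries.constantCoeff (aeval (zz (X () : MvPolynomial Unit (PowerSeries K))) Fr) = X () ^ 5 - 1 := by
      rw [aeval_hom PowerSeries.constantCoeff (map PowerSeries.constantCoeff : MvPolynomial Unit (PowerSeries K) →+* MvPolynomial Unit K) (fun r => by simp [MvPolynomial.algebraMap_eq]), hFr]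
      simp only [zz_hom, map_X]
      exact GG_zz _
    simp only [e]
    have hζ0 : ζ ≠ 0 := by rintro rfl; simp at hζ
    refine NDs_of_inj (by simp [hζ]) fun y hy => ?_
    have := hy ()
    simp [hζ0] at this
    funext s; exact this)
  have hz : aeval (zz (P ())) Fr = 0 := by
    have := h2.1 ()
    have e := aeval_hom (RingHom.id _) (eval P : MvPolynomial Unit (PowerSeries K) →+* PowerSeries K) (fun r => by simp [MvPolynomial.algebraMap_eq]) Fr (zz (X ()))
    rw [map_id] at e
    simp only [zz_hom, eval_X] at e
    rw [← e]; exact this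
  obtain ⟨Y, h3, h4⟩ := hensel_ND (ι := Sg) (κ := Fin 6) (by simp [Sg]) (PS Fr (P ()) 0) y (by
    simp only [PS_map, hFr, h1, map_zero]
    exact hy)
  exact ⟨P (), Y, h1 (), h3, hz, h4⟩

theorem near_zero {k : Type} [Field k] {F : MvPolynomial (Fin 6) k} (hF : F.IsHomogeneous 5) (ζ : k) (hz : aeval (zz ζ) F = 0) (y : Sg → k) (hy : NDs (PS F ζ 0) y) :
    ∃ Y : Sg → PowerSeries k, (∀ s, PowerSeries.constantCoeff (Y s) = y s) ∧ ∀ i : Fin 6, eval (fun s => pz (PowerSeries.C ζ) s + PowerSeries.X * Y s) (map PowerSeries.C (ff F i)) + PowerSeries.X ^ (if i = 5 then 5 else 6) * eval (fun s => pz (PowerSeries.C ζ) s + PowerSeries.X * Y s) (map PowerSeries.C (gg k (TT 5 i))) = 0 := by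
  obtain ⟨Y, h3, h4⟩ := hensel_ND (ι := Sg) (κ := Fin 6) (by simp [Sg]) (PS (map PowerSeries.C F) (PowerSeries.C ζ) PowerSeries.X) y (by
    simp only [PS_map, map_cc_C, PowerSeries.constantCoeff_X, PowerSeries.constantCoeff_C]
    exact hy)
  refine ⟨Y, h3, fun i => ?_⟩
  have e := psi_zero (R := PowerSeries k) (A := PowerSeries k) (hF.map PowerSeries.C) (PowerSeries.C ζ) PowerSeries.X Y (by
    have := aeval_hom (R := k) (A := k) PowerSeries.C PowerSeries.C (fun r => rfl) F (zz ζ)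
    rw [hz, map_zero] at this
    simp only [zz_hom] at this
    exact this.symm) (fun i => by
      have := h4.1 i
      have e := PS_aeval (A := PowerSeries k) (map PowerSeries.C F) (PowerSeries.C ζ) PowerSeries.X Y i
      exact e.symm.trans this) i
  rw [← ff_aeval, ← ff_map, ← gg_gv (R := k)] at e
  rw [eval_map (p := gg k (TT 5 i))]
  exact e

theorem pz_degenerate {k : Type} [Field k] {F : MvPolynomial (Fin 6) k} (hF : F.IsHomogeneous 5) (ζ : k) : ¬ NDs (fun i : Fin 6 => ff F i) (pz ζ) := by
  intro h
  have key : ∀ y : Sg → k, y (true, 0) = 0 → y (false, 0) = 0 → y (false, 1) = 0 → y (false, 2) = 0 →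
      aeval (zz ζ) (pderiv 2 F) * y (true, 1) + aeval (zz ζ) (pderiv 3 F) * y (true, 2) = 0 → y = 0 := by
    intro y y1 y2 y3 y4 y5
    refine NDs_inj h y fun i => ?_
    have e1 := ff_dual F (pz ζ) y i
    rw [dual_eval] at e1
    have e2 := congrArg TrivSqZeroExt.snd e1
    simp only [xs_pz, vs_pz] at e2
    simp at e2
    refine Eq.trans e2 ?_
    have v0 : vs0 y = 0 := by funext j; fin_cases j <;> simp [vs0, y2, y3, y4]
    have : DTP F (zz ζ) (zz ζ) (xs0 y) (vs0 y) = 0 := by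
      unfold DTP
      have t : ∀ j, TP (pderiv j F) (zz ζ) (zz ζ) = (1 + Polynomial.X) ^ 4 * Polynomial.C (aeval (zz ζ) (pderiv j F)) := by
        intro j
        have := hom_scale (hF.pderiv (i := j)) (1 + Polynomial.X : Polynomial k) (fun j => Polynomial.C (zz ζ j))
        have q : aeval (fun j => Polynomial.C (zz ζ j)) (pderiv j F) = Polynomial.C (aeval (zz ζ) (pderiv j F)) := aeval_algebraMap_apply (R := k) (Polynomial k) (zz ζ) _
        rw [q] at this
        refine Eq.trans ?_ this
        unfold TP
        have r : (fun j => Polynomial.C (zz ζ j) + Polynomial.X * Polynomial.C (zz ζ j)) = fun j => (1 + Polynomial.X) * Polynomial.C (zz ζ j) := by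
          funext j; ring
        rw [r]
      simp only [t, v0, Pi.zero_apply, Polynomial.C_0, mul_zero, add_zero]
      have := congrArg Polynomial.C y5
      simp only [Polynomial.C_add, Polynomial.C_mul, Polynomial.C_0] at this
      rw [Fin.sum_univ_six]
      simp [xs0, y1]
      change Polynomial.C (eval (zz ζ) (pderiv 2 F)) * Polynomial.C (y (true, 1)) + Polynomial.C (eval (zz ζ) (pderiv 3 F)) * Polynomial.C (y (true, 2)) = 0 at this
      linear_combination (1 + Polynomial.X) ^ 4 * this
    rw [this]; simp
  by_cases h2 : aeval (zz ζ) (pderiv 2 F) = 0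
  · have := key (fun s => if s = (true, 1) then 1 else 0) (by simp) (by simp) (by simp) (by simp) (by simp [h2])
    simpa using congrFun this (true, 1)
  · have := key (fun s => if s = (true, 1) then aeval (zz ζ) (pderiv 3 F) else if s = (true, 2) then - aeval (zz ζ) (pderiv 2 F) else 0) (by simp) (by simp) (by simp) (by simp) (by simp; ring)
    have := congrFun this (true, 2)
    simp at this
    exact h2 this

theorem amalgam {k L1 L2 : Type} [Field k] [Field L1] [Field L2] (f1 : k →+* L1) (f2 : k →+* L2) : ∃ (Ω : Type) (_ : Field Ω) (g1 : L1 →+* Ω) (g2 : L2 →+* Ω), ∀ x, g1 (f1 x) = g2 (f2 x) := by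
  letI := f1.toAlgebra
  letI := f2.toAlgebra
  obtain ⟨m, hm⟩ := Ideal.exists_maximal (TensorProduct k L1 L2)
  refine ⟨TensorProduct k L1 L2 ⧸ m, Ideal.Quotient.field m, (Ideal.Quotient.mk m).comp (Algebra.TensorProduct.includeLeft (R := k) (S := k) (A := L1) (B := L2) : L1 →+* _), (Ideal.Quotient.mk m).comp (Algebra.TensorProduct.includeRight (R := k) (A := L1) (B := L2) : L2 →+* _), fun x => ?_⟩
  have h1 := (Algebra.TensorProduct.includeLeft (R := k) (S := k) (A := L1) (B := L2)).commutes x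
  have h2 := (Algebra.TensorProduct.includeRight (R := k) (A := L1) (B := L2)).commutes x
  exact congrArg (Ideal.Quotient.mk m) (h1.trans h2.symm)

theorem amalgam2 (K : Type) [Field K] : ∃ (Ω : Type) (_ : Field Ω) (φ0 φ1 : PowerSeries K →+* Ω), Function.Injective φ0 ∧ Function.Injective φ1 ∧ (∀ c, φ0 (PowerSeries.C c) = φ1 (PowerSeries.C c)) ∧ φ0 PowerSeries.X = 1 + φ1 PowerSeries.X := by
  let ι : PowerSeries K →+* FractionRing (PowerSeries K) := algebraMap _ _
  have hι : Function.Injective ι := IsFractionRing.injective _ _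
  let c : Polynomial K →+* PowerSeries K := Polynomial.coeToPowerSeries.ringHom
  have hc : Function.Injective c := Polynomial.coe_injective K
  let t : Polynomial K →+* Polynomial K := Polynomial.compRingHom (Polynomial.X + Polynomial.C 1)
  have ht : Function.Injective t := Polynomial.taylor_injective 1
  have h1 : Function.Injective (ι.comp c) := hι.comp hc
  have h2 : Function.Injective ((ι.comp c).comp t) := h1.comp ht
  obtain ⟨Ω, inst, g1, g2, hg⟩ := amalgam (IsFractionRing.lift (K := FractionRing (Polynomial K)) h1) (IsFractionRing.lift (K := FractionRing (Polynomial K)) h2)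
  have hg' : ∀ p : Polynomial K, g1 (ι (c p)) = g2 (ι (c (t p))) := fun p => by
    have := hg (algebraMap _ _ p)
    rw [IsFractionRing.lift_algebraMap, IsFractionRing.lift_algebraMap] at this
    exact this
  refine ⟨Ω, inst, g1.comp ι, g2.comp ι, g1.injective.comp hι, g2.injective.comp hι, fun a => ?_, ?_⟩
  · have := hg' (Polynomial.C a)
    simpa [c, t] using this
  · have := hg' Polynomial.X
    simp [c, t] at this
    simp [this, add_comm]
end

open MvPolynomial

section
theorem hom_comb {R : Type*} [CommRing R] {e : ℕ} {F G : MvPolynomial (Fin 6) R} (hF : F.IsHomogeneous e) (hG : G.IsHomogeneous e) (a b : R) : (C a * F + C b * G).IsHomogeneous e := by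
  refine IsHomogeneous.add ?_ ?_
  · have := (isHomogeneous_C (Fin 6) a).mul hF
    rwa [zero_add] at this
  · have := (isHomogeneous_C (Fin 6) b).mul hG
    rwa [zero_add] at this

theorem bound_five {K : Type} [Field K] [IsAlgClosed K] [CharZero K] (F : MvPolynomial (Fin 6) K)
    (hF : F.IsHomogeneous 5) {n : Type} [Fintype n] (p : n → Sg → K) (hp : Function.Injective p) (h : ∀ j, NDs (fun i : Fin 6 => ff F i) (p j)) :
    (Fintype.card n : ℤ) ≤ 6125 := by
  obtain ⟨Ω, inst, φ0, φ1, i0, i1, hC, hX⟩ := amalgam2 K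
  haveI : CharZero Ω := charZero_of_injective_ringHom (φ0.comp PowerSeries.C).injective
  obtain ⟨Fr0, hFr0⟩ : ∃ f : MvPolynomial (Fin 6) (PowerSeries K), f = C (1 - PowerSeries.X) * map PowerSeries.C F + C PowerSeries.X * GG _ := ⟨_, rfl⟩
  obtain ⟨Fr1, hFr1⟩ : ∃ f : MvPolynomial (Fin 6) (PowerSeries K), f = C (- PowerSeries.X) * map PowerSeries.C F + C (1 + PowerSeries.X) * GG _ := ⟨_, rfl⟩
  have r0 : map PowerSeries.constantCoeff Fr0 = F := by
    simp only [hFr0, map_add, map_mul, map_C, map_cc_C, GG_map, map_sub, map_one, PowerSeries.constantCoeff_X]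
    simp
  have r1 : map PowerSeries.constantCoeff Fr1 = GG K := by
    simp only [hFr1, map_add, map_mul, map_C, map_cc_C, GG_map, map_neg, map_one, PowerSeries.constantCoeff_X]
    simp
  obtain ⟨G, hGd⟩ : ∃ f : MvPolynomial (Fin 6) Ω, f = map φ0 Fr0 := ⟨_, rfl⟩
  have hG : map φ1 Fr1 = G := by
    have e : φ0.comp PowerSeries.C = φ1.comp PowerSeries.C := RingHom.ext hC
    simp only [hGd, hFr0, hFr1, map_add, map_mul, map_C, map_map, GG_map, map_sub, map_neg, map_one, e, hX]
    ring
  have hGh : G.IsHomogeneous 5 := by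
    rw [hGd, hFr0]
    exact IsHomogeneous.map (hom_comb (hF.map PowerSeries.C) (GG_hom _) _ _) _
  -- zeros away from the diagonal
  choose Q hQ hQn using fun j => hensel_ND (ι := Sg) (κ := Fin 6) (by simp [Sg]) (fun i : Fin 6 => ff Fr0 i) (p j) (by
    simp only [ff_map, r0]; exact h j)
  have hQ0 : ∀ j, NDs (fun i : Fin 6 => ff G i) (fun s => φ0 (Q j s)) := fun j => by
    have := NDs_map φ0 (hQn j)
    simpa only [ff_map, ← hGd] using this
  choose P hP hPz using fun j => lift_zero (fun i : Fin 6 => ff G i) (fun i => gg Ω (TT 5 i)) (fun i => if i = 5 then 5 else 6) (by intro i; split_ifs <;> norm_num) _ (hQ0 j)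
  -- clusters
  obtain ⟨ζ, y, hζ, hy, hinj⟩ := clusters K
  choose ζ' y' hζ' hy' hz' hn' using fun i => near_lift Fr1 r1 (ζ i) (hζ i) (y i) (hy i)
  have hn1 : ∀ i, NDs (PS G (φ1 (ζ' i)) 0) (fun s => φ1 (y' i s)) := fun i => by
    have := NDs_map φ1 (hn' i)
    simp only [PS_map, hG, map_zero] at this
    exact this
  have hz1 : ∀ i, aeval (zz (φ1 (ζ' i))) G = 0 := fun i => by
    have := aeval_hom (R := PowerSeries K) (A := PowerSeries K) φ1 φ1 (fun r => rfl) Fr1 (zz (ζ' i))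
    rw [hz' i, map_zero, hG] at this
    simp only [zz_hom] at this
    exact this.symm
  choose Y hY hYz using fun i => near_zero hGh (φ1 (ζ' i)) (hz1 i) _ (hn1 i)
  have ccn : ∀ i s, PowerSeries.constantCoeff (pz (PowerSeries.C (φ1 (ζ' i))) s + PowerSeries.X * Y i s) = pz (φ1 (ζ' i)) s := fun i s => by
    rw [map_add, map_mul, PowerSeries.constantCoeff_X, zero_mul, add_zero, pz_hom, PowerSeries.constantCoeff_C]
  have main := bezout_ps (d := 5) le_rfl hGh (fun i => if i = 5 then 5 else 6) (by intro i; split_ifs <;> norm_num) (n := n ⊕ I600)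
    (Sum.elim P (fun i s => pz (PowerSeries.C (φ1 (ζ' i))) s + PowerSeries.X * Y i s)) (by
      have hne : ∀ j i, P j ≠ fun s => pz (PowerSeries.C (φ1 (ζ' i))) s + PowerSeries.X * Y i s := by
        intro j i e
        apply pz_degenerate hGh (φ1 (ζ' i))
        have : (fun s => φ0 (Q j s)) = pz (φ1 (ζ' i)) := by
          funext s
          rw [← ccn i s, ← hP j s, e]
        rw [← this]
        exact hQ0 j
      rintro (j | i) (j' | i') e
      · simp only [Sum.elim_inl] at e
        congr 1
        apply hp
        funext s
        have : φ0 (Q j s) = φ0 (Q j' s) := by rw [← hP, ← hP, e]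
        rw [← hQ, ← hQ, i0 this]
      · exact absurd e (hne j i')
      · exact absurd e.symm (hne j' i)
      · simp only [Sum.elim_inr] at e
        congr 1
        have e1 : ζ' i = ζ' i' := by
          apply i1
          have := congrArg PowerSeries.constantCoeff (congrFun e (true, 0))
          rw [ccn, ccn] at this
          simpa [pz] using this
        apply hinj
        · rw [← hζ', ← hζ', e1]
        · funext s
          have := congrFun e s
          simp only [e1] at this
          have h2 : Y i s = Y i' s := mul_left_cancel₀ PowerSeries.X_ne_zero (add_left_cancel this)
          have h3 : φ1 (y' i s) = φ1 (y' i' s) := by rw [← hY, ← hY, h2]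
          rw [← hy', ← hy', i1 h3]) (by
      rintro (j | i) k
      · exact hPz j k
      · exact hYz i k)
  rw [Fintype.card_sum] at main
  have : Fintype.card I600 = 600 := by simp [I600]
  rw [this] at main
  push_cast at main
  norm_num at main
  linarith

theorem bound_all {K : Type} [Field K] [IsAlgClosed K] [CharZero K]
    (d : ℕ) (hd : 5 ≤ d) (F : MvPolynomial (Fin 6) K) (hF : F.IsHomogeneous d)
    (hsmooth : ∀ x : Fin 6 → K, (∀ i, MvPolynomial.eval x (MvPolynomial.pderiv i F) = 0) → x = 0) (S : Finset (Submodule K (Fin 6 → K)))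
    (hS : ∀ W ∈ S, Module.finrank K W = 3 ∧ ∀ w ∈ W, MvPolynomial.eval w F = 0) : (S.card : ℤ) ≤ 120*(d:ℤ)^2 - 150*(d:ℤ)^3 + 35*(d:ℤ)^4 := by
  obtain ⟨F', p, h1, h2, h3⟩ := C5_main hd F hF hsmooth (n := S) (fun W => W.1) Subtype.val_injective (fun W => (hS W.1 W.2).1) (fun W => (hS W.1 W.2).2)
  have hc : Fintype.card S = S.card := Fintype.card_coe S
  rw [← hc]
  rcases hd.eq_or_lt with rfl | h6
  · refine (bound_five F' h1 p h2 h3).trans ?_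
    norm_num
  · refine (bound_ge hd F' h1 p h2 h3).trans ?_
    obtain ⟨e, rfl⟩ := Nat.exists_eq_add_of_le h6
    push_cast
    have : (0 : ℤ) ≤ e := by positivity
    have h : (0:ℤ) ≤ (5 + 1 + e) * (35 * e ^ 3 + 255 * e ^ 2 + 496 * e + 156) := by positivity
    nlinarith [h]
end

/-- **Bound on the number of 2-planes in a smooth hypersurface in `P^5`.**
Let `K` be an algebraically closed field of characteristic zero and `F ∈ K[x_0,…,x_5]`
homogeneous of degree `d ≥ 5` defining a smooth hypersurface `X ⊂ P^5` (the only common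
zero of its partial derivatives is the origin). Then the set of 3-dimensional linear
subspaces `W ⊆ K^6` on which `F` vanishes identically (equivalently, the 2-planes
contained in `X`) is finite, of cardinality at most `120d² − 150d³ + 35d⁴`. -/
theorem planes_in_smooth_hypersurface_bound {K : Type} [Field K] [IsAlgClosed K] [CharZero K]
    (d : ℕ) (hd : 5 ≤ d) (F : MvPolynomial (Fin 6) K) (hF : F.IsHomogeneous d)
    (hsmooth : ∀ x : Fin 6 → K,
      (∀ i, MvPolynomial.eval x (MvPolynomial.pderiv i F) = 0) → x = 0) :
    {W : Submodule K (Fin 6 → K) |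
        Module.finrank K W = 3 ∧ ∀ w ∈ W, MvPolynomial.eval w F = 0}.Finite ∧
      (Nat.card {W : Submodule K (Fin 6 → K) |
          Module.finrank K W = 3 ∧ ∀ w ∈ W, MvPolynomial.eval w F = 0} : ℤ) ≤
        120 * (d : ℤ) ^ 2 - 150 * (d : ℤ) ^ 3 + 35 * (d : ℤ) ^ 4 := by
  have hb := bound_all d hd F hF hsmooth
  have hfin : {W : Submodule K (Fin 6 → K) |
        Module.finrank K W = 3 ∧ ∀ w ∈ W, MvPolynomial.eval w F = 0}.Finite := by
    by_contra hinf
    obtain ⟨S, hS, hc⟩ := Set.Infinite.exists_subset_card_eq hinf ((120 * (d : ℤ) ^ 2 - 150 * (d : ℤ) ^ 3 + 35 * (d : ℤ) ^ 4).toNat + 1)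
    have := hb S (fun W hW => hS hW)
    rw [hc] at this
    push_cast at this
    have := Int.self_le_toNat (120 * (d : ℤ) ^ 2 - 150 * (d : ℤ) ^ 3 + 35 * (d : ℤ) ^ 4)
    omega
  refine ⟨hfin, ?_⟩
  have := hb hfin.toFinset (fun W hW => by simpa using hW)
  rwa [← Nat.card_eq_card_finite_toFinset hfin] at this
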